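/- (Γ-convergence on the Sobolev space) The family of functionals F_ε Γ-converges, as ε → 0, for the strong L^1(Ω;ℝ^d)-topology, at every u ∈ W^{1,1}(Ω;M) to the functional F_hom(u) := ∫_Ω Tf_hom(u(x), ∇u(x)) dx. -/

import Mathlib

open MeasureTheory Filter Set
open scoped ENNReal RealInnerProductSpace Topology NNReal

noncomputable section

/-- Euclidean space `ℝ^N`. -/
abbrev EN (N : ℕ) : Type := EuclideanSpace ℝ (Fin N)

/-- `d × N` matrices, viewed as continuous linear maps `ℝ^N → ℝ^d`. -/
abbrev Mat (d N : ℕ) : Type := EN N →L[ℝ] EN d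

variable {N d : ℕ}

/-- The tangent set of `M ⊆ ℝ^d` at `s`: velocities of curves in `M` through `s`. -/
def TangentSet (M : Set (EN d)) (s : EN d) : Set (EN d) :=
  {v | ∃ γ : ℝ → EN d, (∀ t, γ t ∈ M) ∧ γ 0 = s ∧ HasDerivAt γ v 0}

/-- A matrix `ξ ∈ ℝ^{d×N}` has all its columns in the tangent space `T_s M`,
i.e. `ξ ∈ [T_s M]^N`. -/
def TangentCols (M : Set (EN d)) (s : EN d) (ξ : Mat d N) : Prop :=
  ∀ i : Fin N, ξ (EuclideanSpace.single i 1) ∈ TangentSet M s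

/-- `T` is a smooth `m`-dimensional submanifold (without boundary) of `ℝ^n`,
described locally as a regular level set. -/
def IsSubmanifoldDim (n m : ℕ) (T : Set (EN n)) : Prop :=
  ∀ x ∈ T, ∃ (U : Set (EN n)) (F : EN n → EN (n - m)),
    IsOpen U ∧ x ∈ U ∧ ContDiffOn ℝ (⊤ : ℕ∞) F U ∧
    (T ∩ U = {y ∈ U | F y = 0}) ∧ ∀ y ∈ U, Function.Surjective (fderiv ℝ F y)

/-- `M` is a nonempty compact connected smooth submanifold of `ℝ^d` without boundary. -/
def IsNiceManifold (d : ℕ) (M : Set (EN d)) : Prop :=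
  M.Nonempty ∧ IsCompact M ∧ IsConnected M ∧ ∃ m : ℕ, m ≤ d ∧ IsSubmanifoldDim d m M

/-- A finite union of subsets of `(N-2)`-dimensional submanifolds of `ℝ^N`. -/
def IsSigmaSet (N : ℕ) (Sg : Set (EN N)) : Prop :=
  ∃ (k : ℕ) (S : Fin k → Set (EN N)), Sg = ⋃ i, S i ∧
    ∀ i, ∃ T : Set (EN N), IsSubmanifoldDim N (N - 2) T ∧ S i ⊆ T

/-- `u ∈ W^{1,1}(A;ℝ^d)` with weak gradient `Du`. -/
def MemW11 (A : Set (EN N)) (u : EN N → EN d) (Du : EN N → Mat d N) : Prop :=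
  IntegrableOn u A volume ∧ IntegrableOn Du A volume ∧
    ∀ φ : EN N → ℝ, ContDiff ℝ (⊤ : ℕ∞) φ → HasCompactSupport φ → tsupport φ ⊆ A →
      ∀ y : EN N, ∫ x in A, fderiv ℝ φ x y • u x = - ∫ x in A, φ x • Du x y

/-- `u` takes values in `M` almost everywhere on `A`. -/
def AeIn (A : Set (EN N)) (u : EN N → EN d) (M : Set (EN d)) : Prop :=
  ∀ᵐ x ∂(volume.restrict A), u x ∈ M

/-- Recession function of `h : ℝ^{d×N} → ℝ`: `h^∞(ξ) = limsup_{t→∞} h(tξ)/t`. -/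
def recc (h : Mat d N → ℝ) (ξ : Mat d N) : ℝ :=
  Filter.limsup (fun t : ℝ => h (t • ξ) / t) Filter.atTop

/-- The open cube `(0,t)^N`. -/
def posCube (N : ℕ) (t : ℝ) : Set (EN N) := {x | ∀ i, x i ∈ Set.Ioo (0 : ℝ) t}

/-- The open unit cube `(-1/2,1/2)^N`. -/
def unitCube (N : ℕ) : Set (EN N) := {x | ∀ i, x i ∈ Set.Ioo (-(1/2) : ℝ) (1/2)}

/-- The cell infimum over `W^{1,∞}_0((0,t)^N; T_s M)` defining `Tf_hom`. -/
def tanCell (f : EN N → Mat d N → ℝ) (M : Set (EN d)) (s : EN d) (ξ : Mat d N)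
    (t : ℝ) : ℝ :=
  sInf {c : ℝ | ∃ (φ : EN N → EN d) (K : ℝ≥0), LipschitzWith K φ ∧
    (∀ x, φ x ∈ TangentSet M s) ∧ (∀ x, x ∉ posCube N t → φ x = 0) ∧
    c = (t ^ N)⁻¹ * ∫ x in posCube N t, f x (ξ + fderiv ℝ φ x)}

/-- The tangentially homogenized density `Tf_hom` (the limit as `t → ∞`,
realized as a limsup). -/
def Tfhom (f : EN N → Mat d N → ℝ) (M : Set (EN d)) (s : EN d) (ξ : Mat d N) : ℝ :=
  Filter.limsup (fun t => tanCell f M s ξ t) Filter.atTop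

/-- The unconstrained cell infimum over `W^{1,∞}_0((0,t)^N; ℝ^d)`. -/
def freeCell (h : EN N → Mat d N → ℝ) (ξ : Mat d N) (t : ℝ) : ℝ :=
  sInf {c : ℝ | ∃ (φ : EN N → EN d) (K : ℝ≥0), LipschitzWith K φ ∧
    (∀ x, x ∉ posCube N t → φ x = 0) ∧
    c = (t ^ N)⁻¹ * ∫ x in posCube N t, h x (ξ + fderiv ℝ φ x)}

/-- The usual homogenized density of a parametrized integrand `g(y,s,ξ)`. -/
def ghomOf (g : EN N → EN d → Mat d N → ℝ) (s : EN d) (ξ : Mat d N) : ℝ :=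
  Filter.limsup (fun t => freeCell (fun y => g y s) ξ t) Filter.atTop

/-- The open cube of side `t` centered at the origin adapted to the
orthonormal basis `B`. -/
def obCube (B : OrthonormalBasis (Fin N) ℝ (EN N)) (t : ℝ) : Set (EN N) :=
  {x | ∀ i, ⟪x, B i⟫ ∈ Set.Ioo (-(t / 2)) (t / 2)}

/-- Surface cell infimum at scale `t`: infimum of `t^{1-N} ∫_{tQ_ν} h(y,∇φ)` over
`φ ∈ W^{1,1}(tQ_ν;M)` with `φ = a` on `∂(tQ_ν) ∩ {x·ν₁ > 0}` and `φ = b`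
on `∂(tQ_ν) ∩ {x·ν₁ ≤ 0}`. -/
def surfCell (h : EN N → Mat d N → ℝ) (M : Set (EN d)) (a b : EN d) (ν₁ : EN N)
    (B : OrthonormalBasis (Fin N) ℝ (EN N)) (t : ℝ) : ℝ :=
  sInf {c : ℝ | ∃ (φ : EN N → EN d) (Dφ : EN N → Mat d N),
    MemW11 (obCube B t) φ Dφ ∧ AeIn (obCube B t) φ M ∧
    (∀ x ∈ frontier (obCube B t),
      (0 < ⟪x, ν₁⟫ → φ x = a) ∧ (⟪x, ν₁⟫ ≤ 0 → φ x = b)) ∧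
    c = (t ^ (N - 1))⁻¹ * ∫ x in obCube B t, h x (Dφ x)}

/-- Surface cell infimum where moreover the adapted cube is chosen with two of
its faces orthogonal to `ν₁`. -/
def thetaCell (h : EN N → Mat d N → ℝ) (M : Set (EN d)) (a b : EN d) (ν₁ : EN N)
    (t : ℝ) : ℝ :=
  sInf {c : ℝ | ∃ B : OrthonormalBasis (Fin N) ℝ (EN N), (∃ i, B i = ν₁) ∧
    c = surfCell h M a b ν₁ B t}

/-- The homogenized surface energy density `θ_hom` (built from `f^∞`). -/
def thetaHom (f : EN N → Mat d N → ℝ) (M : Set (EN d)) (a b : EN d) (ν₁ : EN N) : ℝ :=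
  Filter.limsup (fun t => thetaCell (fun y => recc (f y)) M a b ν₁ t) Filter.atTop

/-- Strong `L¹(A;ℝ^d)`-convergence of a family `v ε → u` as `ε → 0⁺`. -/
def TendstoL1 (A : Set (EN N)) (v : ℝ → EN N → EN d) (u : EN N → EN d) : Prop :=
  Filter.Tendsto (fun ε => ∫ x in A, ‖v ε x - u x‖) (nhdsWithin 0 (Set.Ioi 0)) (nhds 0)

/-- Γ-convergence as `ε → 0⁺` of the family `Fε` at the point `u`
(for the strong `L¹(A)`-topology) to the value `c`. -/
def GammaConvergesAt (Fε : ℝ → (EN N → EN d) → ℝ≥0∞) (A : Set (EN N))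
    (u : EN N → EN d) (c : ℝ≥0∞) : Prop :=
  (∀ v : ℝ → EN N → EN d, TendstoL1 A v u →
      c ≤ Filter.liminf (fun ε => Fε ε (v ε)) (nhdsWithin 0 (Set.Ioi 0))) ∧
  (∃ v : ℝ → EN N → EN d, TendstoL1 A v u ∧
      Filter.limsup (fun ε => Fε ε (v ε)) (nhdsWithin 0 (Set.Ioi 0)) ≤ c)

/-- The localized functional `F_ε(u,A) = ∫_A f(x/ε,∇u) dx` if
`u ∈ W^{1,1}(A;M)`, and `+∞` otherwise. -/
def FepsSet (f : EN N → Mat d N → ℝ) (M : Set (EN d)) (ε : ℝ) (u : EN N → EN d)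
    (A : Set (EN N)) : ℝ≥0∞ :=
  ⨅ (Du : EN N → Mat d N) (_ : MemW11 A u Du ∧ AeIn A u M),
    ENNReal.ofReal (∫ x in A, f (ε⁻¹ • x) (Du x))

/-- The localized Γ-lower limit
`F(u,A) = inf { liminf_n F_{ε_n}(u_n,A) : u_n → u in L¹(A) }`. -/
def GammaLow (f : EN N → Mat d N → ℝ) (M : Set (EN d)) (εseq : ℕ → ℝ)
    (u : EN N → EN d) (A : Set (EN N)) : ℝ≥0∞ :=
  ⨅ (v : ℕ → EN N → EN d)
    (_ : Filter.Tendsto (fun n => ∫ x in A, ‖v n x - u x‖) Filter.atTop (nhds 0)),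
    Filter.liminf (fun n => FepsSet f M (εseq n) (v n) A) Filter.atTop

/-- Extension of `F(u,·)` to arbitrary sets `B ⊆ Ω` by outer regularity. -/
def GammaLowB (f : EN N → Mat d N → ℝ) (M : Set (EN d)) (εseq : ℕ → ℝ)
    (u : EN N → EN d) (Ω B : Set (EN N)) : ℝ≥0∞ :=
  ⨅ (A : Set (EN N)) (_ : IsOpen A ∧ A ⊆ Ω ∧ B ⊆ A), GammaLow f M εseq u A

/-- A package certifying `u ∈ BV(Ω;ℝ^d)`, with all its measure-theoretic
attributes: absolutely continuous gradient `grad = ∇u`, approximate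
discontinuity (jump) set `S`, traces `up = u⁺`, `um = u⁻`, normal `nu = ν_u`,
approximate limit `ap = ũ`, Cantor part `cm = |D^c u|` with polar density
`cd = dD^cu/d|D^cu|`. -/
structure BVPack (Ω : Set (EN N)) (u : EN N → EN d) where
  grad : EN N → Mat d N
  S : Set (EN N)
  up : EN N → EN d
  um : EN N → EN d
  nu : EN N → EN N
  ap : EN N → EN d
  cm : Measure (EN N)
  cd : EN N → Mat d N
  integrable : IntegrableOn u Ω volume
  grad_int : IntegrableOn grad Ω volume
  S_meas : MeasurableSet S
  cm_fin : cm Set.univ ≠ ⊤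
  cm_in : cm Ωᶜ = 0
  jump_int : IntegrableOn (fun x => ‖up x - um x‖) (Ω ∩ S) (μH[(N : ℝ) - 1])
  nu_unit : ∀ x ∈ S, ‖nu x‖ = 1
  jump_ne : ∀ x ∈ S, up x ≠ um x
  cd_unit : ∀ᵐ x ∂cm, ‖cd x‖ = 1
  cm_sing : cm ⟂ₘ (volume : Measure (EN N))
  cm_nojump : cm S = 0
  ap_lim : ∀ x ∈ Ω \ S,
    Filter.Tendsto
      (fun r : ℝ => (volume (Metric.ball x r)).toReal⁻¹ *
        ∫ y in Metric.ball x r, ‖u y - ap x‖)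
      (nhdsWithin 0 (Set.Ioi 0)) (nhds 0)
  jump_lim_up : ∀ x ∈ Ω ∩ S,
    Filter.Tendsto
      (fun r : ℝ => (volume (Metric.ball x r)).toReal⁻¹ *
        ∫ y in {y ∈ Metric.ball x r | 0 < ⟪y - x, nu x⟫}, ‖u y - up x‖)
      (nhdsWithin 0 (Set.Ioi 0)) (nhds 0)
  jump_lim_um : ∀ x ∈ Ω ∩ S,
    Filter.Tendsto
      (fun r : ℝ => (volume (Metric.ball x r)).toReal⁻¹ *
        ∫ y in {y ∈ Metric.ball x r | ⟪y - x, nu x⟫ < 0}, ‖u y - um x‖)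
      (nhdsWithin 0 (Set.Ioi 0)) (nhds 0)
  decomp : ∀ φ : EN N → ℝ, ContDiff ℝ (⊤ : ℕ∞) φ → HasCompactSupport φ → tsupport φ ⊆ Ω →
    ∀ y : EN N,
      ∫ x in Ω, fderiv ℝ φ x y • u x =
        -(∫ x in Ω, φ x • grad x y) - (∫ x, φ x • cd x y ∂cm) -
          ∫ x in Ω ∩ S, (⟪nu x, y⟫ * φ x) • (up x - um x) ∂(μH[(N : ℝ) - 1])

/-- The total variation measure `|Du|` associated to a BV package. -/
def totalVar (Ω : Set (EN N)) (u : EN N → EN d) (P : BVPack Ω u) : Measure (EN N) :=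
  ((volume.restrict Ω).withDensity fun x => ENNReal.ofReal ‖P.grad x‖) + P.cm +
    ((μH[(N : ℝ) - 1]).restrict (Ω ∩ P.S)).withDensity
      fun x => ENNReal.ofReal ‖P.up x - P.um x‖

/-- The standing assumptions (Carathéodory, (H1), (H2), (H3)) on the
integrand `f`. -/
structure StdIntegrand (N d : ℕ) (f : EN N → Mat d N → ℝ) (α β L : ℝ) : Prop where
  meas : ∀ ξ : Mat d N, Measurable fun y => f y ξ
  nonneg : ∀ y ξ, 0 ≤ f y ξ
  periodic : ∀ (y : EN N) (ξ : Mat d N) (i : Fin N),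
    f (y + EuclideanSpace.single i 1) ξ = f y ξ
  alpha_pos : 0 < α
  alpha_le_beta : α ≤ β
  growth : ∀ᵐ y ∂(volume : Measure (EN N)), ∀ ξ,
    α * ‖ξ‖ ≤ f y ξ ∧ f y ξ ≤ β * (1 + ‖ξ‖)
  lip_pos : 0 < L
  lip : ∀ᵐ y ∂(volume : Measure (EN N)), ∀ ξ ξ', |f y ξ - f y ξ'| ≤ L * ‖ξ - ξ'‖

/-- Hypothesis (H4): `|f(y,ξ) - f^∞(y,ξ)| ≤ C(1+|ξ|^{1-q})`. -/
def H4 (f : EN N → Mat d N → ℝ) (C q : ℝ) : Prop :=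
  0 < C ∧ 0 < q ∧ q < 1 ∧
    ∀ᵐ y ∂(volume : Measure (EN N)), ∀ ξ,
      |f y ξ - recc (f y) ξ| ≤ C * (1 + ‖ξ‖ ^ (1 - q))

/-- The projection data used to build the modified integrand `g`:
`pr` is the nearest-point projection onto `M` on a `δ₀`-neighborhood,
`tanProj s` is the orthogonal projection of `ℝ^d` onto `T_s M` (for `s ∈ M`),
and `chi` is the smooth cut-off. -/
structure ProjData {d : ℕ} (M : Set (EN d)) where
  δ₀ : ℝ
  pr : EN d → EN d
  chi : EN d → ℝ
  tanProj : EN d → EN d →L[ℝ] EN d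
  δ₀_pos : 0 < δ₀
  pr_mem : ∀ s, Metric.infDist s M < δ₀ → pr s ∈ M
  pr_nearest : ∀ s, Metric.infDist s M < δ₀ → ‖s - pr s‖ = Metric.infDist s M
  pr_lip : ∃ K : ℝ≥0, LipschitzOnWith K pr {s | Metric.infDist s M < δ₀}
  tanProj_lip : ∃ K : ℝ≥0,
    LipschitzOnWith K (fun s => tanProj (pr s)) {s | Metric.infDist s M < δ₀}
  chi_smooth : ContDiff ℝ (⊤ : ℕ∞) chi
  chi_supp : HasCompactSupport chi
  chi_range : ∀ s, chi s ∈ Set.Icc (0 : ℝ) 1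
  chi_one : ∀ s, Metric.infDist s M ≤ δ₀ / 2 → chi s = 1
  chi_zero : ∀ s, 3 * δ₀ / 4 ≤ Metric.infDist s M → chi s = 0
  tanProj_mem : ∀ s ∈ M, ∀ v, tanProj s v ∈ TangentSet M s
  tanProj_id : ∀ s ∈ M, ∀ v ∈ TangentSet M s, tanProj s v = v
  tanProj_symm : ∀ s ∈ M, ∀ v w, ⟪tanProj s v, w⟫ = ⟪v, tanProj s w⟫

/-- The cut-off tangential projection `ℙ_s(ξ) = χ(s) P_{Π(s)} ∘ ξ`. -/
def tanP {M : Set (EN d)} (D : ProjData M) (s : EN d) (ξ : Mat d N) : Mat d N :=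
  D.chi s • ((D.tanProj (D.pr s)).comp ξ)

/-- The modified integrand `g(y,s,ξ) = f(y,ℙ_s(ξ)) + |ξ - ℙ_s(ξ)|`. -/
def gOf {M : Set (EN d)} (D : ProjData M) (f : EN N → Mat d N → ℝ) :
    EN N → EN d → Mat d N → ℝ :=
  fun y s ξ => f y (tanP D s ξ) + ‖ξ - tanP D s ξ‖

/-- The geodesic distance on `M`. -/
def geoDist (M : Set (EN d)) (a b : EN d) : ℝ :=
  sInf {l : ℝ | ∃ γ : ℝ → EN d, ContDiff ℝ (⊤ : ℕ∞) γ ∧ (∀ t, γ t ∈ M) ∧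
    γ 0 = b ∧ γ 1 = a ∧ l = ∫ t in Set.Icc (0 : ℝ) 1, ‖deriv γ t‖}

/-- The class `G(a,b)` of geodesic curves between `a` and `b`. -/
def GeodClass (M : Set (EN d)) (a b : EN d) : Set (ℝ → EN d) :=
  {γ | ContDiff ℝ (⊤ : ℕ∞) γ ∧ (∀ t, γ t ∈ M) ∧ (∀ t : ℝ, 1 / 2 ≤ t → γ t = a) ∧
    (∀ t : ℝ, t ≤ -(1 / 2 : ℝ) → γ t = b) ∧
    (∫ t : ℝ, ‖deriv γ t‖) = geoDist M a b}

/-- `I_ε(a,b,ν)`: infimum of `∫_{Q_ν} h(x/ε,∇u)` over the geodesic-boundary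
class `B_ε(a,b,ν)`. -/
def Ieps (h : EN N → Mat d N → ℝ) (M : Set (EN d)) (a b : EN d) (ν₁ : EN N)
    (B : OrthonormalBasis (Fin N) ℝ (EN N)) (ε : ℝ) : ℝ :=
  sInf {c : ℝ | ∃ (φ : EN N → EN d) (Dφ : EN N → Mat d N) (γ : ℝ → EN d),
    γ ∈ GeodClass M a b ∧ MemW11 (obCube B 1) φ Dφ ∧ AeIn (obCube B 1) φ M ∧
    (∀ x ∈ frontier (obCube B 1), φ x = γ (⟪x, ν₁⟫ / ε)) ∧
    c = ∫ x in obCube B 1, h (ε⁻¹ • x) (Dφ x)}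

/-- `J_ε(a,b,ν)`: infimum of `∫_{Q_ν} h(x/ε,∇u)` with sharp-interface boundary
datum `u_{a,b,ν}`. -/
def Jeps (h : EN N → Mat d N → ℝ) (M : Set (EN d)) (a b : EN d) (ν₁ : EN N)
    (B : OrthonormalBasis (Fin N) ℝ (EN N)) (ε : ℝ) : ℝ :=
  sInf {c : ℝ | ∃ (φ : EN N → EN d) (Dφ : EN N → Mat d N),
    MemW11 (obCube B 1) φ Dφ ∧ AeIn (obCube B 1) φ M ∧
    (∀ x ∈ frontier (obCube B 1),
      (0 < ⟪x, ν₁⟫ → φ x = a) ∧ (⟪x, ν₁⟫ ≤ 0 → φ x = b)) ∧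
    c = ∫ x in obCube B 1, h (ε⁻¹ • x) (Dφ x)}

/-- The defining properties of the interfacial density `K` from the integral
representation on partitions. -/
def IsJumpRepr (Ω : Set (EN N)) (f : EN N → Mat d N → ℝ) (M : Set (EN d))
    (εseq : ℕ → ℝ) (K : EN d → EN d → EN N → ℝ) : Prop :=
  (∀ a ∈ M, ∀ b ∈ M, ∀ ν₁ : EN N, ‖ν₁‖ = 1 → 0 ≤ K a b ν₁) ∧
  (∀ a ∈ M, ∀ b ∈ M, ContinuousOn (K a b) (Metric.sphere (0 : EN N) 1)) ∧
  (∀ a ∈ M, ∀ b ∈ M, ∀ ν₁ : EN N, ‖ν₁‖ = 1 → K a b ν₁ = K b a (-ν₁)) ∧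
  (∀ T : Finset (EN d), (T : Set (EN d)) ⊆ M →
    ∀ (u : EN N → EN d) (P : BVPack Ω u),
      (∀ᵐ x ∂(volume.restrict Ω), u x ∈ (T : Set (EN d))) →
      ∀ S : Set (EN N), MeasurableSet S → S ⊆ Ω ∩ P.S →
        GammaLowB f M εseq u Ω S =
          ENNReal.ofReal
            (∫ x in S, K (P.up x) (P.um x) (P.nu x) ∂(μH[(N : ℝ) - 1])))

end

section
open MeasureTheory Filter Set
open scoped ENNReal RealInnerProductSpace Topology NNReal

/-- continuity of translations in `L¹` -/
theorem hg_translate {N : ℕ} {F : Type*} [NormedAddCommGroup F]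
    {w : EN N → F} (hw : Integrable w) :
    Tendsto (fun h : EN N => ∫ x, ‖w (x + h) - w x‖) (𝓝 0) (𝓝 0) := by
  have mp : ∀ h : EN N, MeasurePreserving (fun x : EN N => x + h) volume volume :=
    fun h => measurePreserving_add_right volume h
  let c : EN N → C(EN N, EN N) := fun h => ⟨fun x => x + h, by fun_prop⟩
  have hc : Continuous c := by
    have : Continuous (fun p : EN N × EN N => p.2 + p.1) := by fun_prop
    exact (ContinuousMap.curry ⟨_, this⟩).continuous
  have hw1 : MemLp w 1 volume := memLp_one_iff_integrable.2 hw
  have key : Continuous fun h : EN N => Lp.compMeasurePreserving (c h) (mp h) (hw1.toLp w) :=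
    Continuous.compMeasurePreservingLp (p := 1) continuous_const hc mp (by simp)
  have k2 := (continuous_iff_continuousAt.1 key 0)
  rw [ContinuousAt, tendsto_iff_dist_tendsto_zero] at k2
  refine k2.congr fun h => ?_
  rw [L1.dist_eq_integral_dist]
  have e1 : (Lp.compMeasurePreserving (c h) (mp h) (hw1.toLp w) : EN N → F) =ᵐ[volume]
      fun x => w (x + h) :=
    (MemLp.coeFn_toLp (hw1.comp_measurePreserving (mp h)))
  have e2 : (Lp.compMeasurePreserving (c 0) (mp 0) (hw1.toLp w) : EN N → F) =ᵐ[volume]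
      fun x => w (x + 0) :=
    (MemLp.coeFn_toLp (hw1.comp_measurePreserving (mp 0)))
  refine integral_congr_ae ?_
  filter_upwards [e1, e2] with x h1 h2
  rw [h1, h2, dist_eq_norm, add_zero]

theorem hg_measurableSet_posCube (N : ℕ) (t : ℝ) : MeasurableSet (posCube N t) := by
  have : posCube N t = ⋂ i, (fun x : EN N => x i) ⁻¹' Set.Ioo (0:ℝ) t := by
    ext x; simp [posCube]
  rw [this]
  exact MeasurableSet.iInter fun i => measurableSet_preimage (by fun_prop) measurableSet_Ioo

theorem hg_isOpen_posCube (N : ℕ) (t : ℝ) : IsOpen (posCube N t) := by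
  have : posCube N t = ⋂ i, (fun x : EN N => x i) ⁻¹' Set.Ioo (0:ℝ) t := by
    ext x; simp [posCube]
  rw [this]
  exact isOpen_iInter_of_finite fun i => isOpen_Ioo.preimage (by fun_prop)

theorem hg_volume_pi (N : ℕ) (S : Fin N → Set ℝ) :
    volume {x : EN N | ∀ i, x i ∈ S i} = ∏ i, volume (S i) := by
  have h := (EuclideanSpace.volume_preserving_symm_measurableEquiv_toLp (Fin N))
  have e : {x : EN N | ∀ i, x i ∈ S i} =
      (MeasurableEquiv.toLp 2 (Fin N → ℝ)).symm ⁻¹' (Set.pi univ S) := by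
    ext x; simp
  rw [e, h.measure_preimage_equiv, volume_pi_pi]

theorem hg_volume_posCube (N : ℕ) (t : ℝ) :
    volume (posCube N t) = ENNReal.ofReal t ^ N := by
  have := hg_volume_pi N (fun _ => Set.Ioo (0:ℝ) t)
  simpa [posCube] using this

/-- norm bound on the cube -/
theorem hg_norm_posCube {N : ℕ} {t : ℝ} {x : EN N} (hx : x ∈ posCube N t) :
    ‖x‖ ≤ N * t := by
  have h1 : ‖x‖ ≤ ∑ i, ‖x i‖ := by
    conv_lhs => rw [← (EuclideanSpace.basisFun (Fin N) ℝ).sum_repr x]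
    refine (norm_sum_le _ _).trans (Finset.sum_le_sum fun i _ => ?_)
    simp [norm_smul]
  refine h1.trans ?_
  calc ∑ i, ‖x i‖ ≤ ∑ _i : Fin N, t := Finset.sum_le_sum fun i _ => by
        have := hx i
        rw [Real.norm_eq_abs, abs_of_pos this.1]; exact this.2.le
    _ = N * t := by simp

/-- abstract Riemann–Lebesgue lemma -/
theorem hg_RL_abs {N : ℕ} {g : EN N → ℝ} (hg : Measurable g) {C : ℝ} (hC : ∀ y, |g y| ≤ C)
    {Q : Set (EN N)} {B : ℝ} (hQB : ∀ z ∈ Q, ‖z‖ ≤ B)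
    (hQ : volume Q ≠ ⊤) (hQm : MeasurableSet Q)
    {m : ℝ} (hm : ∀ x, ∫ z in Q, g (x + z) = m) {h : EN N → ℝ} (hh : Integrable h) :
    Tendsto (fun ε : ℝ => volume.real Q * ∫ x, h x * g (ε⁻¹ • x)) (𝓝[>] 0) (𝓝 (m * ∫ x, h x)) := by
  have hC0 : 0 ≤ C := (abs_nonneg _).trans (hC 0)
  have : IsFiniteMeasure (volume.restrict Q) := ⟨by simpa using hQ.lt_top⟩
  rw [Metric.tendsto_nhds]
  intro η hη
  have ht := hg_translate hh
  rw [Metric.tendsto_nhds] at ht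
  set K := C * volume.real Q + 1
  have hK : 0 < K := by positivity
  obtain ⟨r, hr, hrb⟩ := Metric.eventually_nhds_iff.1 (ht (η / K) (by positivity))
  have hev : ∀ᶠ ε : ℝ in 𝓝[>] 0, ε * (|B| + 1) < r := by
    have : Tendsto (fun ε : ℝ => ε * (|B| + 1)) (𝓝[>] 0) (𝓝 0) := by
      have := (tendsto_id (α := ℝ) (x := 𝓝 0)).mul_const (|B| + 1)
      simp only [id, zero_mul] at this
      exact this.mono_left nhdsWithin_le_nhds
    exact this.eventually (gt_mem_nhds hr)
  filter_upwards [hev, self_mem_nhdsWithin] with ε hε hε0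
  have hε0' : (0:ℝ) < ε := hε0
  -- product integrability
  have hInt0 : Integrable (fun p : EN N × EN N => h p.1 * g (ε⁻¹ • p.1 + p.2))
      ((volume : Measure (EN N)).prod (volume.restrict Q)) := by
    have h1 : Integrable (fun p : EN N × EN N => h p.1)
      ((volume : Measure (EN N)).prod (volume.restrict Q)) := hh.comp_fst _
    refine h1.mul_bdd (c := C) ?_ ?_
    · exact (hg.comp (by fun_prop)).aestronglyMeasurable
    · exact Eventually.of_forall fun p => hC _
  have e1 : m * ∫ x, h x = ∫ z in Q, ∫ x, h x * g (ε⁻¹ • x + z) := by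
    rw [← integral_integral_swap (f := fun x z => h x * g (ε⁻¹ • x + z)) hInt0, ← integral_const_mul]
    refine integral_congr_ae (Eventually.of_forall fun x => ?_)
    simp only
    rw [integral_const_mul, hm, mul_comm]
  have e2 : volume.real Q * ∫ x, h x * g (ε⁻¹ • x) =
      ∫ z in Q, ∫ x, h (x + ε • z) * g (ε⁻¹ • x + z) := by
    have : ∀ z, ∫ x, h (x + ε • z) * g (ε⁻¹ • x + z) = ∫ x, h x * g (ε⁻¹ • x) := by
      intro z
      rw [← integral_add_right_eq_self (fun x => h x * g (ε⁻¹ • x)) (ε • z)]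
      simp only [smul_add, smul_smul, inv_mul_cancel₀ hε0'.ne', one_smul]
    simp only [this, setIntegral_const, smul_eq_mul]
  have hi1 : ∀ z, Integrable (fun x => h (x + ε • z) * g (ε⁻¹ • x + z)) := fun z =>
    (hh.comp_add_right _).mul_bdd (c := C) (hg.comp (by fun_prop)).aestronglyMeasurable
      (Eventually.of_forall fun p => hC _)
  have hi2 : ∀ z, Integrable (fun x => h x * g (ε⁻¹ • x + z)) := fun z =>
    hh.mul_bdd (c := C) (hg.comp (by fun_prop)).aestronglyMeasurable
      (Eventually.of_forall fun p => hC _)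
  have hI1 : Integrable (fun z => ∫ x, h (x + ε • z) * g (ε⁻¹ • x + z)) (volume.restrict Q) := by
    have : ∀ z, ∫ x, h (x + ε • z) * g (ε⁻¹ • x + z) = ∫ x, h x * g (ε⁻¹ • x) := by
      intro z
      rw [← integral_add_right_eq_self (fun x => h x * g (ε⁻¹ • x)) (ε • z)]
      simp only [smul_add, smul_smul, inv_mul_cancel₀ hε0'.ne', one_smul]
    simp only [this]; exact integrable_const _
  have hI2 : Integrable (fun z => ∫ x, h x * g (ε⁻¹ • x + z)) (volume.restrict Q) :=
    hInt0.integral_prod_right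
  rw [dist_eq_norm, e1, e2, ← integral_sub hI1 hI2]
  have bd : ∀ z ∈ Q, ‖(∫ x, h (x + ε • z) * g (ε⁻¹ • x + z)) - ∫ x, h x * g (ε⁻¹ • x + z)‖ ≤
      C * (η / K) := by
    intro z hz
    rw [← integral_sub (hi1 z) (hi2 z)]
    have hd : dist (ε • z) 0 < r := by
      rw [dist_zero_right, norm_smul, Real.norm_eq_abs, abs_of_pos hε0']
      refine lt_of_le_of_lt ?_ hε
      have := (hQB z hz).trans (le_abs_self B)
      gcongr; linarith
    have h3 := hrb hd
    rw [dist_zero_right, Real.norm_eq_abs, abs_of_nonneg (integral_nonneg fun _ => norm_nonneg _)]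
      at h3
    refine (norm_integral_le_integral_norm _).trans ?_
    calc ∫ x, ‖h (x + ε • z) * g (ε⁻¹ • x + z) - h x * g (ε⁻¹ • x + z)‖
        ≤ ∫ x, C * ‖h (x + ε • z) - h x‖ := by
          refine integral_mono ((hi1 z).sub (hi2 z)).norm
            (((hh.comp_add_right _).sub hh).norm.const_mul _) fun x => ?_
          simp only
          rw [← sub_mul, norm_mul, mul_comm]
          exact mul_le_mul_of_nonneg_right (hC _) (norm_nonneg _)
      _ = C * ∫ x, ‖h (x + ε • z) - h x‖ := integral_const_mul _ _
      _ ≤ C * (η / K) := by gcongr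
  have := norm_setIntegral_le_of_norm_le_const (μ := volume) (s := Q) hQ.lt_top bd
  refine this.trans_lt ?_
  have : C * (η / K) * volume.real Q = η * ((C * volume.real Q) / K) := by ring
  rw [this]
  have : (C * volume.real Q) / K < 1 := by rw [div_lt_one hK]; simp [K]
  nlinarith

end

section
open MeasureTheory Filter Set
open scoped ENNReal RealInnerProductSpace Topology NNReal

/-- a.e. equality of half-open and open cubes -/
theorem hg_ico_ae (N : ℕ) (t : ℝ) :
    ({x : EN N | ∀ i, x i ∈ Set.Ico (0:ℝ) t} : Set (EN N)) =ᵐ[volume] posCube N t := by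
  have hsub : posCube N t ⊆ {x : EN N | ∀ i, x i ∈ Set.Ico (0:ℝ) t} :=
    fun x hx i => ⟨(hx i).1.le, (hx i).2⟩
  refine (ae_eq_of_subset_of_measure_ge hsub ?_ (hg_measurableSet_posCube N t).nullMeasurableSet
    ?_).symm
  · rw [hg_volume_posCube, hg_volume_pi]; simp
  · rw [hg_volume_pi]; simp

open scoped Pointwise in
theorem hg_periodic_mean {N : ℕ} {t : ℕ} (ht : 0 < t) {g : EN N → ℝ}
    (hp : ∀ y i, g (y + (t : ℝ) • EuclideanSpace.single i 1) = g y) (x : EN N) :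
    ∫ z in posCube N t, g (x + z) = ∫ z in posCube N t, g z := by
  have ht' : (t:ℝ) ≠ 0 := by positivity
  let b0 : Module.Basis (Fin N) ℝ (EN N) := (EuclideanSpace.basisFun (Fin N) ℝ).toBasis
  let b : Module.Basis (Fin N) ℝ (EN N) := b0.isUnitSMul (w := fun _ => (t:ℝ)) (fun _ => by simpa using ht')
  have hb : ∀ i, b i = (t:ℝ) • EuclideanSpace.single i 1 := by
    intro i; simp [b, b0, Module.Basis.isUnitSMul_apply]
  have hF := ZSpan.isAddFundamentalDomain' b (volume : Measure (EN N))
  have hinv : ∀ (l : (Submodule.span ℤ (Set.range b)).toAddSubgroup) (y : EN N), g (l +ᵥ y) = g y := by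
    rintro ⟨l, hl⟩ y
    change g (l + y) = g y
    have hl' : l ∈ Submodule.span ℤ (Set.range b) := hl
    clear hl
    induction hl' using Submodule.span_induction generalizing y with
    | mem v hv =>
      obtain ⟨i, rfl⟩ := hv
      rw [add_comm, hb, hp]
    | zero => simp
    | add a c _ _ ha hc => rw [add_assoc, ha, hc]
    | smul n v _ hv =>
      have hn : ∀ (k : ℕ) y, g (k • v + y) = g y := by
        intro k; induction k with
        | zero => simp
        | succ k ih => intro y; rw [succ_nsmul, add_assoc, ih, hv]
      obtain ⟨k, rfl | rfl⟩ := n.eq_nat_or_neg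
      · simpa using hn k y
      · have := hn k (-(k • v) + y)
        rw [add_neg_cancel_left] at this
        rw [this]; simp
  have hF2 : IsAddFundamentalDomain (Submodule.span ℤ (Set.range b)).toAddSubgroup (x +ᵥ ZSpan.fundamentalDomain b)
      (volume : Measure (EN N)) := hF.vadd_of_comm x
  have hcnt : Countable (Submodule.span ℤ (Set.range b)) := inferInstance
  have hcnt' : Countable (Submodule.span ℤ (Set.range b)).toAddSubgroup := hcnt
  have h1 := hF2.setIntegral_eq hF hinv
  have hset : ZSpan.fundamentalDomain b = {x : EN N | ∀ i, x i ∈ Set.Ico (0:ℝ) t} := by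
    ext y
    have hbi : ∀ i, b.repr y i = (t:ℝ)⁻¹ * y i := by
      intro i
      have : b.repr y i = (t:ℝ)⁻¹ • b0.repr y i := by
        simp only [b]
        rw [Module.Basis.repr_isUnitSMul]
        simp [Units.smul_def]
      rw [this]; simp [b0]
    have htp : (0:ℝ) < t := by positivity
    simp only [ZSpan.mem_fundamentalDomain, hbi, Set.mem_ofPred_eq, Set.mem_Ico]
    refine forall_congr' fun i => ?_
    rw [inv_mul_lt_iff₀ htp, mul_one]
    refine and_congr_left fun _ => ?_
    exact ⟨fun h => by have := mul_nonneg htp.le h; rwa [mul_inv_cancel_left₀ ht'] at this,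
      fun h => by positivity⟩
  have h2 : ∫ z in x +ᵥ ZSpan.fundamentalDomain b, g z =
      ∫ z in ZSpan.fundamentalDomain b, g (x + z) := by
    have := (measurePreserving_add_left (volume : Measure (EN N)) x).setIntegral_image_emb
      (measurableEmbedding_addLeft x) g (ZSpan.fundamentalDomain b)
    exact this
  rw [h2, hset] at h1
  rw [setIntegral_congr_set (hg_ico_ae N t), setIntegral_congr_set (hg_ico_ae N t)] at h1
  exact h1

theorem hg_volreal_posCube (N : ℕ) {t : ℝ} (ht : 0 ≤ t) : volume.real (posCube N t) = t ^ N := by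
  rw [Measure.real, hg_volume_posCube, ENNReal.toReal_pow, ENNReal.toReal_ofReal ht]

theorem hg_volume_posCube_ne_top (N : ℕ) (t : ℝ) : volume (posCube N t) ≠ ⊤ := by
  rw [hg_volume_posCube]; finiteness

/-- Riemann–Lebesgue for periodic functions -/
theorem hg_RL {N : ℕ} {t : ℕ} (ht : 0 < t) {g : EN N → ℝ} (hg : Measurable g) {C : ℝ}
    (hC : ∀ y, |g y| ≤ C)
    (hp : ∀ y i, g (y + (t : ℝ) • EuclideanSpace.single i 1) = g y)
    {A : Set (EN N)} (hA : MeasurableSet A) (hA' : volume A ≠ ⊤) :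
    Tendsto (fun ε : ℝ => ∫ x in A, g (ε⁻¹ • x)) (𝓝[>] 0)
      (𝓝 (volume.real A * (((t:ℝ) ^ N)⁻¹ * ∫ z in posCube N t, g z))) := by
  have htp : (0:ℝ) < t := by positivity
  have hInt0 : Integrable (A.indicator (1 : EN N → ℝ)) :=
    (integrable_indicator_iff hA).2 (integrableOn_const hA')
  have := hg_RL_abs hg hC (Q := posCube N t) (B := N * t) (fun z hz => hg_norm_posCube hz)
    (hg_volume_posCube_ne_top N t) (hg_measurableSet_posCube N t)
    (m := ∫ z in posCube N t, g z) (hg_periodic_mean ht hp) hInt0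
  have h2 := this.const_mul (((t:ℝ) ^ N)⁻¹)
  have e : ∀ ε : ℝ, ∫ x, A.indicator (1 : EN N → ℝ) x * g (ε⁻¹ • x) = ∫ x in A, g (ε⁻¹ • x) := by
    intro ε
    rw [← integral_indicator hA]
    refine integral_congr_ae (Eventually.of_forall fun x => ?_)
    by_cases hx : x ∈ A <;> simp [hx]
  have e2 : ∫ x, A.indicator (1 : EN N → ℝ) x = volume.real A := by
    rw [integral_indicator hA]; simp
  rw [e2] at h2
  simp only [e, hg_volreal_posCube N htp.le] at h2
  have htN : (t:ℝ) ^ N ≠ 0 := by positivity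
  refine (h2.congr fun ε => ?_).trans (le_of_eq ?_)
  · rw [← mul_assoc, inv_mul_cancel₀ htN, one_mul]
  · congr 1; ring

/-! measurability of compositions -/

/-- a modification of `f`, jointly measurable -/
theorem hg_modif {N d : ℕ} {f : EN N → Mat d N → ℝ} {α β L : ℝ} (hf : StdIntegrand N d f α β L) :
    ∃ f' : EN N → Mat d N → ℝ, Measurable (Function.uncurry f') ∧ (∀ᵐ y, ∀ ξ, f y ξ = f' y ξ) := by
  classical
  set bad : Set (EN N) := {y | ¬ ∀ ξ ξ', |f y ξ - f y ξ'| ≤ L * ‖ξ - ξ'‖}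
  have hbad : volume bad = 0 := hf.lip
  set B := toMeasurable volume bad
  have hB : volume B = 0 := by rw [measure_toMeasurable, hbad]
  have hBm : MeasurableSet B := measurableSet_toMeasurable _ _
  refine ⟨fun y ξ => if y ∈ B then 0 else f y ξ, ?_, ?_⟩
  · have hc : ∀ y, Continuous fun ξ => if y ∈ B then 0 else f y ξ := by
      intro y
      by_cases hy : y ∈ B
      · simp only [hy, if_true]; exact continuous_const
      · simp only [hy, if_false]
        have hy' : y ∉ bad := fun h => hy (subset_toMeasurable _ _ h)
        simp only [bad, Set.mem_ofPred_eq, not_not] at hy'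
        have : LipschitzWith ⟨L, hf.lip_pos.le⟩ (f y) := LipschitzWith.of_dist_le_mul fun ξ ξ' => by
          rw [Real.dist_eq, dist_eq_norm]; exact hy' ξ ξ'
        exact this.continuous
    have hm : ∀ ξ, Measurable fun y => if y ∈ B then 0 else f y ξ :=
      fun ξ => Measurable.ite hBm measurable_const (hf.meas ξ)
    have := measurable_uncurry_of_continuous_of_measurable
      (u := fun (ξ : Mat d N) (y : EN N) => if y ∈ B then 0 else f y ξ) hc hm
    exact this.comp measurable_swap
  · have : ∀ᵐ y, y ∉ B := by rw [ae_iff]; simpa using hB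
    filter_upwards [this] with y hy ξ
    simp [hy]

theorem hg_ae_scale {N : ℕ} {p : EN N → Prop} (h : ∀ᵐ y, p y) {ε : ℝ} (hε : ε ≠ 0) (a : EN N) :
    ∀ᵐ x, p (ε • x + a) := by
  have h1 : ∀ᵐ y, p (y + a) := (quasiMeasurePreserving_add_right volume a).ae h
  have h2 : Measure.QuasiMeasurePreserving (fun x : EN N => ε • x) volume volume := by
    refine ⟨by fun_prop, ?_⟩
    rw [Measure.map_addHaar_smul _ hε]
    exact Measure.smul_absolutelyContinuous
  exact h2.ae h1

theorem hg_ae_scale' {N : ℕ} {p : EN N → Prop} (h : ∀ᵐ y, p y) {ε : ℝ} (hε : ε ≠ 0) :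
    ∀ᵐ x, p (ε • x) := by
  simpa using hg_ae_scale h hε 0

theorem hg_aesm {N d : ℕ} {f : EN N → Mat d N → ℝ} {α β L : ℝ} (hf : StdIntegrand N d f α β L)
    {ε : ℝ} (hε : ε ≠ 0) {D : EN N → Mat d N} {A : Set (EN N)}
    (hD : AEStronglyMeasurable D (volume.restrict A)) :
    AEStronglyMeasurable (fun x => f (ε • x) (D x)) (volume.restrict A) := by
  obtain ⟨f', hm, hae⟩ := hg_modif hf
  have h1 : AEMeasurable (fun x => Function.uncurry f' (ε • x, D x)) (volume.restrict A) :=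
    hm.comp_aemeasurable (AEMeasurable.prodMk (by fun_prop) hD.aemeasurable)
  refine (h1.congr ?_).aestronglyMeasurable
  filter_upwards [ae_restrict_of_ae (hg_ae_scale' hae hε)] with x hx
  simp [Function.uncurry, hx]

theorem hg_integrable_f {N d : ℕ} {f : EN N → Mat d N → ℝ} {α β L : ℝ}
    (hf : StdIntegrand N d f α β L)
    {ε : ℝ} (hε : ε ≠ 0) {D : EN N → Mat d N} {A : Set (EN N)} (hA : volume A ≠ ⊤)
    (hD : IntegrableOn D A) :
    IntegrableOn (fun x => f (ε • x) (D x)) A := by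
  have hc : IntegrableOn (fun x => β * (1 + ‖D x‖)) A :=
    ((integrableOn_const hA).add hD.norm).const_mul β
  refine hc.mono' (hg_aesm hf hε hD.aestronglyMeasurable) ?_
  filter_upwards [ae_restrict_of_ae (hg_ae_scale' hf.growth hε)] with x hx
  rw [Real.norm_eq_abs, abs_of_nonneg (hf.nonneg _ _)]
  exact (hx _).2

end

section
open MeasureTheory Filter Set
open scoped ENNReal RealInnerProductSpace Topology NNReal

theorem hg_modif2 {N d : ℕ} {f : EN N → Mat d N → ℝ} {α β L : ℝ} (hf : StdIntegrand N d f α β L) :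
    ∃ f' : EN N → Mat d N → ℝ, Measurable (Function.uncurry f') ∧
      (∀ y ξ, 0 ≤ f' y ξ ∧ f' y ξ ≤ β * (1 + ‖ξ‖)) ∧
      (∀ y ξ i, f' (y + EuclideanSpace.single i 1) ξ = f' y ξ) ∧
      (∀ᵐ y, ∀ ξ, f y ξ = f' y ξ) := by
  have hβ : 0 < β := hf.alpha_pos.trans_le hf.alpha_le_beta
  let q : ℕ → Mat d N := TopologicalSpace.denseSeq (Mat d N)
  have hq : DenseRange q := TopologicalSpace.denseRange_denseSeq _
  let g : EN N → Mat d N → ℝ := fun y ξ => ⨆ n, (f y (q n) - L * ‖ξ - q n‖)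
  refine ⟨fun y ξ => max 0 (min (g y ξ) (β * (1 + ‖ξ‖))), ?_, ?_, ?_, ?_⟩
  · have hg : Measurable (Function.uncurry g) := by
      refine Measurable.iSup fun n => ?_
      have : Measurable fun p : EN N × Mat d N => f p.1 (q n) := (hf.meas (q n)).comp measurable_fst
      have h2 : Continuous fun ξ : Mat d N => L * ‖ξ - q n‖ := by fun_prop
      exact this.sub (h2.measurable.comp measurable_snd)
    have h2 : Measurable fun p : EN N × Mat d N => β * (1 + ‖p.2‖) := by fun_prop
    exact measurable_const.max (hg.min h2)
  · intro y ξ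
    refine ⟨le_max_left _ _, max_le (by positivity) (min_le_right _ _)⟩
  · intro y ξ i
    simp only [g, hf.periodic]
  · filter_upwards [hf.growth, hf.lip] with y hy hl ξ
    have hb : ∀ n, f y (q n) - L * ‖ξ - q n‖ ≤ f y ξ := fun n => by
      have := (abs_le.1 (hl (q n) ξ)).2
      rw [norm_sub_rev] at this
      linarith
    have hg : g y ξ = f y ξ := by
      refine le_antisymm (ciSup_le hb) ?_
      refine le_of_forall_pos_le_add fun η hη => ?_
      have hLp := hf.lip_pos
      obtain ⟨n, hn⟩ := hq.exists_dist_lt ξ (ε := η / (2 * L)) (by positivity)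
      have h1 : f y (q n) - L * ‖ξ - q n‖ ≤ g y ξ :=
        le_ciSup (f := fun n => f y (q n) - L * ‖ξ - q n‖) ⟨f y ξ, by rintro _ ⟨n, rfl⟩; exact hb n⟩ n
      have h2 := (abs_le.1 (hl ξ (q n))).2
      rw [dist_eq_norm, lt_div_iff₀ (by positivity)] at hn
      nlinarith
    simp only [hg]
    rw [min_eq_left (hy ξ).2, max_eq_right (hf.nonneg _ _)]

theorem hg_per_nat {N : ℕ} {α : Type*} {g : EN N → α}
    (hp : ∀ y i, g (y + EuclideanSpace.single i 1) = g y) (t : ℕ) (y : EN N) (i : Fin N) :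
    g (y + (t : ℝ) • EuclideanSpace.single i 1) = g y := by
  induction t with
  | zero => simp
  | succ t ih => rw [Nat.cast_succ, add_smul, one_smul, ← add_assoc, hp, ih]

theorem hg_RL_f {N d : ℕ} {f : EN N → Mat d N → ℝ} {α β L : ℝ} (hf : StdIntegrand N d f α β L)
    {t : ℕ} (ht : 0 < t) {D : EN N → Mat d N} (hDm : Measurable D) {C : ℝ}
    (hDb : ∀ y, ‖D y‖ ≤ C) (hDp : ∀ y i, D (y + (t : ℝ) • EuclideanSpace.single i 1) = D y)
    {A : Set (EN N)} (hA : MeasurableSet A) (hA' : volume A ≠ ⊤) :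
    Tendsto (fun ε : ℝ => ∫ x in A, f (ε⁻¹ • x) (D (ε⁻¹ • x))) (𝓝[>] 0)
      (𝓝 (volume.real A * (((t:ℝ) ^ N)⁻¹ * ∫ z in posCube N t, f z (D z)))) := by
  obtain ⟨f', hm, hb, hp, hae⟩ := hg_modif2 hf
  have hβ : 0 < β := hf.alpha_pos.trans_le hf.alpha_le_beta
  have h := hg_RL ht (g := fun y => f' y (D y)) (C := β * (1 + C))
    (hm.comp (measurable_id.prodMk hDm)) (fun y => by
      rw [abs_of_nonneg (hb _ _).1]
      refine (hb _ _).2.trans ?_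
      have := hDb y
      gcongr) (fun y i => by
      rw [hDp]; exact hg_per_nat (g := fun y' => f' y' (D y)) (fun y' i' => hp y' _ i') t y i) hA hA'
  have e : ∫ z in posCube N t, f z (D z) = ∫ z in posCube N t, f' z (D z) :=
    integral_congr_ae (ae_restrict_of_ae (by filter_upwards [hae] with x hx using hx _))
  rw [e]
  refine h.congr' ?_
  filter_upwards [self_mem_nhdsWithin] with ε hε
  have hε' : ε⁻¹ ≠ 0 := inv_ne_zero (ne_of_gt hε)
  refine integral_congr_ae (ae_restrict_of_ae ?_)
  filter_upwards [hg_ae_scale' hae hε'] with x hx using (hx _).symm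

end

section
open MeasureTheory Filter Set
open scoped ENNReal RealInnerProductSpace Topology NNReal

open scoped Manifold ContDiff in
theorem hg_cutoff {E : Type*} [NormedAddCommGroup E] [NormedSpace ℝ E] [FiniteDimensional ℝ E]
    {K U : Set E} (hK : IsCompact K) (hU : IsOpen U) (hKU : K ⊆ U) :
    ∃ η : E → ℝ, ContDiff ℝ (⊤ : ℕ∞) η ∧ HasCompactSupport η ∧ tsupport η ⊆ U ∧
      (∀ x, 0 ≤ η x ∧ η x ≤ 1) ∧ (∀ᶠ x in 𝓝ˢ K, η x = 1) := by
  obtain ⟨K', hK', h1, h2⟩ := exists_compact_between hK hU hKU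
  obtain ⟨η, h3, h4, h5⟩ := exists_contMDiffMap_one_nhds_of_subset_interior (n := (⊤ : ℕ∞)) 𝓘(ℝ, E)
    hK.isClosed h1
  have hsub : tsupport η ⊆ K' := closure_minimal (fun x hx => by
    by_contra h; exact hx (h4 x h)) hK'.isClosed
  exact ⟨η, η.contMDiff.contDiff, HasCompactSupport.of_support_subset_isCompact hK'
    (subset_closure.trans hsub), hsub.trans h2, fun x => h5 x, h3⟩

/-- standard mollifier -/
noncomputable def hg_rho (N : ℕ) (n : ℕ) : EN N → ℝ :=
  (⟨1 / (2 * ((n:ℝ) + 1)), 1 / ((n:ℝ) + 1), by positivity, by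
    rw [div_lt_div_iff₀ (by positivity) (by positivity)]
    have : (0:ℝ) ≤ n := by positivity
    linarith⟩ : ContDiffBump (0 : EN N)).normed volume

theorem hg_rho_smooth (N n : ℕ) : ContDiff ℝ (⊤ : ℕ∞) (hg_rho N n) := ContDiffBump.contDiff_normed _

theorem hg_rho_nonneg (N n : ℕ) (x : EN N) : 0 ≤ hg_rho N n x := ContDiffBump.nonneg_normed _ _

theorem hg_rho_int (N n : ℕ) : ∫ x, hg_rho N n x = 1 := ContDiffBump.integral_normed _

theorem hg_rho_tsupport (N n : ℕ) :
    tsupport (hg_rho N n) = Metric.closedBall 0 (1 / ((n:ℝ) + 1)) :=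
  ContDiffBump.tsupport_normed_eq _

theorem hg_rho_compact (N n : ℕ) : HasCompactSupport (hg_rho N n) :=
  ContDiffBump.hasCompactSupport_normed _

theorem hg_rho_integrable (N n : ℕ) : Integrable (hg_rho N n) :=
  (hg_rho_smooth N n).continuous.integrable_of_hasCompactSupport (hg_rho_compact N n)

/-- mollification -/
noncomputable def hg_moll {N : ℕ} {F : Type*} [NormedAddCommGroup F] [NormedSpace ℝ F]
    (n : ℕ) (w : EN N → F) : EN N → F :=
  convolution (hg_rho N n) w (ContinuousLinearMap.lsmul ℝ ℝ) volume

section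
variable {N : ℕ} {F : Type*} [NormedAddCommGroup F] [NormedSpace ℝ F]

theorem hg_moll_apply (n : ℕ) (w : EN N → F) (x : EN N) :
    hg_moll n w x = ∫ t, hg_rho N n t • w (x - t) := by
  simp [hg_moll, convolution_def]

theorem hg_moll_swap (n : ℕ) (w : EN N → F) (x : EN N) :
    hg_moll n w x = ∫ t, hg_rho N n (x - t) • w t := by
  simp [hg_moll, convolution_eq_swap]

theorem hg_moll_smooth (n : ℕ) {w : EN N → F} (hw : Integrable w) :
    ContDiff ℝ (⊤ : ℕ∞) (hg_moll n w) :=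
  (hg_rho_compact N n).contDiff_convolution_left _ (hg_rho_smooth N n) hw.locallyIntegrable

theorem hg_moll_integrable (n : ℕ) {w : EN N → F} (hw : Integrable w) :
    Integrable (hg_moll n w) :=
  (hg_rho_integrable N n).integrable_convolution _ hw

theorem hg_moll_tendsto [CompleteSpace F] {w : EN N → F} (hw : Integrable w) :
    Tendsto (fun n => ∫ x, ‖hg_moll n w x - w x‖) atTop (𝓝 0) := by
  have hT := hg_translate hw
  rw [Metric.tendsto_nhds] at hT ⊢
  intro η hη
  have hT' := hT (η / 2) (by positivity)
  obtain ⟨δ, hδ, hball⟩ := Metric.eventually_nhds_iff.1 hT'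
  have hlim : Tendsto (fun n : ℕ => 1 / ((n:ℝ) + 1)) atTop (𝓝 0) := tendsto_one_div_add_atTop_nhds_zero_nat
  filter_upwards [hlim.eventually (gt_mem_nhds hδ)] with n hn
  have h1 : Integrable (fun p : EN N × EN N => hg_rho N n p.2 • (w (p.1 - p.2))) (volume.prod volume) :=
    (hg_rho_integrable N n).convolution_integrand (ContinuousLinearMap.lsmul ℝ ℝ) hw
  have h2 : Integrable (fun p : EN N × EN N => hg_rho N n p.2 • (w p.1)) (volume.prod volume) := by
    have := ((hg_rho_integrable N n).smul_prod hw).swap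
    exact this
  have h3 : Integrable (fun p : EN N × EN N => hg_rho N n p.2 • (w (p.1 - p.2) - w p.1))
      (volume.prod volume) := by
    refine (h1.sub h2).congr (Eventually.of_forall fun p => ?_)
    simp [smul_sub]
  have h4 : ∀ᵐ x, ‖hg_moll n w x - w x‖ ≤ ∫ t, ‖hg_rho N n t • (w (x - t) - w x)‖ := by
    filter_upwards [h1.prod_right_ae] with x hx
    have : hg_moll n w x - w x = ∫ t, hg_rho N n t • (w (x - t) - w x) := by
      simp only [smul_sub]
      rw [integral_sub hx ((hg_rho_integrable N n).smul_const _), hg_moll_apply,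
        integral_smul_const, hg_rho_int, one_smul]
    rw [this]
    exact norm_integral_le_integral_norm _
  have h5 : ∫ x, ‖hg_moll n w x - w x‖ ≤ ∫ x, ∫ t, ‖hg_rho N n t • (w (x - t) - w x)‖ :=
    integral_mono_ae ((hg_moll_integrable n hw).sub hw).norm h3.norm.integral_prod_left h4
  rw [integral_integral_swap h3.norm] at h5
  have h6 : ∫ t, ∫ x, ‖hg_rho N n t • (w (x - t) - w x)‖ ≤ ∫ t, hg_rho N n t * (η / 2) := by
    refine integral_mono h3.norm.integral_prod_right ((hg_rho_integrable N n).mul_const _) fun t => ?_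
    have e : ∀ x, ‖hg_rho N n t • (w (x - t) - w x)‖ = hg_rho N n t * ‖w (x + -t) - w x‖ := by
      intro x; rw [norm_smul, Real.norm_of_nonneg (hg_rho_nonneg N n t), sub_eq_add_neg x]
    simp only [e, integral_const_mul]
    by_cases ht : hg_rho N n t = 0
    · simp [ht]
    · refine mul_le_mul_of_nonneg_left ?_ (hg_rho_nonneg N n t)
      have hm : t ∈ tsupport (hg_rho N n) := subset_tsupport _ ht
      rw [hg_rho_tsupport, mem_closedBall_zero_iff] at hm
      have := hball (y := -t) (by rw [dist_zero_right, norm_neg]; exact hm.trans_lt hn)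
      rw [Real.dist_eq, sub_zero] at this
      exact (le_abs_self _).trans this.le
  rw [integral_mul_const, hg_rho_int, one_mul] at h6
  rw [Real.dist_eq, sub_zero, abs_of_nonneg (integral_nonneg fun _ => norm_nonneg _)]
  linarith

/-- a mollification vanishes away from the support -/
theorem hg_moll_zero {n : ℕ} {w : EN N → F} {x : EN N} {r : ℝ} (hr : 1 / ((n:ℝ) + 1) ≤ r)
    (h : ∀ y, ‖y - x‖ ≤ r → w y = 0) : hg_moll n w x = 0 := by
  rw [hg_moll_apply]
  refine integral_eq_zero_of_ae (Eventually.of_forall fun t => ?_)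
  by_cases ht : hg_rho N n t = 0
  · simp [ht]
  · have hm : t ∈ tsupport (hg_rho N n) := subset_tsupport _ ht
    rw [hg_rho_tsupport, mem_closedBall_zero_iff] at hm
    simp [h (x - t) (by simpa using hm.trans hr)]

end

end

section
open MeasureTheory Filter Set
open scoped ENNReal RealInnerProductSpace Topology NNReal

section
variable {N d : ℕ}

theorem hg_int_ext {F : Type*} [NormedAddCommGroup F] {g : EN N → F} {A : Set (EN N)}
    (h : IntegrableOn g A) (h0 : ∀ x ∉ A, g x = 0) : Integrable g :=
  (integrableOn_iff_integrable_of_support_subset (fun x hx => by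
    by_contra h'; exact hx (h0 x h'))).1 h

theorem hg_int_add {F : Type*} [NormedAddCommGroup F] {g h : EN N → F}
    (hg : Integrable g) (hh : Integrable h) : Integrable fun x => g x + h x := hg.add hh

theorem hg_W_univ {u : EN N → EN d} {Du : EN N → Mat d N} (h : MemW11 univ u Du) :
    Integrable u ∧ Integrable Du ∧ ∀ φ : EN N → ℝ, ContDiff ℝ (⊤ : ℕ∞) φ → HasCompactSupport φ →
      ∀ y : EN N, ∫ x, fderiv ℝ φ x y • u x = - ∫ x, φ x • Du x y := by
  obtain ⟨h1, h2, h3⟩ := h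
  rw [integrableOn_univ] at h1 h2
  refine ⟨h1, h2, fun φ hφ hc y => ?_⟩
  have := h3 φ hφ hc (subset_univ _) y
  simpa [setIntegral_univ] using this

theorem hg_moll_fderiv {w : EN N → EN d} {Dw : EN N → Mat d N} (h : MemW11 univ w Dw) (n : ℕ)
    (x : EN N) : fderiv ℝ (hg_moll n w) x = hg_moll n Dw x := by
  obtain ⟨hw, hDw, hweak⟩ := hg_W_univ h
  have hρ1 : ContDiff ℝ 1 (hg_rho N n) := (hg_rho_smooth N n).of_le (by norm_cast)
  have hd := (hg_rho_compact N n).hasFDerivAt_convolution_left (ContinuousLinearMap.lsmul ℝ ℝ)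
    hρ1 hw.locallyIntegrable x
  have e1 : fderiv ℝ (hg_moll n w) x = _ := hd.fderiv
  rw [e1]
  have hcd : Continuous (fderiv ℝ (hg_rho N n)) := hρ1.continuous_fderiv (by simp)
  have hce : ConvolutionExists (fderiv ℝ (hg_rho N n)) w
      ((ContinuousLinearMap.lsmul ℝ ℝ : ℝ →L[ℝ] EN d →L[ℝ] EN d).precompL (EN N)) volume :=
    ((hg_rho_compact N n).fderiv ℝ).convolutionExists_left _ hcd hw.locallyIntegrable
  ext1 y
  have hi := (hce x).integrable_swap
  rw [convolution_eq_swap, ContinuousLinearMap.integral_apply hi, hg_moll_swap,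
    ContinuousLinearMap.integral_apply]
  · have hφ : ContDiff ℝ (⊤ : ℕ∞) (fun t => hg_rho N n (x - t)) :=
      (hg_rho_smooth N n).comp (contDiff_const.sub contDiff_id)
    have hφc : HasCompactSupport (fun t => hg_rho N n (x - t)) :=
      (hg_rho_compact N n).comp_homeomorph (Homeomorph.subLeft x)
    have := hweak _ hφ hφc y
    have e : ∀ t, fderiv ℝ (fun t => hg_rho N n (x - t)) t y = - fderiv ℝ (hg_rho N n) (x - t) y := by
      intro t
      have h1 : HasFDerivAt (fun t => x - t) (-ContinuousLinearMap.id ℝ (EN N)) t :=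
        (hasFDerivAt_id t).const_sub x
      have h2 : HasFDerivAt (hg_rho N n) (fderiv ℝ (hg_rho N n) (x - t)) (x - t) :=
        ((hρ1.differentiable (by simp)) _).hasFDerivAt
      have h3 : HasFDerivAt (fun t => hg_rho N n (x - t)) _ t := h2.comp t h1
      rw [h3.fderiv]; simp
    simp only [e, neg_smul, integral_neg, neg_inj] at this
    simpa [ContinuousLinearMap.precompL_apply] using this
  · have : ConvolutionExists (hg_rho N n) Dw
      (ContinuousLinearMap.lsmul ℝ ℝ) volume :=
     (hg_rho_compact N n).convolutionExists_left _ (hg_rho_smooth N n).continuous hDw.locallyIntegrable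
    exact (this x).integrable_swap

/-- approximation of a Sobolev function -/
theorem hg_approx {w : EN N → EN d} {Dw : EN N → Mat d N} (h : MemW11 univ w Dw) :
    Tendsto (fun n => ∫ x, ‖fderiv ℝ (hg_moll n w) x - Dw x‖) atTop (𝓝 0) := by
  simp only [hg_moll_fderiv h]
  exact hg_moll_tendsto (hg_W_univ h).2.1

theorem hg_moll_fderiv_integrable {w : EN N → EN d} {Dw : EN N → Mat d N} (h : MemW11 univ w Dw)
    (n : ℕ) : Integrable (fderiv ℝ (hg_moll n w)) :=
  (hg_moll_integrable n (hg_W_univ h).2.1).congr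
    (Eventually.of_forall fun x => (hg_moll_fderiv h n x).symm)

set_option maxHeartbeats 1000000 in
/-- cut-off -/
theorem hg_cut {A : Set (EN N)} (hA : MeasurableSet A) {u : EN N → EN d} {Du : EN N → Mat d N} (h : MemW11 A u Du)
    {η : EN N → ℝ} (hη : ContDiff ℝ (⊤ : ℕ∞) η) (hc : HasCompactSupport η) (hs : tsupport η ⊆ A) :
    MemW11 univ (fun x => η x • u x)
      (fun x => η x • Du x + (fderiv ℝ η x).smulRight (u x)) := by
  obtain ⟨h1, h2, h3⟩ := h
  have hη1 : ContDiff ℝ 1 η := hη.of_le (by norm_cast)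
  obtain ⟨C, hC⟩ := hη.continuous.bounded_above_of_compact_support hc
  have hcd := hη1.continuous_fderiv (by simp)
  obtain ⟨C', hC'⟩ := hcd.bounded_above_of_compact_support (hc.fderiv ℝ)
  have h0 : ∀ x ∉ A, η x = 0 := fun x hx => image_eq_zero_of_notMem_tsupport fun hh => hx (hs hh)
  have h0' : ∀ x ∉ A, fderiv ℝ η x = 0 := fun x hx =>
    image_eq_zero_of_notMem_tsupport fun hh => hx (hs (tsupport_fderiv_subset ℝ hh))
  have i1 : Integrable (fun x => η x • u x) := by
    have : IntegrableOn (fun x => η x • u x) A :=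
      h1.bdd_smul C hη.continuous.aestronglyMeasurable (Eventually.of_forall hC)
    exact hg_int_ext this fun x hx => by simp [h0 x hx]
  have i2 : Integrable (fun x => η x • Du x) := by
    have : IntegrableOn (fun x => η x • Du x) A :=
      h2.bdd_smul C hη.continuous.aestronglyMeasurable (Eventually.of_forall hC)
    exact hg_int_ext this fun x hx => by rw [h0 x hx]; exact zero_smul ℝ (Du x)
  have i3 : Integrable (fun x => (fderiv ℝ η x).smulRight (u x)) := by
    have : IntegrableOn (fun x => (fderiv ℝ η x).smulRight (u x)) A := by
      refine (h1.norm.const_mul C').mono' ?_ (Eventually.of_forall fun x => ?_)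
      · have hb : Continuous fun p : (EN N →L[ℝ] ℝ) × EN d => p.1.smulRight p.2 := by
          fun_prop
        exact hb.comp_aestronglyMeasurable (hcd.aestronglyMeasurable.prodMk h1.aestronglyMeasurable)
      · rw [ContinuousLinearMap.norm_smulRight_apply]
        exact mul_le_mul_of_nonneg_right (hC' x) (norm_nonneg _)
    exact hg_int_ext this fun x hx => by ext; simp [h0' x hx]
  have i4 : Integrable (fun x => η x • Du x + (fderiv ℝ η x).smulRight (u x)) := hg_int_add i2 i3
  refine ⟨i1.integrableOn, i4.integrableOn, fun φ hφ hφc _ y => ?_⟩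
  rw [setIntegral_univ, setIntegral_univ]
  have hφ1 : ContDiff ℝ 1 φ := hφ.of_le (by norm_cast)
  have hsub : tsupport (fun x => φ x * η x) ⊆ A := (tsupport_mul_subset_right).trans hs
  have key := h3 (fun x => φ x * η x) (hφ.mul hη) (hc.mul_left) hsub y
  have ef : ∀ x, fderiv ℝ (fun x => φ x * η x) x y = fderiv ℝ φ x y * η x + φ x * fderiv ℝ η x y := by
    intro x
    rw [fderiv_fun_mul ((hφ1.differentiable (by simp)) x) ((hη1.differentiable (by simp)) x)]
    simp; ring
  have hbφ := hφ.continuous.bounded_above_of_compact_support hφc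
  obtain ⟨Cφ, hCφ⟩ := hbφ
  have hcφd := hφ1.continuous_fderiv (by simp)
  obtain ⟨Cφ', hCφ'⟩ := hcφd.bounded_above_of_compact_support (hφc.fderiv ℝ)
  have j1 : Integrable (fun x => fderiv ℝ φ x y • η x • u x) := by
    refine i1.bdd_smul (Cφ' * ‖y‖) (hcφd.clm_apply continuous_const).aestronglyMeasurable
      (Eventually.of_forall fun x => ?_)
    exact ((fderiv ℝ φ x).le_opNorm y).trans (by gcongr; exact hCφ' x)
  have j2 : Integrable (fun x => φ x • ((fderiv ℝ η x).smulRight (u x)) y) := by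
    exact (i3.apply_continuousLinearMap y).bdd_smul Cφ hφ.continuous.aestronglyMeasurable
      (Eventually.of_forall hCφ)
  have j3 : Integrable (fun x => φ x • (η x • Du x) y) := by
    exact (i2.apply_continuousLinearMap y).bdd_smul Cφ hφ.continuous.aestronglyMeasurable
      (Eventually.of_forall hCφ)
  have e1 : ∫ x in A, fderiv ℝ (fun x => φ x * η x) x y • u x =
      ∫ x, (fderiv ℝ φ x y • η x • u x + φ x • ((fderiv ℝ η x).smulRight (u x)) y) := by
    symm; rw [← setIntegral_eq_integral_of_forall_compl_eq_zero (s := A)]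
    · refine setIntegral_congr_fun hA fun x _ => ?_
      symm
      simp only [ef, ContinuousLinearMap.smulRight_apply, add_smul, mul_smul]
    · intro x hx; simp [h0 x hx, h0' x hx]
  have e2 : ∫ x in A, (φ x * η x) • Du x y = ∫ x, φ x • (η x • Du x) y := by
    symm; rw [← setIntegral_eq_integral_of_forall_compl_eq_zero (s := A)]
    · refine setIntegral_congr_fun hA fun x _ => ?_
      simp [mul_smul]
    · intro x hx; simp [h0 x hx]
  rw [e1, e2, integral_add j1 j2] at key
  have : ∫ x, φ x • (η x • Du x + (fderiv ℝ η x).smulRight (u x)) y =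
      ∫ x, (φ x • (η x • Du x) y + φ x • ((fderiv ℝ η x).smulRight (u x)) y) := by
    congr 1; ext1 x; exact smul_add _ _ _
  rw [this, integral_add j3 j2, neg_add, ← key]
  abel

end

end

section
open MeasureTheory Filter Set
open scoped ENNReal RealInnerProductSpace Topology NNReal

section
variable {N d : ℕ}

theorem hg_tendsto_int {F : Type*} [NormedAddCommGroup F] [NormedSpace ℝ F] {ι : Type*} {l : Filter ι}
    {X : Type*} [MeasurableSpace X] {μ : Measure X}
    {fn : ι → X → F} {f : X → F} (hfn : ∀ i, Integrable (fn i) μ) (hf : Integrable f μ)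
    (h : Tendsto (fun i => ∫ x, ‖fn i x - f x‖ ∂μ) l (𝓝 0)) :
    Tendsto (fun i => ∫ x, fn i x ∂μ) l (𝓝 (∫ x, f x ∂μ)) := by
  rw [tendsto_iff_norm_sub_tendsto_zero]
  refine squeeze_zero (fun _ => norm_nonneg _) (fun i => ?_) h
  rw [← integral_sub (hfn i) hf]
  exact norm_integral_le_integral_norm _

theorem hg_subseq {F : Type*} [NormedAddCommGroup F] {X : Type*} [MeasurableSpace X] {μ : Measure X}
    {fn : ℕ → X → F} {f : X → F} (hfn : ∀ i, Integrable (fn i) μ) (hf : Integrable f μ)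
    (h : Tendsto (fun i => ∫ x, ‖fn i x - f x‖ ∂μ) atTop (𝓝 0)) :
    ∃ ns : ℕ → ℕ, StrictMono ns ∧ ∀ᵐ x ∂μ, Tendsto (fun i => fn (ns i) x) atTop (𝓝 (f x)) := by
  have : Tendsto (fun i => eLpNorm (fn i - f) 1 μ) atTop (𝓝 0) := by
    have e : ∀ i, eLpNorm (fn i - f) 1 μ = ENNReal.ofReal (∫ x, ‖fn i x - f x‖ ∂μ) := by
      intro i
      rw [eLpNorm_one_eq_lintegral_enorm, ← ofReal_integral_norm_eq_lintegral_enorm ((hfn i).sub hf)]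
      rfl
    simp only [e]
    simpa using ENNReal.tendsto_ofReal h
  exact (tendstoInMeasure_of_tendsto_eLpNorm one_ne_zero (fun i => (hfn i).aestronglyMeasurable)
    hf.aestronglyMeasurable this).exists_seq_tendsto_ae

theorem hg_lip_of_fderiv {E F : Type*} [NormedAddCommGroup E] [NormedSpace ℝ E]
    [NormedAddCommGroup F] [NormedSpace ℝ F] {H : E → F} (hH : ContDiff ℝ 1 H) {C : ℝ}
    (hC : ∀ p, ‖fderiv ℝ H p‖ ≤ C) (p q : E) : ‖H p - H q‖ ≤ C * ‖p - q‖ :=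
  Convex.norm_image_sub_le_of_norm_fderiv_le (fun x _ => (hH.differentiable (by simp)) x)
    (fun x _ => hC x) convex_univ (mem_univ q) (mem_univ p)

/-- Chain rule for smooth inner function -/
theorem hg_chain_smooth {H : EN N × EN d → EN d} (hH : ContDiff ℝ 1 H)
    {w : EN N → EN d} (hw : ContDiff ℝ (⊤ : ℕ∞) w)
    {φ : EN N → ℝ} (hφ : ContDiff ℝ (⊤ : ℕ∞) φ) (hφc : HasCompactSupport φ) (y : EN N) :
    ∫ x, fderiv ℝ φ x y • H (x, w x) =
      - ∫ x, φ x • fderiv ℝ H (x, w x) (y, fderiv ℝ w x y) := by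
  have hw1 : ContDiff ℝ 1 w := hw.of_le (by norm_cast)
  have hφ1 : ContDiff ℝ 1 φ := hφ.of_le (by norm_cast)
  have hg : ContDiff ℝ 1 (fun x => H (x, w x)) := hH.comp (contDiff_id.prodMk hw1)
  have hd : ∀ x, fderiv ℝ (fun x => H (x, w x)) x y = fderiv ℝ H (x, w x) (y, fderiv ℝ w x y) := by
    intro x
    have h1 : HasFDerivAt (fun x => (x, w x)) ((ContinuousLinearMap.id ℝ (EN N)).prod (fderiv ℝ w x)) x :=
      (hasFDerivAt_id x).prodMk ((hw1.differentiable (by simp)) x).hasFDerivAt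
    have h2 := ((hH.differentiable (by simp)) (x, w x)).hasFDerivAt
    have h3 : HasFDerivAt (fun x => H (x, w x)) _ x := h2.comp x h1
    rw [h3.fderiv]; simp
  have hcφd := hφ1.continuous_fderiv (by simp)
  have hcgd := hg.continuous_fderiv (by simp)
  have key := integral_smul_fderiv_eq_neg_fderiv_smul_of_integrable (μ := volume) (f := φ)
    (g := fun x => H (x, w x)) (v := y)
    (((hcφd.clm_apply continuous_const).smul hg.continuous).integrable_of_hasCompactSupport
      (HasCompactSupport.smul_right (by
        exact (hφc.fderiv ℝ).comp_left (g := fun T : EN N →L[ℝ] ℝ => T y) rfl)))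
    ((hφ.continuous.smul (hcgd.clm_apply continuous_const)).integrable_of_hasCompactSupport
      (HasCompactSupport.smul_right hφc))
    ((hφ.continuous.smul hg.continuous).integrable_of_hasCompactSupport
      (HasCompactSupport.smul_right hφc))
    (fun x _ => (hφ1.differentiable (by simp)) x) (fun x _ => (hg.differentiable (by simp)) x)
  simp only [hd] at key
  rw [key, neg_neg]

end

end

section
open MeasureTheory Filter Set
open scoped ENNReal RealInnerProductSpace Topology NNReal

section
variable {N d : ℕ}

set_option maxHeartbeats 2000000 in
theorem hg_chain_univ {H : EN N × EN d → EN d} (hH : ContDiff ℝ 1 H) {C : ℝ}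
    (hC : ∀ p, ‖fderiv ℝ H p‖ ≤ C)
    {w : EN N → EN d} {Dw : EN N → Mat d N} (h : MemW11 univ w Dw)
    {φ : EN N → ℝ} (hφ : ContDiff ℝ (⊤ : ℕ∞) φ) (hφc : HasCompactSupport φ) (y : EN N) :
    ∫ x, fderiv ℝ φ x y • H (x, w x) =
      - ∫ x, φ x • fderiv ℝ H (x, w x) (y, Dw x y) := by
  obtain ⟨hw, hDw, -⟩ := hg_W_univ h
  have hC0 : 0 ≤ C := (norm_nonneg _).trans (hC 0)
  have hwn := fun n => hg_moll_integrable n hw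
  have hDwn := fun n => hg_moll_fderiv_integrable h n
  obtain ⟨ns, hns, hae⟩ := hg_subseq hwn hw (hg_moll_tendsto hw)
  have hφ1 : ContDiff ℝ 1 φ := hφ.of_le (by norm_cast)
  have hcφd := hφ1.continuous_fderiv (by simp)
  obtain ⟨B, hB⟩ := hφ.continuous.bounded_above_of_compact_support hφc
  obtain ⟨B', hB'⟩ := hcφd.bounded_above_of_compact_support (hφc.fderiv ℝ)
  have hB0 : 0 ≤ B := (norm_nonneg _).trans (hB 0)
  have hB0' : 0 ≤ B' := (norm_nonneg _).trans (hB' 0)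
  have hφi : Integrable φ := hφ.continuous.integrable_of_hasCompactSupport hφc
  have hHd := hH.continuous_fderiv (by simp)
  have hφdy : Integrable (fun x => fderiv ℝ φ x y) :=
    (hcφd.clm_apply continuous_const).integrable_of_hasCompactSupport
      ((hφc.fderiv ℝ).comp_left (g := fun T : EN N →L[ℝ] ℝ => T y) rfl)
  have hφdyB : ∀ x, ‖fderiv ℝ φ x y‖ ≤ B' * ‖y‖ := fun x =>
    ((fderiv ℝ φ x).le_opNorm y).trans (by gcongr; exact hB' x)
  -- integrability
  have I1 : ∀ v : EN N → EN d, Integrable v → Integrable (fun x => fderiv ℝ φ x y • H (x, v x)) := by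
    intro v hv
    have hcont : Continuous (fun x => fderiv ℝ φ x y • H (x, (0 : EN d))) :=
      (hcφd.clm_apply continuous_const).smul (hH.continuous.comp (by fun_prop))
    have hi0 : Integrable (fun x => fderiv ℝ φ x y • H (x, (0 : EN d))) :=
      hcont.integrable_of_hasCompactSupport (HasCompactSupport.smul_right
      ((hφc.fderiv ℝ).comp_left (g := fun T : EN N →L[ℝ] ℝ => T y) rfl))
    refine (hi0.norm.add (hv.norm.const_mul (B' * ‖y‖ * C))).mono' ?_ (Eventually.of_forall fun x => ?_)
    · exact hφdy.aestronglyMeasurable.smul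
        (hH.continuous.comp_aestronglyMeasurable (aestronglyMeasurable_id.prodMk hv.aestronglyMeasurable))
    · have h1 := hg_lip_of_fderiv hH hC (x, v x) (x, 0)
      have e : ((x, v x) : EN N × EN d) - (x, 0) = (0, v x) := by simp
      rw [e, Prod.norm_mk, norm_zero, max_eq_right (norm_nonneg _)] at h1
      have h2 : ‖fderiv ℝ φ x y • H (x, v x)‖ ≤ ‖fderiv ℝ φ x y • H (x, (0:EN d))‖
          + ‖fderiv ℝ φ x y • (H (x, v x) - H (x, (0 : EN d)))‖ := by
        refine le_trans (le_of_eq ?_) (norm_add_le _ _)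
        rw [smul_sub, add_sub_cancel]
      refine h2.trans ?_
      have h3 : ‖fderiv ℝ φ x y • (H (x, v x) - H (x, (0 : EN d)))‖ ≤ B' * ‖y‖ * (C * ‖v x‖) := by
        rw [norm_smul]
        exact mul_le_mul (hφdyB x) h1 (norm_nonneg _) (by positivity)
      rw [← mul_assoc] at h3
      exact add_le_add_right h3 _
  have I2 : ∀ (v : EN N → EN d) (Dv : EN N → Mat d N), Integrable v → Integrable Dv →
      Integrable (fun x => φ x • fderiv ℝ H (x, v x) (y, Dv x y)) := by
    intro v Dv hv hDv
    have hb : Integrable (fun x => B * (C * (‖y‖ * ‖Dv x‖)) + C * ‖y‖ * ‖φ x‖) :=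
      (((hDv.norm.const_mul _).const_mul _).const_mul _).add (hφi.norm.const_mul _)
    refine hb.mono' ?_ (Eventually.of_forall fun x => ?_)
    · refine hφi.aestronglyMeasurable.smul ?_
      have hm1 : AEStronglyMeasurable (fun x => fderiv ℝ H (x, v x)) volume :=
        hHd.comp_aestronglyMeasurable (aestronglyMeasurable_id.prodMk hv.aestronglyMeasurable)
      have hm2 : AEStronglyMeasurable (fun x => (y, Dv x y)) volume :=
        aestronglyMeasurable_const.prodMk (hDv.apply_continuousLinearMap y).aestronglyMeasurable
      have hcc : Continuous fun p : ((EN N × EN d) →L[ℝ] EN d) × (EN N × EN d) => p.1 p.2 := by fun_prop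
      exact hcc.comp_aestronglyMeasurable (hm1.prodMk hm2)
    · rw [norm_smul]
      have h1 : ‖fderiv ℝ H (x, v x) (y, Dv x y)‖ ≤ C * (‖y‖ + ‖y‖ * ‖Dv x‖) := by
        refine ((fderiv ℝ H (x, v x)).le_opNorm _).trans ?_
        refine mul_le_mul (hC _) ?_ (norm_nonneg _) hC0
        rw [Prod.norm_mk]
        refine max_le (le_add_of_nonneg_right (by positivity)) ?_
        have := (Dv x).le_opNorm y
        nlinarith [norm_nonneg y]
      calc ‖φ x‖ * ‖fderiv ℝ H (x, v x) (y, Dv x y)‖ ≤ ‖φ x‖ * (C * (‖y‖ + ‖y‖ * ‖Dv x‖)) := by gcongr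
        _ = ‖φ x‖ * (C * (‖y‖ * ‖Dv x‖)) + C * ‖y‖ * ‖φ x‖ := by ring
        _ ≤ _ := by gcongr; exact hB x
  -- left limit
  have L1 : Tendsto (fun i => ∫ x, fderiv ℝ φ x y • H (x, hg_moll (ns i) w x)) atTop
      (𝓝 (∫ x, fderiv ℝ φ x y • H (x, w x))) := by
    refine hg_tendsto_int (fun i => I1 _ (hwn _)) (I1 _ hw) ?_
    have hz : Tendsto (fun i => B' * ‖y‖ * C * ∫ x, ‖hg_moll (ns i) w x - w x‖) atTop (𝓝 0) := by
      simpa using ((hg_moll_tendsto hw).comp hns.tendsto_atTop).const_mul (B' * ‖y‖ * C)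
    refine squeeze_zero (fun i => integral_nonneg fun _ => norm_nonneg _) (fun i => ?_) hz
    rw [← integral_const_mul]
    refine integral_mono ((I1 _ (hwn _)).sub (I1 _ hw)).norm (((hwn _).sub hw).norm.const_mul _) fun x => ?_
    have h1 := hg_lip_of_fderiv hH hC (x, hg_moll (ns i) w x) (x, w x)
    have e : ((x, hg_moll (ns i) w x) : EN N × EN d) - (x, w x) = (0, hg_moll (ns i) w x - w x) := by simp
    rw [e, Prod.norm_mk, norm_zero, max_eq_right (norm_nonneg _)] at h1
    simp only
    rw [← smul_sub, norm_smul, mul_assoc]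
    exact mul_le_mul (hφdyB x) h1 (norm_nonneg _) (by positivity)
  -- right limit
  have R1 : Tendsto (fun i => ∫ x, φ x • fderiv ℝ H (x, hg_moll (ns i) w x) (y, fderiv ℝ (hg_moll (ns i) w) x y)) atTop
      (𝓝 (∫ x, φ x • fderiv ℝ H (x, w x) (y, Dw x y))) := by
    -- intermediate
    have M1 : Tendsto (fun i => ∫ x, φ x • fderiv ℝ H (x, hg_moll (ns i) w x) (y, Dw x y)) atTop
      (𝓝 (∫ x, φ x • fderiv ℝ H (x, w x) (y, Dw x y))) := by
      refine tendsto_integral_of_dominated_convergence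
        (fun x => B * (C * (‖y‖ * ‖Dw x‖)) + C * ‖y‖ * ‖φ x‖) (fun i => (I2 _ _ (hwn _) hDw).aestronglyMeasurable)
        ((((hDw.norm.const_mul _).const_mul _).const_mul _).add (hφi.norm.const_mul _))
        (fun i => Eventually.of_forall fun x => ?_) ?_
      · rw [norm_smul]
        have h1 : ‖fderiv ℝ H (x, hg_moll (ns i) w x) (y, Dw x y)‖ ≤ C * (‖y‖ + ‖y‖ * ‖Dw x‖) := by
          refine ((fderiv ℝ H (x, _)).le_opNorm _).trans ?_
          refine mul_le_mul (hC _) ?_ (norm_nonneg _) hC0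
          rw [Prod.norm_mk]
          refine max_le (le_add_of_nonneg_right (by positivity)) ?_
          have := (Dw x).le_opNorm y
          nlinarith [norm_nonneg y]
        calc ‖φ x‖ * ‖fderiv ℝ H (x, hg_moll (ns i) w x) (y, Dw x y)‖ ≤ ‖φ x‖ * (C * (‖y‖ + ‖y‖ * ‖Dw x‖)) := by gcongr
          _ = ‖φ x‖ * (C * (‖y‖ * ‖Dw x‖)) + C * ‖y‖ * ‖φ x‖ := by ring
          _ ≤ _ := by gcongr; exact hB x
      · filter_upwards [hae] with x hx
        have h1 : Tendsto (fun i => fderiv ℝ H (x, hg_moll (ns i) w x)) atTop (𝓝 (fderiv ℝ H (x, w x))) :=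
          (hHd.tendsto _).comp (tendsto_const_nhds.prodMk_nhds hx)
        exact (((ContinuousLinearMap.apply ℝ (EN d) (y, Dw x y)).continuous.tendsto _).comp h1).const_smul _
    have M2 : Tendsto (fun i => ∫ x, (φ x • fderiv ℝ H (x, hg_moll (ns i) w x) (y, fderiv ℝ (hg_moll (ns i) w) x y)
        - φ x • fderiv ℝ H (x, hg_moll (ns i) w x) (y, Dw x y))) atTop (𝓝 0) := by
      have hz : Tendsto (fun i => B * C * ‖y‖ * ∫ x, ‖fderiv ℝ (hg_moll (ns i) w) x - Dw x‖) atTop (𝓝 0) := by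
        simpa using ((hg_approx h).comp hns.tendsto_atTop).const_mul (B * C * ‖y‖)
      refine squeeze_zero_norm (fun i => ?_) hz
      refine (norm_integral_le_integral_norm _).trans ?_
      rw [← integral_const_mul]
      refine integral_mono ((I2 _ _ (hwn _) (hDwn _)).sub (I2 _ _ (hwn _) hDw)).norm
        (((hDwn _).sub hDw).norm.const_mul _) fun x => ?_
      simp only
      rw [← smul_sub, ← map_sub, norm_smul]
      have e : ((y, fderiv ℝ (hg_moll (ns i) w) x y) : EN N × EN d) - (y, Dw x y) =
        (0, (fderiv ℝ (hg_moll (ns i) w) x - Dw x) y) := by simp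
      rw [e]
      have h1 := (fderiv ℝ H (x, hg_moll (ns i) w x)).le_opNorm (0, (fderiv ℝ (hg_moll (ns i) w) x - Dw x) y)
      rw [Prod.norm_mk, norm_zero, max_eq_right (norm_nonneg _)] at h1
      have h2 := (fderiv ℝ (hg_moll (ns i) w) x - Dw x).le_opNorm y
      have h3 := hC (x, hg_moll (ns i) w x)
      calc _ ≤ B * (C * (‖fderiv ℝ (hg_moll (ns i) w) x - Dw x‖ * ‖y‖)) :=
            mul_le_mul (hB x) (h1.trans (mul_le_mul h3 h2 (norm_nonneg _) hC0)) (norm_nonneg _) hB0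
        _ = _ := by ring
    have := M2.add M1
    rw [zero_add] at this
    refine this.congr fun i => ?_
    rw [integral_sub (I2 _ _ (hwn _) (hDwn _)) (I2 _ _ (hwn _) hDw)]
    abel
  refine tendsto_nhds_unique L1 (R1.neg.congr fun i => ?_)
  exact (hg_chain_smooth hH (hg_moll_smooth _ hw) hφ hφc y).symm

end

end

section
open MeasureTheory Filter Set
open scoped ENNReal RealInnerProductSpace Topology NNReal

section
variable {N d : ℕ}

/-- pointwise gradient of `x ↦ H (x, v x)` -/
noncomputable def hg_grad (H : EN N × EN d → EN d) (v : EN N → EN d) (Dv : EN N → Mat d N) (x : EN N) : Mat d N :=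
  (fderiv ℝ H (x, v x)).comp ((ContinuousLinearMap.id ℝ (EN N)).prod (Dv x))

theorem hg_grad_apply (H : EN N × EN d → EN d) (v : EN N → EN d) (Dv : EN N → Mat d N) (x y : EN N) :
    hg_grad H v Dv x y = fderiv ℝ H (x, v x) (y, Dv x y) := rfl

theorem hg_grad_norm {H : EN N × EN d → EN d} {C : ℝ} (hC : ∀ p, ‖fderiv ℝ H p‖ ≤ C)
    (v : EN N → EN d) (Dv : EN N → Mat d N) (x : EN N) : ‖hg_grad H v Dv x‖ ≤ C * (1 + ‖Dv x‖) := by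
  have hC0 : 0 ≤ C := (norm_nonneg _).trans (hC 0)
  refine ContinuousLinearMap.opNorm_le_bound _ (by positivity) fun y => ?_
  rw [hg_grad_apply]
  refine ((fderiv ℝ H (x, v x)).le_opNorm _).trans ?_
  rw [mul_assoc]
  refine mul_le_mul (hC _) ?_ (norm_nonneg _) hC0
  rw [Prod.norm_mk]
  have := (Dv x).le_opNorm y
  refine max_le ?_ ?_ <;> nlinarith [norm_nonneg y, norm_nonneg (Dv x), mul_nonneg (norm_nonneg (Dv x)) (norm_nonneg y)]

theorem hg_grad_aesm {H : EN N × EN d → EN d} (hH : ContDiff ℝ 1 H) {μ : Measure (EN N)}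
    {v : EN N → EN d} {Dv : EN N → Mat d N} (hv : AEStronglyMeasurable v μ)
    (hDv : AEStronglyMeasurable Dv μ) : AEStronglyMeasurable (hg_grad H v Dv) μ := by
  have hHd := hH.continuous_fderiv (by simp)
  have hm1 : AEStronglyMeasurable (fun x => fderiv ℝ H (x, v x)) μ :=
    hHd.comp_aestronglyMeasurable (aestronglyMeasurable_id.prodMk hv)
  have hcc : Continuous fun p : ((EN N × EN d) →L[ℝ] EN d) × (Mat d N) =>
      p.1.comp ((ContinuousLinearMap.id ℝ (EN N)).prod p.2) := by
    refine continuous_fst.clm_comp ?_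
    have e : ∀ A : Mat d N, (ContinuousLinearMap.id ℝ (EN N)).prod A =
      ContinuousLinearMap.inl ℝ (EN N) (EN d) + (ContinuousLinearMap.inr ℝ (EN N) (EN d)).comp A := by
      intro A; ext1 x; simp
    simp only [e]
    exact continuous_const.add (continuous_const.clm_comp continuous_snd)
  exact hcc.comp_aestronglyMeasurable (hm1.prodMk hDv)

theorem hg_chain {Ω : Set (EN N)} (hΩ : IsOpen Ω) (hb : Bornology.IsBounded Ω)
    {H : EN N × EN d → EN d} (hH : ContDiff ℝ 1 H) {C : ℝ}
    (hC : ∀ p, ‖fderiv ℝ H p‖ ≤ C)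
    {v : EN N → EN d} {Dv : EN N → Mat d N} (h : MemW11 Ω v Dv) :
    MemW11 Ω (fun x => H (x, v x)) (hg_grad H v Dv) := by
  have hC0 : 0 ≤ C := (norm_nonneg _).trans (hC 0)
  have hfin : volume Ω ≠ ⊤ := hb.measure_lt_top.ne
  obtain ⟨R, hR⟩ := hb.exists_norm_le
  refine ⟨?_, ?_, ?_⟩
  · have hi : IntegrableOn (fun x => ‖H 0‖ + C * (R + ‖v x‖)) Ω :=
      (integrableOn_const hfin).add (((integrableOn_const hfin).add h.1.norm).const_mul C)
    refine hi.mono' (hH.continuous.comp_aestronglyMeasurable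
      (aestronglyMeasurable_id.prodMk h.1.aestronglyMeasurable)) ?_
    filter_upwards [ae_restrict_mem hΩ.measurableSet] with x hx
    have h1 := hg_lip_of_fderiv hH hC (x, v x) 0
    have h2 : ‖H (x, v x)‖ ≤ ‖H 0‖ + ‖H (x, v x) - H 0‖ := by
      refine le_trans (le_of_eq ?_) (norm_add_le _ _)
      rw [add_sub_cancel]
    rw [sub_zero, Prod.norm_mk] at h1
    have h3 : max ‖x‖ ‖v x‖ ≤ R + ‖v x‖ := by
      have := hR x hx
      have := norm_nonneg x
      exact max_le (by linarith [norm_nonneg (v x)]) (by linarith)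
    have := mul_le_mul_of_nonneg_left h3 hC0
    linarith
  · have hi : IntegrableOn (fun x => C * (1 + ‖Dv x‖)) Ω :=
      ((integrableOn_const hfin).add h.2.1.norm).const_mul C
    exact hi.mono' (hg_grad_aesm hH h.1.aestronglyMeasurable h.2.1.aestronglyMeasurable)
      (Eventually.of_forall fun x => hg_grad_norm hC v Dv x)
  · intro φ hφ hφc hφs y
    obtain ⟨η, hη, hηc, hηs, -, hη1⟩ := hg_cutoff hφc hΩ hφs
    have hw := hg_cut hΩ.measurableSet h hη hηc hηs
    have key := hg_chain_univ hH hC hw hφ hφc y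
    have hφ0 : ∀ x, x ∉ tsupport φ → φ x = 0 := fun x hx => image_eq_zero_of_notMem_tsupport hx
    have hφ0' : ∀ x, x ∉ tsupport φ → fderiv ℝ φ x = 0 := fun x hx =>
      image_eq_zero_of_notMem_tsupport fun hh => hx (tsupport_fderiv_subset ℝ hh)
    have hη1' : ∀ x ∈ tsupport φ, η x = 1 ∧ fderiv ℝ η x = 0 := by
      intro x hx
      have : ∀ᶠ y in 𝓝 x, η y = 1 := (eventually_nhdsSet_iff_forall.1 hη1) x hx
      refine ⟨this.self_of_nhds, ?_⟩
      have h2 : η =ᶠ[𝓝 x] fun _ => (1:ℝ) := this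
      rw [h2.fderiv_eq]; simp
    have e1 : ∀ x, fderiv ℝ φ x y • H (x, η x • v x) = fderiv ℝ φ x y • H (x, v x) := by
      intro x
      by_cases hx : x ∈ tsupport φ
      · rw [(hη1' x hx).1, one_smul]
      · rw [hφ0' x hx]; simp
    have e2 : ∀ x, φ x • fderiv ℝ H (x, η x • v x) (y, (η x • Dv x + (fderiv ℝ η x).smulRight (v x)) y)
       = φ x • hg_grad H v Dv x y := by
      intro x
      by_cases hx : x ∈ tsupport φ
      · rw [(hη1' x hx).1, one_smul, (hη1' x hx).2, hg_grad_apply]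
        congr 3
        simp
      · rw [hφ0 x hx]; simp
    simp only [e1, e2] at key
    rw [setIntegral_eq_integral_of_forall_compl_eq_zero, setIntegral_eq_integral_of_forall_compl_eq_zero]
    · exact key
    · intro x hx; simp [hφ0 x fun hh => hx (hφs hh)]
    · intro x hx; simp [hφ0' x fun hh => hx (hφs hh)]

theorem hg_unique {Ω : Set (EN N)} (hΩ : IsOpen Ω)
    {u v : EN N → EN d} {Du Dv : EN N → Mat d N} (hu : MemW11 Ω u Du) (hv : MemW11 Ω v Dv)
    (h : ∀ᵐ x ∂(volume.restrict Ω), u x = v x) : ∀ᵐ x ∂(volume.restrict Ω), Du x = Dv x := by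
  have key : ∀ y : EN N, ∀ᵐ x, x ∈ Ω → (Du x y - Dv x y) = 0 := by
    intro y
    have i1 : IntegrableOn (fun x => Du x y) Ω := hu.2.1.apply_continuousLinearMap y
    have i2 : IntegrableOn (fun x => Dv x y) Ω := hv.2.1.apply_continuousLinearMap y
    refine hΩ.ae_eq_zero_of_integral_contDiff_smul_eq_zero (i1.sub i2).locallyIntegrableOn
      fun φ hφ hφc hφs => ?_
    obtain ⟨B, hB⟩ := hφ.continuous.bounded_above_of_compact_support hφc
    have h1 := hu.2.2 φ hφ hφc hφs y
    have h2 := hv.2.2 φ hφ hφc hφs y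
    have h3 : ∫ x in Ω, fderiv ℝ φ x y • u x = ∫ x in Ω, fderiv ℝ φ x y • v x :=
      integral_congr_ae (by filter_upwards [h] with x hx; rw [hx])
    rw [h1, h2, neg_inj] at h3
    have j1 : IntegrableOn (fun x => φ x • Du x y) Ω :=
      i1.bdd_smul B hφ.continuous.aestronglyMeasurable (Eventually.of_forall hB)
    have j2 : IntegrableOn (fun x => φ x • Dv x y) Ω :=
      i2.bdd_smul B hφ.continuous.aestronglyMeasurable (Eventually.of_forall hB)
    rw [← setIntegral_eq_integral_of_forall_compl_eq_zero (s := Ω)]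
    · simp only [smul_sub]
      rw [integral_sub j1 j2, h3, sub_self]
    · intro x hx
      rw [image_eq_zero_of_notMem_tsupport fun hh => hx (hφs hh), zero_smul]
  have hall : ∀ᵐ x, ∀ i : Fin N, x ∈ Ω → (Du x (EuclideanSpace.basisFun (Fin N) ℝ i)
      - Dv x (EuclideanSpace.basisFun (Fin N) ℝ i)) = 0 :=
    ae_all_iff.2 fun i => key _
  rw [ae_restrict_iff' hΩ.measurableSet]
  filter_upwards [hall] with x hx hxΩ
  refine ContinuousLinearMap.coe_injective ((EuclideanSpace.basisFun (Fin N) ℝ).toBasis.ext fun i => ?_)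
  simpa [sub_eq_zero] using hx i hxΩ

end

end

section
open MeasureTheory Filter Set
open scoped ENNReal RealInnerProductSpace Topology NNReal

variable {N d : ℕ}

theorem hg_iadd {X F : Type*} [MeasurableSpace X] {μ : Measure X} [NormedAddCommGroup F] {g h : X → F}
    (hg : Integrable g μ) (hh : Integrable h μ) : Integrable (fun x => g x + h x) μ := hg.add hh

theorem hg_isub {X F : Type*} [MeasurableSpace X] {μ : Measure X} [NormedAddCommGroup F] {g h : X → F}
    (hg : Integrable g μ) (hh : Integrable h μ) : Integrable (fun x => g x - h x) μ := hg.sub hh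

theorem hg_diff_smooth {g : EN N → EN d} (hg : ContDiff ℝ 1 g)
    (hgi : Integrable g) (hDi : Integrable (fderiv ℝ g)) (h : EN N) {B : ℝ} (hB0 : 0 ≤ B)
    (hB : ∀ t ∈ Icc (0:ℝ) 1, ∫ x, ‖fderiv ℝ g (x + t • h) - fderiv ℝ g x‖ ≤ B) :
    ∫ x, ‖g (x + h) - g x - fderiv ℝ g x h‖ ≤ ‖h‖ * B := by
  have hcd : Continuous (fderiv ℝ g) := hg.continuous_fderiv (by simp)
  have hInt0 : Integrable (fun x => g (x + h) - g x - fderiv ℝ g x h) :=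
    ((hgi.comp_add_right h).sub hgi).sub (hDi.apply_continuousLinearMap h)
  rw [integral_norm_eq_lintegral_enorm hInt0.aestronglyMeasurable]
  refine ENNReal.toReal_le_of_le_ofReal (by positivity) ?_
  have hpt : ∀ x, ‖g (x + h) - g x - fderiv ℝ g x h‖ₑ ≤
      ∫⁻ t in Ioc (0:ℝ) 1, ‖h‖ₑ * ‖fderiv ℝ g (x + t • h) - fderiv ℝ g x‖ₑ := by
    intro x
    have hder : ∀ t : ℝ, HasDerivAt (fun t : ℝ => g (x + t • h)) (fderiv ℝ g (x + t • h) h) t := by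
      intro t
      have h1 : HasDerivAt (fun t : ℝ => x + t • h) h t := by
        simpa using ((hasDerivAt_id t).smul_const h).const_add x
      exact ((hg.differentiable (by simp)) _).hasFDerivAt.comp_hasDerivAt t h1
    have hc : Continuous fun t : ℝ => fderiv ℝ g (x + t • h) h :=
      (hcd.comp (by fun_prop)).clm_apply continuous_const
    have e : ∫ t in (0:ℝ)..1, fderiv ℝ g (x + t • h) h = g (x + h) - g x := by
      rw [intervalIntegral.integral_eq_sub_of_hasDerivAt (fun t _ => hder t)
        (hc.intervalIntegrable _ _)]
      simp
    have e2 : g (x + h) - g x - fderiv ℝ g x h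
        = ∫ t in Ioc (0:ℝ) 1, (fderiv ℝ g (x + t • h) h - fderiv ℝ g x h) := by
      rw [← intervalIntegral.integral_of_le (by norm_num), intervalIntegral.integral_sub
        (hc.intervalIntegrable _ _) (by simp), e]
      simp
    rw [e2]
    refine (enorm_integral_le_lintegral_enorm _).trans (lintegral_mono fun t => ?_)
    rw [← sub_apply, mul_comm]
    exact ContinuousLinearMap.le_opENorm _ _
  refine (lintegral_mono hpt).trans ?_
  rw [lintegral_lintegral_swap]
  · have : ∀ t ∈ Ioc (0:ℝ) 1, ∫⁻ x, ‖h‖ₑ * ‖fderiv ℝ g (x + t • h) - fderiv ℝ g x‖ₑ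
        ≤ ENNReal.ofReal (‖h‖ * B) := by
      intro t ht
      rw [lintegral_const_mul' _ _ enorm_ne_top, ENNReal.ofReal_mul (norm_nonneg _), ofReal_norm]
      gcongr
      rw [← ofReal_integral_norm_eq_lintegral_enorm (hg_isub (hDi.comp_add_right (t • h)) hDi)]
      exact ENNReal.ofReal_le_ofReal (hB t ⟨ht.1.le, ht.2⟩)
    refine (setLIntegral_mono' measurableSet_Ioc this).trans ?_
    simp
  · refine Continuous.aemeasurable ?_
    have hc2 : Continuous fun p : EN N × ℝ => ‖h‖ * ‖fderiv ℝ g (p.1 + p.2 • h) - fderiv ℝ g p.1‖ := by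
      refine continuous_const.mul (Continuous.norm (Continuous.sub (hcd.comp (by fun_prop))
        (hcd.comp continuous_fst)))
    refine (ENNReal.continuous_ofReal.comp hc2).congr fun p => ?_
    simp only [Function.comp, Function.uncurry]
    rw [ENNReal.ofReal_mul (norm_nonneg _), ofReal_norm, ofReal_norm]

theorem hg_L1diff {w : EN N → EN d} {Dw : EN N → Mat d N} (hw : MemW11 univ w Dw) {η : ℝ} (hη : 0 < η) :
    ∃ δ > 0, ∀ h : EN N, ‖h‖ < δ → ∫ x, ‖w (x + h) - w x - Dw x h‖ ≤ η * ‖h‖ := by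
  obtain ⟨hwi, hDi, -⟩ := hg_W_univ hw
  have hT := hg_translate hDi
  rw [Metric.tendsto_nhds_nhds] at hT
  obtain ⟨δ, hδ, hδ'⟩ := hT η hη
  refine ⟨δ, hδ, fun h hh => ?_⟩
  set wn := fun n => hg_moll n w
  set a := fun n => ∫ x, ‖wn n x - w x‖
  set b := fun n => ∫ x, ‖fderiv ℝ (wn n) x - Dw x‖
  have ha : Tendsto a atTop (𝓝 0) := hg_moll_tendsto hwi
  have hb : Tendsto b atTop (𝓝 0) := hg_approx hw
  have hb0 : ∀ n, 0 ≤ b n := fun n => integral_nonneg fun _ => norm_nonneg _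
  have hwni : ∀ n, Integrable (wn n) := fun n => hg_moll_integrable n hwi
  have hDni : ∀ n, Integrable (fderiv ℝ (wn n)) := fun n => hg_moll_fderiv_integrable hw n
  have key : ∀ n, ∫ x, ‖w (x + h) - w x - Dw x h‖ ≤ ‖h‖ * (η + 2 * b n) + 2 * a n + ‖h‖ * b n := by
    intro n
    have hs : ∫ x, ‖wn n (x + h) - wn n x - fderiv ℝ (wn n) x h‖ ≤ ‖h‖ * (η + 2 * b n) := by
      refine hg_diff_smooth ((hg_moll_smooth n hwi).of_le (by norm_cast)) (hwni n) (hDni n) h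
        (by have := hb0 n; positivity) fun t ht => ?_
      have h1 : ∫ x, ‖Dw (x + t • h) - Dw x‖ ≤ η := by
        have hth : ‖t • h‖ < δ := by
          rw [norm_smul, Real.norm_eq_abs, abs_of_nonneg ht.1]
          nlinarith [norm_nonneg h, ht.2, ht.1]
        have := hδ' (x := t • h) (by simpa using hth)
        rw [Real.dist_eq, sub_zero] at this
        exact (le_abs_self _).trans this.le
      have i1 : Integrable (fun x => ‖fderiv ℝ (wn n) x - Dw x‖) := ((hDni n).sub hDi).norm
      have i2 : Integrable (fun x => ‖fderiv ℝ (wn n) (x + t • h) - Dw (x + t • h)‖) :=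
        i1.comp_add_right (t • h)
      have i3 : Integrable (fun x => ‖Dw (x + t • h) - Dw x‖) :=
        ((hDi.comp_add_right (t • h)).sub hDi).norm
      have e2 : ∫ x, ‖fderiv ℝ (wn n) (x + t • h) - Dw (x + t • h)‖ = b n :=
        integral_add_right_eq_self (fun x => ‖fderiv ℝ (wn n) x - Dw x‖) (t • h)
      calc ∫ x, ‖fderiv ℝ (wn n) (x + t • h) - fderiv ℝ (wn n) x‖
          ≤ ∫ x, (‖fderiv ℝ (wn n) (x + t • h) - Dw (x + t • h)‖ + ‖Dw (x + t • h) - Dw x‖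
              + ‖fderiv ℝ (wn n) x - Dw x‖) := by
            refine integral_mono_of_nonneg (Eventually.of_forall fun x => norm_nonneg _)
              ((i2.add i3).add i1) (Eventually.of_forall fun x => ?_)
            have := norm_sub_le_norm_sub_add_norm_sub (fderiv ℝ (wn n) (x + t • h)) (Dw (x + t • h)) (fderiv ℝ (wn n) x)
            have h4 := norm_sub_le_norm_sub_add_norm_sub (Dw (x + t • h)) (Dw x) (fderiv ℝ (wn n) x)
            rw [norm_sub_rev (Dw x)] at h4
            dsimp only
            linarith
        _ = b n + (∫ x, ‖Dw (x + t • h) - Dw x‖) + b n := by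
            rw [integral_add (hg_iadd i2 i3) i1, integral_add i2 i3, e2]
        _ ≤ _ := by linarith
    have j0 : Integrable (fun x => ‖wn n (x + h) - wn n x - fderiv ℝ (wn n) x h‖) :=
      ((((hwni n).comp_add_right h).sub (hwni n)).sub ((hDni n).apply_continuousLinearMap h)).norm
    have j1 : Integrable (fun x => ‖wn n x - w x‖) := ((hwni n).sub hwi).norm
    have j2 : Integrable (fun x => ‖wn n (x + h) - w (x + h)‖) := j1.comp_add_right h
    have e2 : ∫ x, ‖wn n (x + h) - w (x + h)‖ = a n :=
      integral_add_right_eq_self (fun x => ‖wn n x - w x‖) h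
    have j3 : Integrable (fun x => ‖h‖ * ‖fderiv ℝ (wn n) x - Dw x‖) :=
      ((hDni n).sub hDi).norm.const_mul _
    calc ∫ x, ‖w (x + h) - w x - Dw x h‖ ≤ ∫ x, (‖wn n (x + h) - wn n x - fderiv ℝ (wn n) x h‖
          + ‖wn n (x + h) - w (x + h)‖ + ‖wn n x - w x‖ + ‖h‖ * ‖fderiv ℝ (wn n) x - Dw x‖) := by
            refine integral_mono_of_nonneg (Eventually.of_forall fun x => norm_nonneg _)
              (((j0.add j2).add j1).add j3) (Eventually.of_forall fun x => ?_)
            have h5 : ‖fderiv ℝ (wn n) x h - Dw x h‖ ≤ ‖h‖ * ‖fderiv ℝ (wn n) x - Dw x‖ := by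
              rw [← sub_apply, mul_comm]
              exact ContinuousLinearMap.le_opNorm _ _
            have e : w (x + h) - w x - Dw x h = (wn n (x + h) - wn n x - fderiv ℝ (wn n) x h)
              - (wn n (x + h) - w (x + h)) + (wn n x - w x) + (fderiv ℝ (wn n) x h - Dw x h) := by
              abel
            dsimp only
            rw [e]
            refine (norm_add_le _ _).trans (add_le_add ((norm_add_le _ _).trans
              (add_le_add (norm_sub_le _ _) le_rfl)) h5)
      _ = (∫ x, ‖wn n (x + h) - wn n x - fderiv ℝ (wn n) x h‖) + a n + a n + ‖h‖ * b n := by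
            rw [integral_add (hg_iadd (hg_iadd j0 j2) j1) j3, integral_add (hg_iadd j0 j2) j1, integral_add j0 j2, e2,
              integral_const_mul]
      _ ≤ _ := by linarith
  have hlim : Tendsto (fun n => ‖h‖ * (η + 2 * b n) + 2 * a n + ‖h‖ * b n) atTop
      (𝓝 (‖h‖ * (η + 2 * 0) + 2 * 0 + ‖h‖ * 0)) :=
    (((((hb.const_mul 2).const_add η).const_mul _).add (ha.const_mul 2)).add (hb.const_mul _))
  have := ge_of_tendsto' hlim key
  linarith

end

section
open MeasureTheory Filter Set
open scoped ENNReal RealInnerProductSpace Topology NNReal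

variable {N d : ℕ}

/-- local retraction property -/
def hg_retr (M : Set (EN d)) (V : Set (EN d)) (r : EN d → EN d) : Prop :=
  IsOpen V ∧ ContDiffOn ℝ 1 r V ∧ (∀ y ∈ V, r y ∈ M) ∧ ∀ y ∈ V, y ∈ M → r y = y

theorem hg_retr_local {M : Set (EN d)} {m : ℕ} (hM : IsSubmanifoldDim d m M) {x : EN d} (hx : x ∈ M) :
    ∃ V r, x ∈ V ∧ hg_retr M V r := by
  obtain ⟨U, F, hU, hxU, hF, hMU, hsurj⟩ := hM x hx
  have hFx : F x = 0 := by
    have : x ∈ M ∩ U := ⟨hx, hxU⟩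
    rw [hMU] at this; exact this.2
  have hFc : ContDiffAt ℝ 1 F x := ((hF x hxU).contDiffAt (hU.mem_nhds hxU)).of_le (by norm_cast)
  have hs : HasStrictFDerivAt F (fderiv ℝ F x) x := hFc.hasStrictFDerivAt (by simp)
  have hr : (fderiv ℝ F x).range = ⊤ := LinearMap.range_eq_top.2 (hsurj x hxU)
  have hker : (fderiv ℝ F x).ker.ClosedComplemented := Submodule.ClosedComplemented.of_finiteDimensional _
  set φ := hs.implicitFunctionDataOfComplemented F (fderiv ℝ F x) hr hker with hφ
  have hl : φ.leftFun = F := rfl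
  have hpt : φ.pt = x := rfl
  have hrf : ContDiff ℝ 1 φ.rightFun := by
    have : φ.rightFun = fun y => Classical.choose hker (y - x) := rfl
    rw [this]
    exact (Classical.choose hker).contDiff.comp (contDiff_id.sub contDiff_const)
  have hcd := φ.contDiffAt_implicitFunction (n := 1) (by rw [hl, hpt]; exact hFc) hrf.contDiffAt (by simp)
  have hprod : φ.prodFun φ.pt = (0, φ.rightFun x) := by
    rw [φ.prodFun_apply, hl, hpt, hFx]
  rw [hprod] at hcd
  set r : EN d → EN d := fun y => φ.implicitFunction 0 (φ.rightFun y)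
  have hrc : ContDiffAt ℝ 1 r x :=
    hcd.comp (f := fun y => ((0 : EN (d - m)), φ.rightFun y)) x
      (contDiffAt_const.prodMk hrf.contDiffAt)
  have hrx : r x = x := by
    have := φ.implicitFunction_apply_image.self_of_nhds
    rw [hl, hpt, hFx] at this
    exact this
  have h1 : ∀ᶠ y in 𝓝 x, r y ∈ U := hrc.continuousAt.eventually (by rw [hrx]; exact hU.mem_nhds hxU)
  have h2 : ∀ᶠ y in 𝓝 x, F (r y) = 0 := by
    have := φ.leftFun_implicitFunction_eq_leftFun
    rw [hl, hpt, hFx] at this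
    exact this
  have h3 : ∀ᶠ y in 𝓝 x, φ.implicitFunction (F y) (φ.rightFun y) = y := φ.implicitFunction_apply_image
  have h4 : ∀ᶠ y in 𝓝 x, ContDiffAt ℝ 1 r y := hrc.eventually (by simp)
  have h5 : ∀ᶠ y in 𝓝 x, y ∈ U := hU.mem_nhds hxU
  obtain ⟨V, hV, hVo, hxV⟩ := eventually_nhds_iff.1 (h1.and (h2.and (h3.and (h4.and h5))))
  refine ⟨V, r, hxV, hVo, fun y hy => (hV y hy).2.2.2.1.contDiffWithinAt, fun y hy => ?_, fun y hy hyM => ?_⟩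
  · have : r y ∈ M ∩ U := by rw [hMU]; exact ⟨(hV y hy).1, (hV y hy).2.1⟩
    exact this.1
  · have : y ∈ M ∩ U := ⟨hyM, (hV y hy).2.2.2.2⟩
    rw [hMU] at this
    have h := (hV y hy).2.2.1
    rw [this.2] at h
    exact h

theorem hg_retr_glue {M K1 K2 V1 V2 : Set (EN d)} {r1 r2 : EN d → EN d} (hK1 : IsCompact K1)
    (hK2M : K2 ⊆ M) (h1 : K1 ⊆ V1) (h2 : K2 ⊆ V2) (hr1 : hg_retr M V1 r1) (hr2 : hg_retr M V2 r2) :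
    ∃ V r, K1 ∪ K2 ⊆ V ∧ hg_retr M V r := by
  classical
  obtain ⟨o1, c1, m1, i1⟩ := hr1
  obtain ⟨o2, c2, m2, i2⟩ := hr2
  obtain ⟨χ, hχ, hχc, hχs, hχ01, hχ1⟩ := hg_cutoff hK1 o1 h1
  have hχ' : ContDiff ℝ 1 χ := hχ.of_le (by norm_cast)
  set q : EN d → EN d := fun y => y + χ y • (r1 y - y) with hq
  have hqc : ContDiff ℝ 1 q := by
    rw [contDiff_iff_contDiffAt]
    intro y
    by_cases hy : y ∈ tsupport χ
    · have hy1 := hχs hy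
      have : ContDiffAt ℝ 1 r1 y := (c1 y hy1).contDiffAt (o1.mem_nhds hy1)
      exact contDiffAt_id.add (hχ'.contDiffAt.smul (this.sub contDiffAt_id))
    · have : q =ᶠ[𝓝 y] id := by
        have h0 := notMem_tsupport_iff_eventuallyEq.1 hy
        filter_upwards [h0] with z hz
        simp [hq, hz]
      exact contDiffAt_id.congr_of_eventuallyEq this
  have hqM : ∀ y ∈ M, q y = y := by
    intro y hy
    by_cases hy1 : y ∈ V1
    · simp [hq, i1 y hy1 hy]
    · have : χ y = 0 := by
        by_contra h
        exact hy1 (hχs (subset_tsupport _ h))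
      simp [hq, this]
  set W1 : Set (EN d) := interior {y | χ y = 1}
  set W2 : Set (EN d) := q ⁻¹' V2
  have hW2 : IsOpen W2 := o2.preimage hqc.continuous
  have hW1V : W1 ⊆ V1 := fun y hy => by
    have : χ y = 1 := interior_subset (s := {y | χ y = 1}) hy
    exact hχs (subset_tsupport _ (by simp [this]))
  have hq1 : ∀ y ∈ W1, q y = r1 y := fun y hy => by
    have : χ y = 1 := interior_subset (s := {y | χ y = 1}) hy
    simp [hq, this]
  set r : EN d → EN d := fun y => if y ∈ W1 then r1 y else r2 (q y)
  have hrW1 : ∀ y ∈ W1, r y = r1 y := fun y hy => by simp [r, hy]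
  have hrW2 : ∀ y ∈ W2, r y = r2 (q y) := fun y hy => by
    by_cases h : y ∈ W1
    · rw [hrW1 y h, hq1 y h, i2 _ _ (m1 y (hW1V h))]
      rw [← hq1 y h]; exact hy
    · simp [r, h]
  refine ⟨W1 ∪ W2, r, ?_, isOpen_interior.union hW2, ?_, ?_, ?_⟩
  · refine union_subset_union ?_ ?_
    · have := hχ1
      rw [eventually_nhdsSet_iff_forall] at this
      exact fun y hy => mem_interior_iff_mem_nhds.2 (this y hy)
    · intro y hy
      change q y ∈ V2
      rw [hqM y (hK2M hy)]; exact h2 hy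
  · rintro y (hy | hy)
    · refine ContDiffAt.contDiffWithinAt ?_
      have : ContDiffAt ℝ 1 r1 y := (c1 y (hW1V hy)).contDiffAt (o1.mem_nhds (hW1V hy))
      exact this.congr_of_eventuallyEq (Filter.eventually_of_mem (isOpen_interior.mem_nhds hy) hrW1)
    · refine ContDiffAt.contDiffWithinAt ?_
      have : ContDiffAt ℝ 1 r2 (q y) := (c2 _ hy).contDiffAt (o2.mem_nhds hy)
      have h' : ContDiffAt ℝ 1 (fun y => r2 (q y)) y := this.comp y hqc.contDiffAt
      exact h'.congr_of_eventuallyEq (Filter.eventually_of_mem (hW2.mem_nhds hy) hrW2)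
  · rintro y (hy | hy)
    · rw [hrW1 y hy]; exact m1 y (hW1V hy)
    · rw [hrW2 y hy]; exact m2 _ hy
  · rintro y (hy | hy) hyM
    · rw [hrW1 y hy, i1 y (hW1V hy) hyM]
    · rw [hrW2 y hy, hqM y hyM]
      refine i2 y ?_ hyM
      rw [← hqM y hyM]; exact hy

theorem hg_retraction {M : Set (EN d)} (hM : IsNiceManifold d M) :
    ∃ (G : EN d → EN d) (δ : ℝ), 0 < δ ∧ ContDiff ℝ 1 G ∧ HasCompactSupport G ∧
      (∀ y, Metric.infDist y M < δ → G y ∈ M) ∧ ∀ s ∈ M, G s = s := by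
  obtain ⟨hne, hc, -, m, -, hsub⟩ := hM
  have key : ∃ K, IsCompact K ∧ K ⊆ M ∧ M ⊆ K ∧ ∃ V r, K ⊆ V ∧ hg_retr M V r := by
    refine hc.induction_on (p := fun A => ∃ K, IsCompact K ∧ K ⊆ M ∧ A ⊆ K ∧ ∃ V r, K ⊆ V ∧ hg_retr M V r)
      ?_ ?_ ?_ ?_
    · refine ⟨∅, isCompact_empty, by simp, by simp, ∅, id, by simp, isOpen_empty, ?_, ?_, ?_⟩
      · exact fun y hy => absurd hy (by simp)
      · simp
      · simp
    · rintro s t hst ⟨K, h1, h2, h3, h4⟩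
      exact ⟨K, h1, h2, hst.trans h3, h4⟩
    · rintro s t ⟨K1, a1, a2, a3, V1, r1, a4, a5⟩ ⟨K2, b1, b2, b3, V2, r2, b4, b5⟩
      exact ⟨K1 ∪ K2, a1.union b1, union_subset a2 b2, union_subset_union a3 b3,
        hg_retr_glue a1 b2 a4 b4 a5 b5⟩
    · intro x hx
      obtain ⟨V, r, hxV, hr⟩ := hg_retr_local hsub hx
      obtain ⟨ρ, hρ, hball⟩ := Metric.nhds_basis_closedBall.mem_iff.1 (hr.1.mem_nhds hxV)
      refine ⟨M ∩ Metric.closedBall x ρ, ?_, M ∩ Metric.closedBall x ρ,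
        hc.inter_right Metric.isClosed_closedBall, inter_subset_left, subset_rfl, V, r,
        inter_subset_right.trans hball, hr⟩
      exact inter_mem_nhdsWithin M (Metric.closedBall_mem_nhds x hρ)
  obtain ⟨K, hK, -, hMK, V, r, hKV, hVo, hrc, hrM, hrid⟩ := key
  obtain ⟨η, hη, hηc, hηs, hη01, hη1⟩ := hg_cutoff hc hVo (hMK.trans hKV)
  have hη' : ContDiff ℝ 1 η := hη.of_le (by norm_cast)
  have hop : M ⊆ interior {y | η y = 1} := by
    rw [eventually_nhdsSet_iff_forall] at hη1
    exact fun y hy => mem_interior_iff_mem_nhds.2 (hη1 y hy)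
  obtain ⟨δ, hδ, hth⟩ := hc.exists_thickening_subset_open isOpen_interior hop
  have h1V : ∀ y, η y = 1 → y ∈ V := fun y hy => hηs (subset_tsupport _ (by simp [hy]))
  refine ⟨fun y => η y • r y, δ, hδ, ?_, ?_, ?_, ?_⟩
  · rw [contDiff_iff_contDiffAt]
    intro y
    by_cases hy : y ∈ tsupport η
    · exact hη'.contDiffAt.smul ((hrc y (hηs hy)).contDiffAt (hVo.mem_nhds (hηs hy)))
    · have : (fun y => η y • r y) =ᶠ[𝓝 y] fun _ => 0 := by
        filter_upwards [notMem_tsupport_iff_eventuallyEq.1 hy] with z hz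
        simp [hz]
      exact contDiffAt_const.congr_of_eventuallyEq this
  · exact hηc.smul_right
  · intro y hy
    have : η y = 1 := interior_subset (s := {y | η y = 1}) (hth ((Metric.mem_thickening_iff_infDist_lt hne).2 hy))
    simp only [this, one_smul]
    exact hrM y (h1V y this)
  · intro s hs
    have : η s = 1 := interior_subset (s := {y | η y = 1}) (hop hs)
    simp only [this, one_smul]
    exact hrid s (h1V s this) hs

end

section
open MeasureTheory Filter Set
open scoped ENNReal RealInnerProductSpace Topology NNReal

variable {N d : ℕ}

/-- A global compactly supported `C¹` map that retracts a neighbourhood onto `M`. -/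
structure hg_Ret (M : Set (EN d)) (G : EN d → EN d) (δ C : ℝ) : Prop where
  ne : M.Nonempty
  cpt : IsCompact M
  dpos : 0 < δ
  smooth : ContDiff ℝ 1 G
  mem : ∀ y, Metric.infDist y M < δ → G y ∈ M
  idM : ∀ s ∈ M, G s = s
  C1 : 1 ≤ C
  bd : ∀ p, ‖fderiv ℝ G p‖ ≤ C
  uc : UniformContinuous (fderiv ℝ G)

theorem hg_ret_exists {M : Set (EN d)} (hM : IsNiceManifold d M) : ∃ G δ C, hg_Ret M G δ C := by
  obtain ⟨G, δ, hδ, hG, hc, hm, hi⟩ := hg_retraction hM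
  have hcd : Continuous (fderiv ℝ G) := hG.continuous_fderiv (by simp)
  obtain ⟨C, hC⟩ := hcd.bounded_above_of_compact_support (hc.fderiv ℝ)
  exact ⟨G, δ, max C 1, hM.1, hM.2.1, hδ, hG, hm, hi, le_max_right _ _,
    fun p => (hC p).trans (le_max_left _ _), (hc.fderiv ℝ).uniformContinuous_of_continuous hcd⟩

namespace hg_Ret
variable {M : Set (EN d)} {G : EN d → EN d} {δ C : ℝ}

theorem tan_fix (h : hg_Ret M G δ C) {s v : EN d} (hv : v ∈ TangentSet M s) :
    fderiv ℝ G s v = v := by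
  obtain ⟨γ, h1, h2, h3⟩ := hv
  have hd : HasFDerivAt G (fderiv ℝ G (γ 0)) (γ 0) := ((h.smooth.differentiable (by simp)) _).hasFDerivAt
  have h4 : HasDerivAt (fun t => G (γ t)) (fderiv ℝ G (γ 0) v) 0 := hd.comp_hasDerivAt 0 h3
  have h5 : (fun t => G (γ t)) = γ := funext fun t => h.idM _ (h1 t)
  rw [h5, h2] at h4
  exact h4.unique h3

theorem tan_mem (h : hg_Ret M G δ C) {s : EN d} (hs : s ∈ M) (v : EN d) :
    fderiv ℝ G s v ∈ TangentSet M s := by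
  classical
  set γ : ℝ → EN d := fun t => if Metric.infDist (s + t • v) M < δ then G (s + t • v) else s
  have h0 : Metric.infDist (s + (0:ℝ) • v) M < δ := by
    simp [Metric.infDist_zero_of_mem hs, h.dpos]
  have hcont : Continuous fun t : ℝ => Metric.infDist (s + t • v) M :=
    (Metric.continuous_infDist_pt M).comp (by fun_prop)
  have hev : γ =ᶠ[𝓝 0] fun t => G (s + t • v) := by
    filter_upwards [hcont.continuousAt.eventually (gt_mem_nhds h0)] with t ht
    simp only [γ, if_pos ht]
  refine ⟨γ, fun t => ?_, ?_, ?_⟩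
  · by_cases ht : Metric.infDist (s + t • v) M < δ
    · simp only [γ, if_pos ht]; exact h.mem _ ht
    · simp only [γ, if_neg ht]; exact hs
  · rw [hev.self_of_nhds]; simp [h.idM s hs]
  · refine HasDerivAt.congr_of_eventuallyEq ?_ hev
    have h1 : HasDerivAt (fun t : ℝ => s + t • v) v 0 := by
      simpa using ((hasDerivAt_id (0:ℝ)).smul_const v).const_add s
    have hd : HasFDerivAt G (fderiv ℝ G (s + (0:ℝ) • v)) (s + (0:ℝ) • v) :=
      ((h.smooth.differentiable (by simp)) _).hasFDerivAt
    have := hd.comp_hasDerivAt 0 h1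
    simpa [Function.comp_def] using this

theorem tan_zero (h : hg_Ret M G δ C) {s : EN d} (hs : s ∈ M) : (0 : EN d) ∈ TangentSet M s := by
  simpa using h.tan_mem hs 0

theorem tan_iff (h : hg_Ret M G δ C) {s : EN d} (hs : s ∈ M) (v : EN d) :
    v ∈ TangentSet M s ↔ fderiv ℝ G s v = v :=
  ⟨h.tan_fix, fun hv => hv ▸ h.tan_mem hs v⟩

theorem idem (h : hg_Ret M G δ C) {s : EN d} (hs : s ∈ M) (v : EN d) :
    fderiv ℝ G s (fderiv ℝ G s v) = fderiv ℝ G s v := h.tan_fix (h.tan_mem hs v)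

theorem grad_tan (h : hg_Ret M G δ C) {Ω : Set (EN N)} (hΩ : IsOpen Ω) (hb : Bornology.IsBounded Ω)
    {v : EN N → EN d} {Dv : EN N → Mat d N} (hv : MemW11 Ω v Dv) (hM : AeIn Ω v M) :
    ∀ᵐ x ∂(volume.restrict Ω), (fderiv ℝ G (v x)).comp (Dv x) = Dv x := by
  set H : EN N × EN d → EN d := fun p => G p.2
  have hH : ContDiff ℝ 1 H := h.smooth.comp contDiff_snd
  have hfd : ∀ p, fderiv ℝ H p = (fderiv ℝ G p.2).comp (ContinuousLinearMap.snd ℝ (EN N) (EN d)) := by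
    intro p
    have hd : HasFDerivAt G (fderiv ℝ G p.2) p.2 := ((h.smooth.differentiable (by simp)) _).hasFDerivAt
    exact (hd.comp p hasFDerivAt_snd).fderiv
  have hC : ∀ p, ‖fderiv ℝ H p‖ ≤ C * 1 := by
    intro p
    rw [hfd]
    refine (ContinuousLinearMap.opNorm_comp_le _ _).trans ?_
    exact mul_le_mul (h.bd _) (ContinuousLinearMap.norm_snd_le _ _ _) (norm_nonneg _) (zero_le_one.trans h.C1)
  have hc := hg_chain hΩ hb hH hC hv
  have hu := hg_unique hΩ hc hv (by
    filter_upwards [hM] with x hx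
    exact h.idM _ hx)
  filter_upwards [hu] with x hx
  refine ContinuousLinearMap.ext fun y => ?_
  have e := congrArg (fun A : Mat d N => A y) hx
  simp only [hg_grad_apply, hfd] at e
  exact e

end hg_Ret

end

section
open MeasureTheory Filter Set
open scoped ENNReal RealInnerProductSpace Topology NNReal

variable {N d : ℕ}

theorem hg_cube_margin {t : ℝ} {K : Set (EN N)} (hK : IsCompact K) (h : K ⊆ posCube N t) :
    ∃ δ > 0, ∀ y ∈ K, ∀ i, δ ≤ y i ∧ y i ≤ t - δ := by
  obtain ⟨δ, hδ, hs⟩ := hK.exists_cthickening_subset_open (hg_isOpen_posCube N t) h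
  refine ⟨δ, hδ, fun y hy i => ?_⟩
  have h1 : y + EuclideanSpace.single i δ ∈ posCube N t := hs
    (Metric.mem_cthickening_of_dist_le _ y δ K hy (by simp [abs_of_pos hδ]))
  have h2 : y - EuclideanSpace.single i δ ∈ posCube N t := hs
    (Metric.mem_cthickening_of_dist_le _ y δ K hy (by simp [dist_eq_norm, abs_of_pos hδ]))
  have h1' := (h1 i).2
  have h2' := (h2 i).1
  simp at h1' h2'
  exact ⟨h2'.le, by linarith⟩

/-- reduction modulo `t ℤ^N` -/
noncomputable def hg_fl (t : ℝ) (x : EN N) : EN N := WithLp.toLp 2 fun i => t * Int.fract (x i / t)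

/-- periodic extension -/
noncomputable def hg_per (t : ℝ) (φ : EN N → EN d) (x : EN N) : EN d := φ (hg_fl t x)

@[simp] theorem hg_fl_apply (t : ℝ) (x : EN N) (i : Fin N) : hg_fl t x i = t * Int.fract (x i / t) := rfl

theorem hg_fl_periodic {t : ℝ} (ht : 0 < t) (x : EN N) (i : Fin N) :
    hg_fl t (x + t • EuclideanSpace.single i 1) = hg_fl t x := by
  ext j
  simp only [hg_fl_apply]
  by_cases h : j = i
  · subst h
    have : (x + t • EuclideanSpace.single j (1:ℝ) : EN N) j / t = x j / t + 1 := by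
      simp; field_simp
    rw [this, Int.fract_add_one]
  · have : (x + t • EuclideanSpace.single i (1:ℝ) : EN N) j = x j := by simp [h]
    rw [this]

theorem hg_fl_cube {t : ℝ} (ht : 0 < t) {x : EN N} (hx : x ∈ posCube N t) : hg_fl t x = x := by
  ext j
  have := hx j
  rw [hg_fl_apply, Int.fract_eq_self.2 ⟨by have := this.1; positivity, by rw [div_lt_one ht]; exact this.2⟩]
  field_simp

/-- structure of the periodic extension near a point -/
theorem hg_per_zero_near {t : ℝ} (ht : 0 < t) {φ : EN N → EN d} (hc : HasCompactSupport φ)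
    (hs : tsupport φ ⊆ posCube N t) {x : EN N} {i : Fin N} {m : ℤ} (hx : x i = t * m) :
    hg_per t φ =ᶠ[𝓝 x] fun _ => 0 := by
  obtain ⟨δ, hδ, hm⟩ := hg_cube_margin hc hs
  have hci : Continuous fun x : EN N => x i := by fun_prop
  have hev : ∀ᶠ y in 𝓝 x, |y i - x i| < min δ t := by
    have : ContinuousAt (fun y : EN N => |y i - x i|) x := by fun_prop
    exact this.eventually (gt_mem_nhds (by simp [hδ, ht]))
  filter_upwards [hev] with y hy
  by_contra hne
  have hmem := hm _ (subset_tsupport _ hne) i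
  rw [hg_fl_apply] at hmem
  have hyδ : |y i - x i| < δ := hy.trans_le (min_le_left _ _)
  have hyt : |y i - x i| < t := hy.trans_le (min_le_right _ _)
  rw [abs_lt] at hyδ hyt
  rcases le_or_gt 0 (y i - x i) with h0 | h0
  · have hfl : ⌊y i / t⌋ = m := by
      rw [Int.floor_eq_iff]
      constructor
      · rw [le_div_iff₀ ht]; nlinarith
      · rw [div_lt_iff₀ ht]; nlinarith
    have : t * Int.fract (y i / t) = y i - x i := by
      rw [Int.fract, hfl, hx]; field_simp
    linarith [hmem.1]
  · have hfl : ⌊y i / t⌋ = m - 1 := by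
      rw [Int.floor_eq_iff]; push_cast
      constructor
      · rw [le_div_iff₀ ht]; nlinarith
      · rw [div_lt_iff₀ ht]; nlinarith
    have : t * Int.fract (y i / t) = t + (y i - x i) := by
      rw [Int.fract, hfl, hx]; push_cast; field_simp; ring
    linarith [hmem.2]

theorem hg_per_shift_near {t : ℝ} (ht : 0 < t) (φ : EN N → EN d) {x : EN N}
    (hx : ∀ i, 0 < Int.fract (x i / t)) :
    hg_per t φ =ᶠ[𝓝 x] fun y => φ (y + (hg_fl t x - x)) := by
  have hev : ∀ i, ∀ᶠ y : EN N in 𝓝 x, ⌊y i / t⌋ = ⌊x i / t⌋ := by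
    intro i
    have hcont : ContinuousAt (fun y : EN N => y i / t) x := by fun_prop
    have h1 : (⌊x i / t⌋ : ℝ) < x i / t := by
      have := hx i; rw [Int.fract] at this; linarith
    filter_upwards [hcont.eventually (lt_mem_nhds h1),
      hcont.eventually (gt_mem_nhds (Int.lt_floor_add_one _))] with y h2 h3
    exact Int.floor_eq_iff.2 ⟨h2.le, h3⟩
  filter_upwards [Filter.eventually_all.2 hev] with y hy
  have : hg_fl t y = y + (hg_fl t x - x) := by
    ext i
    simp only [hg_fl_apply, PiLp.add_apply, PiLp.sub_apply, Int.fract, hy i]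
    field_simp; ring
  simp only [hg_per, this]

theorem hg_per_dichotomy (t : ℝ) (ht : 0 < t) (x : EN N) :
    (∀ i, 0 < Int.fract (x i / t)) ∨ ∃ (i : Fin N) (m : ℤ), x i = t * m := by
  by_cases h : ∀ i, 0 < Int.fract (x i / t)
  · exact Or.inl h
  · right
    push Not at h
    obtain ⟨i, hi⟩ := h
    refine ⟨i, ⌊x i / t⌋, ?_⟩
    have : Int.fract (x i / t) = 0 := le_antisymm hi (Int.fract_nonneg _)
    rw [Int.fract, sub_eq_zero] at this
    rw [← this]; field_simp

theorem hg_per_contDiff {t : ℝ} (ht : 0 < t) {φ : EN N → EN d} (hφ : ContDiff ℝ 1 φ) (hc : HasCompactSupport φ)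
    (hs : tsupport φ ⊆ posCube N t) : ContDiff ℝ 1 (hg_per t φ) := by
  rw [contDiff_iff_contDiffAt]
  intro x
  rcases hg_per_dichotomy t ht x with h | ⟨i, m, h⟩
  · refine ContDiffAt.congr_of_eventuallyEq ?_ (hg_per_shift_near ht φ h)
    exact (hφ.comp (contDiff_id.add contDiff_const)).contDiffAt
  · exact contDiffAt_const.congr_of_eventuallyEq (hg_per_zero_near ht hc hs h)

theorem hg_per_fderiv {t : ℝ} (ht : 0 < t) {φ : EN N → EN d} (hc : HasCompactSupport φ)
    (hs : tsupport φ ⊆ posCube N t) (x : EN N) :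
    fderiv ℝ (hg_per t φ) x = fderiv ℝ φ (hg_fl t x) := by
  rcases hg_per_dichotomy t ht x with h | ⟨i, m, h⟩
  · rw [(hg_per_shift_near ht φ h).fderiv_eq, fderiv_comp_add_right]
    simp
  · rw [(hg_per_zero_near ht hc hs h).fderiv_eq]
    have : hg_fl t x ∉ tsupport φ := by
      intro hmem
      have := (hs hmem i).1
      rw [hg_fl_apply, h] at this
      have e : t * (m:ℝ) / t = m := by field_simp
      rw [e, Int.fract_intCast] at this
      simp at this
    rw [(notMem_tsupport_iff_eventuallyEq.1 this).fderiv_eq]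
    simp

theorem hg_per_periodic {t : ℝ} (ht : 0 < t) (φ : EN N → EN d) (x : EN N) (i : Fin N) :
    hg_per t φ (x + t • EuclideanSpace.single i 1) = hg_per t φ x := by
  rw [hg_per, hg_fl_periodic ht]; rfl

theorem hg_per_fderiv_periodic {t : ℝ} (ht : 0 < t) {φ : EN N → EN d} (hc : HasCompactSupport φ)
    (hs : tsupport φ ⊆ posCube N t) (x : EN N) (i : Fin N) :
    fderiv ℝ (hg_per t φ) (x + t • EuclideanSpace.single i 1) = fderiv ℝ (hg_per t φ) x := by
  rw [hg_per_fderiv ht hc hs, hg_per_fderiv ht hc hs, hg_fl_periodic ht]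

/-- the periodic extension truncated to a large cube -/
noncomputable def hg_trunc (t : ℝ) (k : ℕ) (φ : EN N → EN d) (x : EN N) : EN d :=
  open Classical in if x ∈ posCube N (k * t) then hg_per t φ x else 0

theorem hg_trunc_in {t : ℝ} {k : ℕ} {φ : EN N → EN d} {x : EN N} (hx : x ∈ posCube N (k * t)) :
    hg_trunc t k φ =ᶠ[𝓝 x] hg_per t φ := by
  filter_upwards [(hg_isOpen_posCube N _).mem_nhds hx] with y hy
  simp [hg_trunc, hy]

theorem hg_trunc_out {t : ℝ} (ht : 0 < t) {k : ℕ} {φ : EN N → EN d} (hc : HasCompactSupport φ)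
    (hs : tsupport φ ⊆ posCube N t) {x : EN N} (hx : x ∉ posCube N (k * t)) :
    hg_trunc t k φ =ᶠ[𝓝 x] fun _ => 0 := by
  have hx' : ∃ i, ¬ (0 < x i ∧ x i < k * t) := by
    by_contra h; push Not at h
    exact hx fun i => h i
  obtain ⟨i, hi⟩ := hx'
  have hz : ∀ m : ℤ, x i = t * m → hg_trunc t k φ =ᶠ[𝓝 x] fun _ => 0 := by
    intro m hm
    filter_upwards [hg_per_zero_near ht hc hs hm] with y hy
    simp only [hg_trunc]; split_ifs
    · exact hy
    · rfl
  have hco : ContinuousAt (fun y : EN N => y i) x := by fun_prop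
  rcases lt_trichotomy (x i) 0 with h | h | h
  · filter_upwards [hco.eventually (gt_mem_nhds h)] with y hy
    have : y ∉ posCube N (k * t) := fun h' => by linarith [(h' i).1]
    simp [hg_trunc, this]
  · exact hz 0 (by simp [h])
  · have h2 : k * t ≤ x i := by
      by_contra h3; push Not at h3; exact hi ⟨h, h3⟩
    rcases h2.eq_or_lt with h3 | h3
    · exact hz k (by rw [← h3]; push_cast; ring)
    · filter_upwards [hco.eventually (lt_mem_nhds h3)] with y hy
      have : y ∉ posCube N (k * t) := fun h' => by linarith [(h' i).2]
      simp [hg_trunc, this]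

theorem hg_trunc_contDiff {t : ℝ} (ht : 0 < t) (k : ℕ) {φ : EN N → EN d} (hφ : ContDiff ℝ 1 φ)
    (hc : HasCompactSupport φ)
    (hs : tsupport φ ⊆ posCube N t) : ContDiff ℝ 1 (hg_trunc t k φ) := by
  rw [contDiff_iff_contDiffAt]
  intro x
  by_cases hx : x ∈ posCube N (k * t)
  · exact (hg_per_contDiff ht hφ hc hs).contDiffAt.congr_of_eventuallyEq (hg_trunc_in hx)
  · exact contDiffAt_const.congr_of_eventuallyEq (hg_trunc_out ht hc hs hx)

end

section
open MeasureTheory Filter Set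
open scoped ENNReal RealInnerProductSpace Topology NNReal Pointwise

variable {N d : ℕ}

theorem hg_smul_posCube {R : ℝ} (hR : 0 < R) (t : ℝ) : R • posCube N t = posCube N (R * t) := by
  ext x
  rw [mem_smul_set_iff_inv_smul_mem₀ hR.ne']
  simp only [posCube, mem_ofPred_eq, PiLp.smul_apply, smul_eq_mul, mem_Ioo]
  refine forall_congr' fun i => ?_
  rw [inv_mul_lt_iff₀ hR]
  have : 0 < R⁻¹ * x i ↔ 0 < x i := by
    rw [mul_pos_iff_of_pos_left (by positivity)]
  rw [this]

theorem hg_scale_posCube {R : ℝ} (hR : 0 < R) (g : EN N → ℝ) :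
    ∫ x in posCube N R, g x = R ^ N * ∫ x in posCube N 1, g (R • x) := by
  rw [Measure.setIntegral_comp_smul_of_pos _ _ _ hR, hg_smul_posCube hR, mul_one]
  simp only [finrank_euclideanSpace, Fintype.card_fin, smul_eq_mul]
  rw [← mul_assoc, mul_inv_cancel₀ (by positivity), one_mul]

section

theorem hg_beta_pos
    {f : EN N → Mat d N → ℝ} {α β L : ℝ} (hf : StdIntegrand N d f α β L) : 0 < β := hf.alpha_pos.trans_le hf.alpha_le_beta

theorem hg_tanCell_le
    {f : EN N → Mat d N → ℝ} {α β L : ℝ} (hf : StdIntegrand N d f α β L) {M : Set (EN d)} {s : EN d} (ξ : Mat d N) {t : ℝ} (ht : 0 < t) {φ : EN N → EN d} {K : ℝ≥0} (hK : LipschitzWith K φ)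
    (hT : ∀ x, φ x ∈ TangentSet M s) (hz : ∀ x, x ∉ posCube N t → φ x = 0) :
    tanCell f M s ξ t ≤ (t ^ N)⁻¹ * ∫ x in posCube N t, f x (ξ + fderiv ℝ φ x) := by
  refine csInf_le ⟨0, ?_⟩ ⟨φ, K, hK, hT, hz, rfl⟩
  rintro c ⟨φ, K, -, -, -, rfl⟩
  have : 0 ≤ ∫ x in posCube N t, f x (ξ + fderiv ℝ φ x) := integral_nonneg fun x => hf.nonneg _ _
  positivity

theorem hg_tanCell_nonneg
    {f : EN N → Mat d N → ℝ} {α β L : ℝ} (hf : StdIntegrand N d f α β L) {M : Set (EN d)} {s : EN d}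
    (h0 : (0 : EN d) ∈ TangentSet M s) (ξ : Mat d N) {t : ℝ} (ht : 0 < t) : 0 ≤ tanCell f M s ξ t := by
  refine le_csInf ⟨_, fun _ => 0, 0, LipschitzWith.const _, fun _ => h0, fun _ _ => rfl, rfl⟩ ?_
  rintro c ⟨φ, K, -, -, -, rfl⟩
  have : 0 ≤ ∫ x in posCube N t, f x (ξ + fderiv ℝ φ x) := integral_nonneg fun x => hf.nonneg _ _
  positivity

theorem hg_tanCell_bd
    {f : EN N → Mat d N → ℝ} {α β L : ℝ} (hf : StdIntegrand N d f α β L) {M : Set (EN d)} {s : EN d}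
    (h0 : (0 : EN d) ∈ TangentSet M s) (ξ : Mat d N) {t : ℝ} (ht : 0 < t) : tanCell f M s ξ t ≤ β * (1 + ‖ξ‖) := by
  refine (hg_tanCell_le hf ξ ht (LipschitzWith.const (0 : EN d)) (fun _ => h0) (fun _ _ => rfl)).trans ?_
  rw [inv_mul_le_iff₀ (by positivity)]
  have hv := hg_volreal_posCube N ht.le
  have hae : ∀ᵐ x ∂(volume.restrict (posCube N t)), f x (ξ + fderiv ℝ (fun _ : EN N => (0 : EN d)) x) ≤ β * (1 + ‖ξ‖) := by
    filter_upwards [ae_restrict_of_ae hf.growth] with x hx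
    simpa using (hx ξ).2
  haveI : IsFiniteMeasure (volume.restrict (posCube N t)) := ⟨by
    simpa using (hg_volume_posCube_ne_top N t).lt_top⟩
  calc _ ≤ ∫ x in posCube N t, β * (1 + ‖ξ‖) :=
        integral_mono_of_nonneg (Eventually.of_forall fun x => hf.nonneg _ _) (integrable_const _) hae
    _ = _ := by simp [hv]

theorem hg_tanCell_isBdd
    {f : EN N → Mat d N → ℝ} {α β L : ℝ} (hf : StdIntegrand N d f α β L) {M : Set (EN d)} {s : EN d}
    (h0 : (0 : EN d) ∈ TangentSet M s) (ξ : Mat d N) : IsBoundedUnder (· ≤ ·) atTop (fun t => tanCell f M s ξ t) :=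
  ⟨β * (1 + ‖ξ‖), by
    rw [eventually_map]; filter_upwards [eventually_gt_atTop 0] with t ht using hg_tanCell_bd hf h0 ξ ht⟩

theorem hg_tanCell_isCobdd
    {f : EN N → Mat d N → ℝ} {α β L : ℝ} (hf : StdIntegrand N d f α β L) {M : Set (EN d)} {s : EN d}
    (h0 : (0 : EN d) ∈ TangentSet M s) (ξ : Mat d N) : IsCoboundedUnder (· ≤ ·) atTop (fun t => tanCell f M s ξ t) :=
  IsBoundedUnder.isCoboundedUnder_le ⟨0, by
    rw [eventually_map]; filter_upwards [eventually_gt_atTop 0] with t ht using hg_tanCell_nonneg hf h0 ξ ht⟩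

theorem hg_Tfhom_nonneg
    {f : EN N → Mat d N → ℝ} {α β L : ℝ} (hf : StdIntegrand N d f α β L) {M : Set (EN d)} {s : EN d}
    (h0 : (0 : EN d) ∈ TangentSet M s) (ξ : Mat d N) : 0 ≤ Tfhom f M s ξ := by
  refine le_limsup_of_frequently_le (Eventually.frequently ?_) (hg_tanCell_isBdd hf h0 ξ)
  filter_upwards [eventually_gt_atTop 0] with t ht using hg_tanCell_nonneg hf h0 ξ ht

theorem hg_Tfhom_bd
    {f : EN N → Mat d N → ℝ} {α β L : ℝ} (hf : StdIntegrand N d f α β L) {M : Set (EN d)} {s : EN d}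
    (h0 : (0 : EN d) ∈ TangentSet M s) (ξ : Mat d N) : Tfhom f M s ξ ≤ β * (1 + ‖ξ‖) := by
  refine limsup_le_of_le (hg_tanCell_isCobdd hf h0 ξ) ?_
  filter_upwards [eventually_gt_atTop 0] with t ht using hg_tanCell_bd hf h0 ξ ht

theorem hg_Tfhom_le
    {f : EN N → Mat d N → ℝ} {α β L : ℝ} (hf : StdIntegrand N d f α β L) {M : Set (EN d)} {s : EN d}
    (h0 : (0 : EN d) ∈ TangentSet M s) (ξ : Mat d N) {t : ℕ} (ht : 0 < t) {φ : EN N → EN d} (hφ : ContDiff ℝ 1 φ) (hc : HasCompactSupport φ)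
    (hs : tsupport φ ⊆ posCube N t) (hT : ∀ x, φ x ∈ TangentSet M s) :
    Tfhom f M s ξ ≤ ((t:ℝ) ^ N)⁻¹ * ∫ x in posCube N t, f x (ξ + fderiv ℝ φ x) := by
  have ht' : (0:ℝ) < t := by exact_mod_cast ht
  have hcd : Continuous (fderiv ℝ φ) := hφ.continuous_fderiv (by simp)
  obtain ⟨C, hC⟩ := hcd.bounded_above_of_compact_support (hc.fderiv ℝ)
  have hC0 : 0 ≤ C := (norm_nonneg _).trans (hC 0)
  set ψ := hg_per (t:ℝ) φ
  have hψ : ContDiff ℝ 1 ψ := hg_per_contDiff ht' hφ hc hs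
  have hψd : Continuous (fderiv ℝ ψ) := hψ.continuous_fderiv (by simp)
  have hψb : ∀ x, ‖fderiv ℝ ψ x‖ ≤ C := fun x => by rw [hg_per_fderiv ht' hc hs]; exact hC _
  have hβ := hg_beta_pos hf
  set J : ℝ → ℝ := fun R => ∫ x in posCube N 1, f (R • x) (ξ + fderiv ℝ ψ (R • x))
  have hI : ∫ z in posCube N t, f z (ξ + fderiv ℝ ψ z) = ∫ z in posCube N t, f z (ξ + fderiv ℝ φ z) := by
    refine setIntegral_congr_fun (hg_measurableSet_posCube N t) fun x hx => ?_
    simp only [ψ]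
    rw [hg_per_fderiv ht' hc hs, hg_fl_cube ht' hx]
  set I := ((t:ℝ) ^ N)⁻¹ * ∫ x in posCube N t, f x (ξ + fderiv ℝ φ x)
  have hJ : Tendsto J atTop (𝓝 I) := by
    have h := hg_RL_f hf ht (D := fun y => ξ + fderiv ℝ ψ y) (C := ‖ξ‖ + C)
      (continuous_const.add hψd).measurable
      (fun y => (norm_add_le _ _).trans (add_le_add le_rfl (hψb y)))
      (fun y i => by simp only [ψ]; rw [hg_per_fderiv_periodic ht' hc hs])
      (hg_measurableSet_posCube N 1) (hg_volume_posCube_ne_top N 1)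
    rw [hI, hg_volreal_posCube N zero_le_one, one_pow, one_mul] at h
    refine (h.comp tendsto_inv_atTop_nhdsGT_zero).congr fun R => ?_
    simp [J]
  set k : ℝ → ℕ := fun T => ⌊T / t⌋₊
  have hk : Tendsto (fun T => (k T : ℝ) * t) atTop atTop := by
    refine Tendsto.atTop_mul_const ht' ?_
    exact tendsto_natCast_atTop_atTop.comp (tendsto_nat_floor_atTop.comp (tendsto_id.atTop_div_const ht'))
  have hq : Tendsto (fun T : ℝ => ((k T : ℝ) * t / T) ^ N) atTop (𝓝 1) := by
    have h1 : Tendsto (fun T : ℝ => (k T : ℝ) / (T / t)) atTop (𝓝 1) :=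
      (tendsto_nat_floor_div_atTop (R := ℝ)).comp (tendsto_id.atTop_div_const ht')
    have h2 : Tendsto (fun T : ℝ => ((k T : ℝ) * t / T)) atTop (𝓝 1) :=
      h1.congr fun T => by rw [div_div_eq_mul_div]
    simpa using h2.pow N
  have hlim : Tendsto (fun T : ℝ => ((k T : ℝ) * t / T) ^ N * J (k T * t) +
      β * (1 + ‖ξ‖) * (1 - ((k T : ℝ) * t / T) ^ N)) atTop (𝓝 (1 * I + β * (1 + ‖ξ‖) * (1 - 1))) :=
    (hq.mul (hJ.comp hk)).add ((hq.const_sub 1).const_mul _)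
  have e : 1 * I + β * (1 + ‖ξ‖) * (1 - 1) = I := by ring
  rw [e] at hlim
  rw [← hlim.limsup_eq]
  refine limsup_le_limsup ?_ (hg_tanCell_isCobdd hf h0 ξ) hlim.isBoundedUnder_le
  filter_upwards [eventually_ge_atTop (t:ℝ)] with T hTt
  have hT0 : 0 < T := ht'.trans_le hTt
  have hk1 : 1 ≤ k T := by
    rw [Nat.one_le_floor_iff, one_le_div ht']; exact hTt
  have hkT : (k T : ℝ) * t ≤ T := by
    rw [← le_div_iff₀ ht']; exact Nat.floor_le (by positivity)
  have hk0 : 0 < (k T : ℝ) * t := by positivity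
  set χ := hg_trunc (t:ℝ) (k T) φ
  have hχ : ContDiff ℝ 1 χ := hg_trunc_contDiff ht' _ hφ hc hs
  have hin : ∀ x ∈ posCube N (k T * t), fderiv ℝ χ x = fderiv ℝ ψ x := fun x hx => (hg_trunc_in hx).fderiv_eq
  have hout : ∀ x ∉ posCube N (k T * t), fderiv ℝ χ x = 0 := fun x hx => by
    rw [(hg_trunc_out ht' hc hs hx).fderiv_eq]; simp
  have hχb : ∀ x, ‖fderiv ℝ χ x‖ ≤ C := fun x => by
    by_cases hx : x ∈ posCube N (k T * t)
    · rw [hin x hx]; exact hψb x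
    · rw [hout x hx]; simpa using hC0
  have hLip : LipschitzWith C.toNNReal χ := LipschitzWith.of_dist_le_mul fun x y => by
    rw [dist_eq_norm, dist_eq_norm, Real.coe_toNNReal _ hC0]
    exact hg_lip_of_fderiv hχ hχb x y
  have hsub : posCube N (k T * t) ⊆ posCube N T := fun x hx i => ⟨(hx i).1, (hx i).2.trans_le hkT⟩
  refine (hg_tanCell_le hf ξ hT0 hLip ?_ ?_).trans ?_
  · intro x
    simp only [χ, hg_trunc]; split_ifs
    · exact hT _
    · exact h0
  · intro x hx
    have : x ∉ posCube N (k T * t) := fun h => hx (hsub h)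
    simp [χ, hg_trunc, this]
  · have hInt0 : IntegrableOn (fun x => f x (ξ + fderiv ℝ χ x)) (posCube N T) := by
      have := hg_integrable_f hf one_ne_zero (D := fun x => ξ + fderiv ℝ χ x) (hg_volume_posCube_ne_top N T) (by
        haveI : IsFiniteMeasure (volume.restrict (posCube N T)) := ⟨by
          simpa using (hg_volume_posCube_ne_top N T).lt_top⟩
        refine Integrable.of_bound (continuous_const.add (hχ.continuous_fderiv (by simp))).aestronglyMeasurable
          (‖ξ‖ + C) (Eventually.of_forall fun x => (norm_add_le _ _).trans (add_le_add le_rfl (hχb x))))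
      simpa using this
    have hsplit : ∫ x in posCube N T, f x (ξ + fderiv ℝ χ x) =
        (∫ x in posCube N (k T * t), f x (ξ + fderiv ℝ χ x)) +
        ∫ x in posCube N T \ posCube N (k T * t), f x (ξ + fderiv ℝ χ x) := by
      rw [add_comm, setIntegral_sdiff (hg_measurableSet_posCube N _) hInt0 hsub, sub_add_cancel]
    have e1 : ∫ x in posCube N (k T * t), f x (ξ + fderiv ℝ χ x) = (k T * t) ^ N * J (k T * t) := by
      rw [← hg_scale_posCube hk0 (fun x => f x (ξ + fderiv ℝ ψ x))]
      exact setIntegral_congr_fun (hg_measurableSet_posCube N _) fun x hx => by simp only [hin x hx]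
    have hvol : volume.real (posCube N T \ posCube N (k T * t)) = T ^ N - (k T * t) ^ N := by
      rw [measureReal_sdiff hsub (hg_measurableSet_posCube N _) (hg_volume_posCube_ne_top N _),
        hg_volreal_posCube N hT0.le, hg_volreal_posCube N hk0.le]
    have e2 : ∫ x in posCube N T \ posCube N (k T * t), f x (ξ + fderiv ℝ χ x) ≤
        β * (1 + ‖ξ‖) * (T ^ N - (k T * t) ^ N) := by
      haveI : IsFiniteMeasure (volume.restrict (posCube N T \ posCube N (k T * t))) := ⟨by
        simpa using (measure_mono sdiff_subset).trans_lt (hg_volume_posCube_ne_top N T).lt_top⟩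
      calc _ ≤ ∫ x in posCube N T \ posCube N (k T * t), β * (1 + ‖ξ‖) := by
            refine integral_mono_of_nonneg (Eventually.of_forall fun x => hf.nonneg _ _) (integrable_const _) ?_
            filter_upwards [ae_restrict_of_ae hf.growth,
              ae_restrict_mem ((hg_measurableSet_posCube N _).diff (hg_measurableSet_posCube N _))] with x hx hxm
            rw [hout x hxm.2, add_zero]; exact (hx ξ).2
        _ = _ := by simp [hvol]; ring
    rw [hsplit, e1]
    calc _ ≤ (T ^ N)⁻¹ * ((k T * t) ^ N * J (k T * t) + β * (1 + ‖ξ‖) * (T ^ N - (k T * t) ^ N)) := by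
          gcongr
      _ = _ := by
          rw [div_pow]; field_simp

end

end

section
open MeasureTheory Filter Set
open scoped ENNReal RealInnerProductSpace Topology NNReal Pointwise

variable {N d : ℕ}

/-- The open cube with corner `x0` and side `ρ`. -/
def hg_Q (x0 : EN N) (ρ : ℝ) : Set (EN N) := {x | x - x0 ∈ posCube N ρ}

theorem hg_Q_pre (x0 : EN N) (ρ : ℝ) : hg_Q x0 ρ = (fun x => x - x0) ⁻¹' posCube N ρ := rfl

theorem hg_Q_open (x0 : EN N) (ρ : ℝ) : IsOpen (hg_Q x0 ρ) :=
  (hg_isOpen_posCube N ρ).preimage (by fun_prop)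

theorem hg_Q_meas (x0 : EN N) (ρ : ℝ) : MeasurableSet (hg_Q x0 ρ) := (hg_Q_open x0 ρ).measurableSet

theorem hg_Q_volume (x0 : EN N) (ρ : ℝ) : volume (hg_Q x0 ρ) = volume (posCube N ρ) := by
  rw [hg_Q_pre]
  exact (measurePreserving_sub_right volume x0).measure_preimage (hg_measurableSet_posCube N ρ).nullMeasurableSet

theorem hg_Q_ne_top (x0 : EN N) (ρ : ℝ) : volume (hg_Q x0 ρ) ≠ ⊤ := by
  rw [hg_Q_volume]; exact hg_volume_posCube_ne_top N ρ

theorem hg_Q_real (x0 : EN N) {ρ : ℝ} (h : 0 ≤ ρ) : volume.real (hg_Q x0 ρ) = ρ ^ N := by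
  rw [Measure.real, hg_Q_volume]; exact hg_volreal_posCube N h

theorem hg_Q_int (x0 : EN N) {ρ : ℝ} (hρ : 0 < ρ) (t : ℝ) (g : EN N → ℝ) :
    ∫ x in hg_Q x0 (ρ * t), g x = ρ ^ N * ∫ y in posCube N t, g (x0 + ρ • y) := by
  have h1 : ∫ x in hg_Q x0 (ρ * t), g x = ∫ x in posCube N (ρ * t), g (x0 + x) := by
    have := (measurePreserving_sub_right volume x0).setIntegral_preimage_emb
      (MeasurableEquiv.subRight x0).measurableEmbedding (fun x => g (x0 + x)) (posCube N (ρ * t))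
    rw [← this, hg_Q_pre]; simp
  rw [h1, Measure.setIntegral_comp_smul_of_pos _ (fun x => g (x0 + x)) _ hρ, hg_smul_posCube hρ]
  simp only [finrank_euclideanSpace, Fintype.card_fin, smul_eq_mul]
  rw [← mul_assoc, mul_inv_cancel₀ (by positivity), one_mul]

theorem hg_per_int {f : EN N → Mat d N → ℝ} {α β L : ℝ} (hf : StdIntegrand N d f α β L)
    (k : Fin N → ℤ) (y : EN N) (ξ : Mat d N) :
    f (y + WithLp.toLp 2 (fun i => (k i : ℝ))) ξ = f y ξ := by
  have h1 : ∀ (i : Fin N) (n : ℕ) (y : EN N), f (y + EuclideanSpace.single i (n:ℝ)) ξ = f y ξ := by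
    intro i n
    induction n with
    | zero =>
      intro y
      have : (EuclideanSpace.single i (0:ℝ) : EN N) = 0 := by ext j; simp
      simp [this]
    | succ n ih =>
      intro y
      have : EuclideanSpace.single i ((n+1 : ℕ):ℝ) = EuclideanSpace.single i (n:ℝ) + EuclideanSpace.single i (1:ℝ) := by
        ext j; by_cases h : j = i <;> simp [h]
      rw [this, ← add_assoc, hf.periodic, ih]
  have h2 : ∀ (i : Fin N) (n : ℤ) (y : EN N), f (y + EuclideanSpace.single i (n:ℝ)) ξ = f y ξ := by
    intro i n y
    obtain ⟨m, rfl | rfl⟩ := n.eq_nat_or_neg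
    · simpa using h1 i m y
    · rw [← h1 i m (y + EuclideanSpace.single i _)]
      congr 1
      ext j; by_cases h : j = i <;> simp [h]
  have h3 : ∀ (S : Finset (Fin N)) (y : EN N), f (y + ∑ i ∈ S, EuclideanSpace.single i (k i : ℝ)) ξ = f y ξ := by
    intro S
    induction S using Finset.induction_on with
    | empty => simp
    | insert a S ha ih =>
      intro y; rw [Finset.sum_insert ha, ← add_assoc, ih, h2]
  rw [← h3 Finset.univ y]
  congr 2
  ext j
  simp [Finset.sum_apply]

section

theorem hg_cell_C1
    {f : EN N → Mat d N → ℝ} {α β L : ℝ} (hf : StdIntegrand N d f α β L) {M : Set (EN d)} {s : EN d} (ξ : Mat d N) (h0 : (0 : EN d) ∈ TangentSet M s) (hsm : ∀ (c : ℝ), ∀ v ∈ TangentSet M s, c • v ∈ TangentSet M s)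
    (x0 : EN N) {ε ρ : ℝ} (hε : 0 < ε) (hρ : 0 < ρ) {φ : EN N → EN d} (hφ : ContDiff ℝ 1 φ)
    (hc : HasCompactSupport φ) (hs : tsupport φ ⊆ hg_Q x0 ρ) (hT : ∀ x, φ x ∈ TangentSet M s) :
    ρ ^ N * Tfhom f M s ξ ≤ (∫ x in hg_Q x0 ρ, f (ε⁻¹ • x) (ξ + fderiv ℝ φ x))
      + β * (1 + ‖ξ‖) * ((ρ + 2 * ε) ^ N - ρ ^ N) := by
  set κ : Fin N → ℤ := fun i => ⌊x0 i / ε⌋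
  set k : EN N := WithLp.toLp 2 (fun i => (κ i : ℝ))
  set t : ℕ := ⌈ρ / ε⌉₊ + 1
  have ht : 0 < t := Nat.succ_pos _
  have ht' : (0:ℝ) < t := by exact_mod_cast ht
  have hk1 : ∀ i, ε * k i ≤ x0 i := fun i => by
    have := Int.floor_le (x0 i / ε)
    rw [le_div_iff₀ hε] at this
    simpa [k, κ, mul_comm] using this
  have hk2 : ∀ i, x0 i < ε * k i + ε := fun i => by
    have := Int.lt_floor_add_one (x0 i / ε)
    rw [div_lt_iff₀ hε] at this
    simp only [k, κ]; linarith
  have ht1 : ρ + ε ≤ ε * t := by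
    have := Nat.le_ceil (ρ / ε)
    rw [div_le_iff₀ hε] at this
    simp only [t]; push_cast; linarith
  have ht2 : ε * t ≤ ρ + 2 * ε := by
    have := Nat.ceil_lt_add_one (show 0 ≤ ρ / ε by positivity)
    have h3 : (⌈ρ / ε⌉₊ : ℝ) * ε < ρ + ε := by
      calc _ < (ρ / ε + 1) * ε := by gcongr
        _ = _ := by field_simp
    simp only [t]; push_cast; linarith
  have hsub : hg_Q x0 ρ ⊆ hg_Q (ε • k) (ε * t) := by
    intro x hx i
    have h1 := hx i
    have h2 := hk1 i; have h3 := hk2 i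
    simp only [PiLp.sub_apply, PiLp.smul_apply, smul_eq_mul, mem_Ioo] at h1 ⊢
    constructor <;> linarith [h1.1, h1.2]
  -- test map
  set ψ : EN N → EN d := fun y => ε⁻¹ • φ (ε • k + ε • y)
  have hψd : ∀ y, fderiv ℝ ψ y = fderiv ℝ φ (ε • k + ε • y) := by
    intro y
    have h1 : HasFDerivAt (fun y : EN N => ε • k + ε • y) (ε • ContinuousLinearMap.id ℝ (EN N)) y :=
      ((hasFDerivAt_id y).const_smul ε).const_add _
    have h2 := (((hφ.differentiable (by simp)) (ε • k + ε • y)).hasFDerivAt.comp y h1).const_smul ε⁻¹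
    rw [show ψ = ε⁻¹ • (φ ∘ fun y : EN N => ε • k + ε • y) from rfl, h2.fderiv]
    ext v
    simp [hε.ne']
  let e : EN N ≃ₜ EN N := (Homeomorph.smulOfNeZero ε hε.ne').trans (Homeomorph.addLeft (ε • k))
  have hψc : HasCompactSupport (fun y => φ (e y)) := hc.comp_homeomorph e
  have hψs : tsupport (fun y => φ (e y)) = e ⁻¹' tsupport φ := tsupport_comp_eq_preimage φ e
  have hψ : ContDiff ℝ 1 ψ := by
    exact (hφ.comp (contDiff_const.add (contDiff_id.const_smul ε))).const_smul ε⁻¹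
  have hsupψ : tsupport ψ ⊆ tsupport (fun y => φ (e y)) :=
    closure_mono fun y hy h => hy (by
      have : φ (e y) = 0 := h
      have h' : φ (ε • k + ε • y) = 0 := this
      simp [ψ, h'])
  have main := hg_Tfhom_le hf h0 ξ ht hψ (hψc.mono' (subset_tsupport _ |>.trans hsupψ)) (by
    refine hsupψ.trans ?_
    rw [hψs]
    intro y hy
    have := hsub (hs hy)
    intro i
    have := this i
    have he : e y = ε • k + ε • y := rfl
    rw [he] at this
    simp only [add_sub_cancel_left, PiLp.smul_apply, smul_eq_mul, mem_Ioo] at this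
    exact ⟨by nlinarith [this.1], lt_of_mul_lt_mul_left this.2 hε.le⟩) (fun x => hsm _ _ (hT _))
  set g : EN N → ℝ := fun x => f (ε⁻¹ • x) (ξ + fderiv ℝ φ x)
  have e1 : ∫ x in posCube N t, f x (ξ + fderiv ℝ ψ x) = ∫ y in posCube N t, g (ε • k + ε • y) := by
    refine integral_congr_ae (Eventually.of_forall fun y => ?_)
    simp only [g, hψd]
    rw [smul_add, smul_smul, smul_smul, inv_mul_cancel₀ hε.ne', one_smul, one_smul, add_comm k y,
      hg_per_int hf κ]
  have e2 := hg_Q_int (ε • k) hε t g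
  have hcd : Continuous (fderiv ℝ φ) := hφ.continuous_fderiv (by simp)
  obtain ⟨C, hC⟩ := hcd.bounded_above_of_compact_support (hc.fderiv ℝ)
  have : IsFiniteMeasure (volume.restrict (hg_Q (ε • k) (ε * t))) := ⟨by
          simpa using (hg_Q_ne_top _ _).lt_top⟩
  have : IsFiniteMeasure (volume.restrict (hg_Q (ε • k) (ε * t) \ hg_Q x0 ρ)) := ⟨by
        simpa using (measure_mono sdiff_subset).trans_lt (hg_Q_ne_top (ε • k) (ε * t)).lt_top⟩
  have hInt0 : IntegrableOn g (hg_Q (ε • k) (ε * t)) :=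
    hg_integrable_f hf (inv_ne_zero hε.ne') (D := fun x => ξ + fderiv ℝ φ x) (hg_Q_ne_top _ _) (by
        refine Integrable.of_bound (continuous_const.add hcd).aestronglyMeasurable
          (‖ξ‖ + C) (Eventually.of_forall fun x => (norm_add_le _ _).trans (add_le_add le_rfl (hC x))))
  have hsplit : ∫ x in hg_Q (ε • k) (ε * t), g x = (∫ x in hg_Q x0 ρ, g x) +
        ∫ x in hg_Q (ε • k) (ε * t) \ hg_Q x0 ρ, g x := by
      rw [add_comm, setIntegral_sdiff (hg_Q_meas _ _) hInt0 hsub, sub_add_cancel]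
  have hβ := hg_beta_pos hf
  have e3 : ∫ x in hg_Q (ε • k) (ε * t) \ hg_Q x0 ρ, g x ≤ β * (1 + ‖ξ‖) * ((ε * t) ^ N - ρ ^ N) := by
    have hvol : volume.real (hg_Q (ε • k) (ε * t) \ hg_Q x0 ρ) = (ε * t) ^ N - ρ ^ N := by
      rw [measureReal_sdiff hsub (hg_Q_meas _ _) (hg_Q_ne_top _ _),
        hg_Q_real _ (by positivity), hg_Q_real _ hρ.le]
    calc _ ≤ ∫ x in hg_Q (ε • k) (ε * t) \ hg_Q x0 ρ, β * (1 + ‖ξ‖) := by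
            refine integral_mono_of_nonneg (Eventually.of_forall fun x => hf.nonneg _ _) (integrable_const _) ?_
            filter_upwards [ae_restrict_of_ae (hg_ae_scale hf.growth (inv_ne_zero hε.ne') 0),
              ae_restrict_mem ((hg_Q_meas _ _).diff (hg_Q_meas _ _))] with x hx hxm
            have : fderiv ℝ φ x = 0 := by
              have h1 : x ∉ tsupport φ := fun h => hxm.2 (hs h)
              exact fderiv_of_notMem_tsupport (𝕜 := ℝ) h1
            simp only [g, this, add_zero] at hx ⊢; exact (hx ξ).2
        _ = _ := by simp [hvol]; ring
  have hTn := hg_Tfhom_nonneg hf h0 ξ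
  rw [e1, ← div_eq_inv_mul, le_div_iff₀ (by positivity)] at main
  have e4 : (ε * t) ^ N * Tfhom f M s ξ ≤ (∫ x in hg_Q x0 ρ, g x) + β * (1 + ‖ξ‖) * ((ε * t) ^ N - ρ ^ N) := by
    calc _ = ε ^ N * (Tfhom f M s ξ * t ^ N) := by rw [mul_pow]; ring
      _ ≤ _ := by
        have := mul_le_mul_of_nonneg_left main (show 0 ≤ ε ^ N by positivity)
        linarith
  calc ρ ^ N * Tfhom f M s ξ ≤ (ε * t) ^ N * Tfhom f M s ξ := by
        gcongr; linarith
    _ ≤ _ := e4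
    _ ≤ _ := by
        gcongr
end

end

section
open MeasureTheory Filter Set
open scoped ENNReal RealInnerProductSpace Topology NNReal Pointwise

variable {N d : ℕ}

theorem hg_moll_support {w : EN N → EN d} (hc : HasCompactSupport w) {U : Set (EN N)} (hU : IsOpen U)
    (hs : tsupport w ⊆ U) :
    ∀ᶠ n in atTop, HasCompactSupport (hg_moll n w) ∧ tsupport (hg_moll n w) ⊆ U := by
  obtain ⟨δ, hδ, hsub⟩ := hc.exists_cthickening_subset_open hU hs
  have hlim : Tendsto (fun n : ℕ => 1 / ((n:ℝ) + 1)) atTop (𝓝 0) := tendsto_one_div_add_atTop_nhds_zero_nat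
  filter_upwards [hlim.eventually_lt_const hδ] with n hn
  have hcomp : IsCompact (Metric.cthickening δ (tsupport w)) := IsCompact.cthickening hc
  have hz : ∀ x, x ∉ Metric.cthickening δ (tsupport w) → hg_moll n w x = 0 := by
    intro x hx
    refine hg_moll_zero hn.le fun y hy => ?_
    by_contra h
    refine hx (Metric.mem_cthickening_of_dist_le x y δ _ (subset_tsupport _ h) ?_)
    rw [dist_comm, dist_eq_norm]; exact hy
  have h2 : tsupport (hg_moll n w) ⊆ Metric.cthickening δ (tsupport w) :=
    closure_minimal (fun x hx => by by_contra h; exact hx (hz x h)) Metric.isClosed_cthickening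
  exact ⟨hcomp.of_isClosed_subset (isClosed_tsupport _) h2, h2.trans hsub⟩

section

theorem hg_f_diff
    {f : EN N → Mat d N → ℝ} {α β L : ℝ} (hf : StdIntegrand N d f α β L) {ε : ℝ} (hε : ε ≠ 0) {A : Set (EN N)} (hA : volume A ≠ ⊤) {D1 D2 : EN N → Mat d N}
    (h1 : IntegrableOn D1 A) (h2 : IntegrableOn D2 A) :
    ∫ x in A, f (ε • x) (D1 x) ≤ (∫ x in A, f (ε • x) (D2 x)) + L * ∫ x in A, ‖D1 x - D2 x‖ := by
  have h3 : IntegrableOn (fun x => L * ‖D1 x - D2 x‖) A := (h1.sub h2).norm.const_mul L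
  rw [← integral_const_mul, ← integral_add (hg_integrable_f hf hε hA h2) h3]
  refine integral_mono_ae (hg_integrable_f hf hε hA h1)
    ((hg_integrable_f hf hε hA h2).add h3) ?_
  filter_upwards [ae_restrict_of_ae (hg_ae_scale hf.lip hε 0)] with x hx
  simp only [add_zero] at hx
  have := (abs_le.1 (hx (D1 x) (D2 x))).2
  linarith

theorem hg_cell_W
    {f : EN N → Mat d N → ℝ} {α β L : ℝ} (hf : StdIntegrand N d f α β L) {M : Set (EN d)} {s : EN d} {G : EN d → EN d} {δ C : ℝ} (hR : hg_Ret M G δ C) (hsM : s ∈ M) (ξ : Mat d N)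
    (x0 : EN N) {ε ρ : ℝ} (hε : 0 < ε) (hρ : 0 < ρ) {φ : EN N → EN d} {Dφ : EN N → Mat d N}
    (hφ : MemW11 univ φ Dφ)
    (hc : HasCompactSupport φ) (hs : tsupport φ ⊆ hg_Q x0 ρ) :
    ρ ^ N * Tfhom f M s ξ ≤ (∫ x in hg_Q x0 ρ, f (ε⁻¹ • x) (ξ + (fderiv ℝ G s).comp (Dφ x)))
      + β * (1 + ‖ξ‖) * ((ρ + 2 * ε) ^ N - ρ ^ N) := by
  set P := fderiv ℝ G s
  have hw := hg_W_univ hφ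
  have hsm : ∀ (c : ℝ), ∀ v ∈ TangentSet M s, c • v ∈ TangentSet M s := fun c v hv => by
    rw [hR.tan_iff hsM] at hv ⊢
    rw [map_smul, hv]
  have hL := hf.lip_pos
  have hlim : Tendsto (fun n => ((∫ x in hg_Q x0 ρ, f (ε⁻¹ • x) (ξ + P.comp (Dφ x)))
      + β * (1 + ‖ξ‖) * ((ρ + 2 * ε) ^ N - ρ ^ N)) + L * (‖P‖ * ∫ x, ‖fderiv ℝ (hg_moll n φ) x - Dφ x‖)) atTop
      (𝓝 (((∫ x in hg_Q x0 ρ, f (ε⁻¹ • x) (ξ + P.comp (Dφ x)))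
      + β * (1 + ‖ξ‖) * ((ρ + 2 * ε) ^ N - ρ ^ N)) + L * (‖P‖ * 0))) :=
    (((hg_approx hφ).const_mul _).const_mul _).const_add _
  rw [mul_zero, mul_zero, add_zero] at hlim
  refine ge_of_tendsto hlim ?_
  filter_upwards [hg_moll_support hc (hg_Q_open x0 ρ) hs] with n hn
  have hsmooth : ContDiff ℝ 1 (hg_moll n φ) := (hg_moll_smooth n hw.1).of_le (by norm_cast)
  set ψ : EN N → EN d := fun x => P (hg_moll n φ x)
  have hsupψ : tsupport ψ ⊆ tsupport (hg_moll n φ) :=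
    closure_mono fun y hy h => hy (by simp [ψ, h])
  have hψd : ∀ x, fderiv ℝ ψ x = P.comp (fderiv ℝ (hg_moll n φ) x) := fun x =>
    (P.hasFDerivAt.comp x ((hsmooth.differentiable (by simp)) x).hasFDerivAt).fderiv
  have h := hg_cell_C1 hf ξ (hR.tan_zero hsM) hsm x0 hε hρ (φ := ψ) (P.contDiff.comp hsmooth)
    (hn.1.mono' (subset_tsupport _ |>.trans hsupψ)) (hsupψ.trans hn.2) (fun x => hR.tan_mem hsM _)
  simp only [hψd] at h
  have : IsFiniteMeasure (volume.restrict (hg_Q x0 ρ)) := ⟨by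
          simpa using (hg_Q_ne_top _ _).lt_top⟩
  have hP : ∀ {D : EN N → Mat d N}, Integrable D → Integrable (fun x => P.comp (D x)) := fun hD =>
    ((ContinuousLinearMap.compL ℝ (EN N) (EN d) (EN d)) P).integrable_comp hD
  have hi1 := hg_moll_fderiv_integrable hφ n
  have hdiff := hg_f_diff hf (inv_ne_zero hε.ne') (hg_Q_ne_top x0 ρ)
    (D1 := fun x => ξ + P.comp (fderiv ℝ (hg_moll n φ) x)) (D2 := fun x => ξ + P.comp (Dφ x))
    ((integrable_const ξ).add (hP hi1).integrableOn)
    ((integrable_const ξ).add (hP hw.2.1).integrableOn)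
  have hb : ∫ x in hg_Q x0 ρ, ‖(ξ + P.comp (fderiv ℝ (hg_moll n φ) x)) - (ξ + P.comp (Dφ x))‖ ≤
      ‖P‖ * ∫ x, ‖fderiv ℝ (hg_moll n φ) x - Dφ x‖ := by
    rw [← integral_const_mul]
    have hi2 : Integrable (fun x => ‖P‖ * ‖fderiv ℝ (hg_moll n φ) x - Dφ x‖) := (hi1.sub hw.2.1).norm.const_mul _
    refine le_trans ?_ (setIntegral_le_integral (s := hg_Q x0 ρ) hi2 (Eventually.of_forall fun x => by positivity))
    refine integral_mono_of_nonneg (Eventually.of_forall fun x => norm_nonneg _) hi2.integrableOn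
      (Eventually.of_forall fun x => ?_)
    simp only [add_sub_add_left_eq_sub, ← ContinuousLinearMap.comp_sub]
    exact ContinuousLinearMap.opNorm_comp_le _ _
  have := mul_le_mul_of_nonneg_left hb hL.le
  linarith
end

end

section
open MeasureTheory Filter Set
open scoped ENNReal RealInnerProductSpace Topology NNReal Pointwise

variable {N d : ℕ}

theorem hg_lip_W {φ : EN N → EN d} {K : ℝ≥0} (hK : LipschitzWith K φ) (hc : HasCompactSupport φ) :
    MemW11 univ φ (fderiv ℝ φ) := by
  have hi1 : Integrable φ := hK.continuous.integrable_of_hasCompactSupport hc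
  have hm : StronglyMeasurable (fderiv ℝ φ) := (measurable_fderiv ℝ φ).stronglyMeasurable
  have hi2 : Integrable (fderiv ℝ φ) := by
    have h1 : IntegrableOn (fderiv ℝ φ) (tsupport φ) := by
      have : IsFiniteMeasure (volume.restrict (tsupport φ)) := ⟨by
          simpa using hc.isCompact.measure_lt_top⟩
      exact Integrable.of_bound hm.aestronglyMeasurable K
        (Eventually.of_forall fun x => norm_fderiv_le_of_lipschitz ℝ hK)
    exact hg_int_ext h1 fun x hx => fderiv_of_notMem_tsupport (𝕜 := ℝ) hx
  refine ⟨hi1.integrableOn, hi2.integrableOn, fun ψ hψ hψc _ y => ?_⟩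
  simp only [Measure.restrict_univ]
  have hψ1 : ContDiff ℝ 1 ψ := hψ.of_le (by norm_cast)
  obtain ⟨D, hD⟩ := hψ1.lipschitzWith_of_hasCompactSupport hψc (by simp)
  have hψcd : Continuous (fderiv ℝ ψ) := hψ1.continuous_fderiv (by simp)
  obtain ⟨C1, hC1⟩ := hψ1.continuous.bounded_above_of_compact_support hψc
  obtain ⟨C2, hC2⟩ := hψcd.bounded_above_of_compact_support (hψc.fderiv ℝ)
  have hj1 : Integrable (fun x => fderiv ℝ ψ x y • φ x) :=
    hi1.bdd_smul (C2 * ‖y‖) (hψcd.clm_apply continuous_const).aestronglyMeasurable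
      (Eventually.of_forall fun x => ((fderiv ℝ ψ x).le_opNorm y).trans
        (mul_le_mul_of_nonneg_right (hC2 x) (norm_nonneg _)))
  have hj2 : Integrable (fun x => ψ x • fderiv ℝ φ x y) :=
    (hi2.apply_continuousLinearMap y).bdd_smul C1 hψ1.continuous.aestronglyMeasurable
      (Eventually.of_forall hC1)
  ext i
  have e1 := (EuclideanSpace.proj (𝕜 := ℝ) i : EN d →L[ℝ] ℝ).integral_comp_comm hj1
  have e2 := (EuclideanSpace.proj (𝕜 := ℝ) i : EN d →L[ℝ] ℝ).integral_comp_comm hj2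
  change _ = (∫ x, fderiv ℝ ψ x y • φ x) i at e1
  change _ = (∫ x, ψ x • fderiv ℝ φ x y) i at e2
  rw [PiLp.neg_apply, ← e1, ← e2]
  change ∫ x, (fderiv ℝ ψ x y • φ x) i = - ∫ x, (ψ x • fderiv ℝ φ x y) i
  have hKi : LipschitzWith (‖(EuclideanSpace.proj (𝕜 := ℝ) i : EN d →L[ℝ] ℝ)‖₊ * K) (fun x => φ x i) :=
    (EuclideanSpace.proj (𝕜 := ℝ) i : EN d →L[ℝ] ℝ).lipschitz.comp hK
  have key := LipschitzWith.integral_lineDeriv_mul_eq (μ := volume) hKi hD hψc y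
  have l1 : ∫ x, lineDeriv ℝ (fun x => φ x i) x y * ψ x = ∫ x, (ψ x • fderiv ℝ φ x y) i := by
    refine integral_congr_ae ?_
    filter_upwards [hK.ae_differentiableAt] with x hx
    have : HasFDerivAt (fun x => φ x i) ((EuclideanSpace.proj (𝕜 := ℝ) i : EN d →L[ℝ] ℝ).comp (fderiv ℝ φ x)) x :=
      (EuclideanSpace.proj (𝕜 := ℝ) i : EN d →L[ℝ] ℝ).hasFDerivAt.comp x hx.hasFDerivAt
    rw [(this.hasLineDerivAt y).lineDeriv]
    simp [mul_comm]
  have l2 : ∫ x, lineDeriv ℝ ψ x (-y) * φ x i = - ∫ x, (fderiv ℝ ψ x y • φ x) i := by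
    rw [← integral_neg]
    refine integral_congr_ae (Eventually.of_forall fun x => ?_)
    have hx := (hψ1.differentiable (by simp)) x
    simp only [hx.lineDeriv_eq_fderiv]
    simp
  rw [l1, l2] at key
  rw [key, neg_neg]

section

set_option maxHeartbeats 1000000 in
theorem hg_recover
    {f : EN N → Mat d N → ℝ} {α β L : ℝ} (hf : StdIntegrand N d f α β L) {M : Set (EN d)} {s : EN d} {G : EN d → EN d} {δ C : ℝ} (hR : hg_Ret M G δ C) (hsM : s ∈ M) (ξ : Mat d N)
    {η : ℝ} (hη : 0 < η) : ∃ t : ℕ, 0 < t ∧ ∃ φ : EN N → EN d, ContDiff ℝ 1 φ ∧ HasCompactSupport φ ∧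
      tsupport φ ⊆ posCube N t ∧ (∀ x, φ x ∈ TangentSet M s) ∧
      ((t:ℝ) ^ N)⁻¹ * ∫ x in posCube N t, f x (ξ + fderiv ℝ φ x) ≤ Tfhom f M s ξ + η := by
  have h0 := hR.tan_zero hsM
  have hβ := hg_beta_pos hf
  have hL := hf.lip_pos
  set P := fderiv ℝ G s
  have hTn := hg_Tfhom_nonneg hf h0 ξ
  have hev : ∀ᶠ T in atTop, tanCell f M s ξ T < Tfhom f M s ξ + η / 3 :=
    eventually_lt_of_limsup_lt (show limsup (fun t => tanCell f M s ξ t) atTop < _ by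
      change Tfhom f M s ξ < _; linarith) (hg_tanCell_isBdd hf h0 ξ)
  have hq : Tendsto (fun m : ℕ => β * (1 + ‖ξ‖) * (1 - ((m:ℝ) / (m + 2)) ^ N)) atTop (𝓝 0) := by
    have h1 : Tendsto (fun m : ℕ => (m:ℝ) / (m + 2)) atTop (𝓝 1) := tendsto_natCast_div_add_atTop 2
    simpa using ((h1.pow N).const_sub 1).const_mul (β * (1 + ‖ξ‖))
  obtain ⟨m, hm1, hm2, hm3⟩ := ((tendsto_natCast_atTop_atTop.eventually hev).and
    ((hq.eventually_lt_const (show 0 < η / 3 by positivity)).and (eventually_gt_atTop 0))).exists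
  have hm' : (0:ℝ) < m := by exact_mod_cast hm3
  obtain ⟨c, ⟨φ, K, hK, hT, hz, rfl⟩, hclt⟩ := exists_lt_of_csInf_lt
    (show {c : ℝ | ∃ (φ : EN N → EN d) (K : ℝ≥0), LipschitzWith K φ ∧
      (∀ x, φ x ∈ TangentSet M s) ∧ (∀ x, x ∉ posCube N m → φ x = 0) ∧
      c = ((m:ℝ) ^ N)⁻¹ * ∫ x in posCube N m, f x (ξ + fderiv ℝ φ x)}.Nonempty from
      ⟨_, fun _ => 0, 0, LipschitzWith.const _, fun _ => h0, fun _ _ => rfl, rfl⟩) hm1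
  set e : EN N := WithLp.toLp 2 (fun _ => 1)
  set w : EN N → EN d := fun x => φ (x - e)
  have hwK : LipschitzWith (K * 1) w := hK.comp (LipschitzWith.of_dist_le_mul fun x y => by simp)
  have hwd : ∀ x, fderiv ℝ w x = fderiv ℝ φ (x - e) := fun x => by
    simpa [w, sub_eq_add_neg] using fderiv_comp_add_right (𝕜 := ℝ) (f := φ) (x := x) (-e)
  have hws : Function.support w ⊆ hg_Q e m := fun x hx => by
    by_contra h; exact hx (hz _ h)
  have hcl : closure (hg_Q e (m:ℝ)) ⊆ {x | ∀ i, x i ∈ Icc (1:ℝ) (m + 1)} := by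
    refine closure_minimal (fun x hx i => ?_) ?_
    · have := hx i
      simp only [e, PiLp.sub_apply, mem_Ioo] at this
      exact ⟨by linarith [this.1], by linarith [this.2]⟩
    · simp only [ofPred_forall]
      exact isClosed_iInter fun i => isClosed_Icc.preimage (by fun_prop)
  have hbd : Bornology.IsBounded (hg_Q e (m:ℝ)) := by
    refine (Metric.isBounded_iff_subset_closedBall e).2 ⟨N * m, fun x hx => ?_⟩
    rw [mem_closedBall_iff_norm]; exact hg_norm_posCube hx
  have hwts : tsupport w ⊆ closure (hg_Q e (m:ℝ)) := closure_mono hws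
  have hwc : HasCompactSupport w :=
    hbd.isCompact_closure.of_isClosed_subset (isClosed_tsupport _) hwts
  set t : ℕ := m + 2
  have htm : (t:ℝ) = m + 2 := by simp [t]
  have hwsub : tsupport w ⊆ posCube N t := (hwts.trans hcl).trans fun x hx i => by
    have := hx i
    rw [htm]; exact ⟨by linarith [this.1], by linarith [this.2]⟩
  have hW := hg_lip_W hwK hwc
  have hWu := hg_W_univ hW
  obtain ⟨n, hn1, hn2⟩ := ((hg_moll_support hwc (hg_isOpen_posCube N t) hwsub).and
    ((((hg_approx hW).const_mul ‖P‖).const_mul L).eventually_lt_const (show L * (‖P‖ * 0) < η / 3 by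
      rw [mul_zero, mul_zero]; positivity))).exists
  have hsmooth : ContDiff ℝ 1 (hg_moll n w) := (hg_moll_smooth n hWu.1).of_le (by norm_cast)
  set ψ : EN N → EN d := fun x => P (hg_moll n w x)
  have hsupψ : tsupport ψ ⊆ tsupport (hg_moll n w) :=
    closure_mono fun y hy h => hy (by simp [ψ, h])
  have hψd : ∀ x, fderiv ℝ ψ x = P.comp (fderiv ℝ (hg_moll n w) x) := fun x =>
    (P.hasFDerivAt.comp x ((hsmooth.differentiable (by simp)) x).hasFDerivAt).fderiv
  refine ⟨t, by simp [t], ψ, P.contDiff.comp hsmooth,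
    hn1.1.mono' (subset_tsupport _ |>.trans hsupψ), hsupψ.trans hn1.2, fun x => hR.tan_mem hsM _, ?_⟩
  have : IsFiniteMeasure (volume.restrict (posCube N t)) := ⟨by
          simpa using (hg_volume_posCube_ne_top _ _).lt_top⟩
  have hP : ∀ {D : EN N → Mat d N}, Integrable D → Integrable (fun x => P.comp (D x)) := fun hD =>
    ((ContinuousLinearMap.compL ℝ (EN N) (EN d) (EN d)) P).integrable_comp hD
  have hi1 := hg_moll_fderiv_integrable hW n
  have hPw : ∀ x, P.comp (fderiv ℝ w x) = fderiv ℝ w x := fun x => by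
    by_cases hx : DifferentiableAt ℝ w x
    · have h1 := (P.hasFDerivAt.comp x hx.hasFDerivAt).fderiv
      have h2 : (fun x => P (w x)) = w := funext fun x => hR.tan_fix (hT _)
      rw [← h1]
      change fderiv ℝ (fun x => P (w x)) x = _
      rw [h2]
    · rw [fderiv_zero_of_not_differentiableAt hx]; simp
  have hdiff := hg_f_diff hf one_ne_zero (hg_volume_posCube_ne_top N t)
    (D1 := fun x => ξ + P.comp (fderiv ℝ (hg_moll n w) x)) (D2 := fun x => ξ + fderiv ℝ w x)
    ((integrable_const ξ).add (hP hi1).integrableOn)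
    ((integrable_const ξ).add hWu.2.1.integrableOn)
  simp only [one_smul] at hdiff
  have hb : ∫ x in posCube N t, ‖(ξ + P.comp (fderiv ℝ (hg_moll n w) x)) - (ξ + fderiv ℝ w x)‖ ≤
      ‖P‖ * ∫ x, ‖fderiv ℝ (hg_moll n w) x - fderiv ℝ w x‖ := by
    rw [← integral_const_mul]
    have hi2 : Integrable (fun x => ‖P‖ * ‖fderiv ℝ (hg_moll n w) x - fderiv ℝ w x‖) :=
      (hi1.sub hWu.2.1).norm.const_mul _
    refine le_trans ?_ (setIntegral_le_integral (s := posCube N t) hi2 (Eventually.of_forall fun x => by positivity))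
    refine integral_mono_of_nonneg (Eventually.of_forall fun x => norm_nonneg _) hi2.integrableOn
      (Eventually.of_forall fun x => ?_)
    dsimp only
    rw [add_sub_add_left_eq_sub, ← hPw x, ← ContinuousLinearMap.comp_sub, hPw x]
    exact ContinuousLinearMap.opNorm_comp_le _ _
  -- energy of w
  set g : EN N → ℝ := fun x => f x (ξ + fderiv ℝ w x)
  have hsub : hg_Q e (m:ℝ) ⊆ posCube N t := (subset_closure.trans hcl).trans fun x hx i => by
    have := hx i
    rw [htm]; exact ⟨by linarith [this.1], by linarith [this.2]⟩
  have : IsFiniteMeasure (volume.restrict (posCube N t \ hg_Q e (m:ℝ))) := ⟨by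
        simpa using (measure_mono sdiff_subset).trans_lt (hg_volume_posCube_ne_top N t).lt_top⟩
  have hInt0 : IntegrableOn g (posCube N t) := by
    have := hg_integrable_f hf one_ne_zero (D := fun x => ξ + fderiv ℝ w x) (hg_volume_posCube_ne_top N t)
      ((integrable_const ξ).add hWu.2.1.integrableOn)
    simpa using this
  have hsplit : ∫ x in posCube N t, g x = (∫ x in hg_Q e (m:ℝ), g x) + ∫ x in posCube N t \ hg_Q e (m:ℝ), g x := by
      rw [add_comm, setIntegral_sdiff (hg_Q_meas _ _) hInt0 hsub, sub_add_cancel]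
  have hconv : Convex ℝ (hg_Q e (m:ℝ)) := by
    intro x hx y hy a b ha hb hab i
    have h1 := hx i; have h2 := hy i
    simp only [e, PiLp.sub_apply, PiLp.add_apply, PiLp.smul_apply, smul_eq_mul, mem_Ioo] at h1 h2 ⊢
    have hc := (convex_Ioo (1:ℝ) (m+1)) (show x i ∈ Ioo (1:ℝ) (m+1) from ⟨by linarith [h1.1], by linarith [h1.2]⟩)
      (show y i ∈ Ioo (1:ℝ) (m+1) from ⟨by linarith [h2.1], by linarith [h2.2]⟩) ha hb hab
    simp only [smul_eq_mul, mem_Ioo] at hc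
    exact ⟨by linarith [hc.1], by linarith [hc.2]⟩
  have e3 : ∫ x in posCube N t \ hg_Q e (m:ℝ), g x ≤ β * (1 + ‖ξ‖) * ((t:ℝ) ^ N - (m:ℝ) ^ N) := by
    have hvol : volume.real (posCube N t \ hg_Q e (m:ℝ)) = (t:ℝ) ^ N - (m:ℝ) ^ N := by
      rw [measureReal_sdiff hsub (hg_Q_meas _ _) (hg_volume_posCube_ne_top _ _),
        hg_Q_real _ (by positivity), hg_volreal_posCube N (by positivity)]
    calc _ ≤ ∫ x in posCube N t \ hg_Q e (m:ℝ), β * (1 + ‖ξ‖) := by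
            refine integral_mono_of_nonneg (Eventually.of_forall fun x => hf.nonneg _ _) (integrable_const _) ?_
            have hfr : ∀ᵐ x ∂(volume : Measure (EN N)), x ∉ frontier (hg_Q e (m:ℝ)) :=
              measure_eq_zero_iff_ae_notMem.1 (hconv.addHaar_frontier volume)
            filter_upwards [ae_restrict_of_ae hf.growth, ae_restrict_of_ae hfr,
              ae_restrict_mem ((hg_measurableSet_posCube _ _).diff (hg_Q_meas _ _))] with x hx hxf hxm
            have : fderiv ℝ w x = 0 := by
              have h1 : x ∉ tsupport w := fun h => by
                have h2 := hwts h
                rw [closure_eq_interior_union_frontier, (hg_Q_open e (m:ℝ)).interior_eq] at h2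
                exact h2.elim hxm.2 hxf
              exact fderiv_of_notMem_tsupport (𝕜 := ℝ) h1
            simp only [g, this, add_zero] at hx ⊢; exact (hx ξ).2
        _ = _ := by simp [hvol]; ring
  have e4 : ∫ x in hg_Q e (m:ℝ), g x = ∫ x in posCube N m, f x (ξ + fderiv ℝ φ x) := by
    have := hg_Q_int e one_pos (m:ℝ) g
    rw [one_mul, one_pow, one_mul] at this
    rw [this]
    refine integral_congr_ae (Eventually.of_forall fun y => ?_)
    simp only [g, hwd, one_smul, add_sub_cancel_left]
    rw [add_comm e y]
    have h1 := hg_per_int hf (fun _ => 1) y (ξ + fderiv ℝ φ y)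
    simpa [e] using h1
  have e5 : ∫ x in posCube N m, f x (ξ + fderiv ℝ φ x) ≤ (m:ℝ) ^ N * (Tfhom f M s ξ + η / 3) := by
    rw [inv_mul_lt_iff₀ (by positivity)] at hclt; exact hclt.le
  have ht0 : (0:ℝ) < t := by rw [htm]; positivity
  simp only [hψd]
  have hb' := mul_le_mul_of_nonneg_left hb hL.le
  have tot : ∫ x in posCube N t, f x (ξ + P.comp (fderiv ℝ (hg_moll n w) x)) ≤
      (m:ℝ) ^ N * (Tfhom f M s ξ + η / 3) + β * (1 + ‖ξ‖) * ((t:ℝ) ^ N - (m:ℝ) ^ N) + η / 3 := by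
    linarith
  have ht1 : (1:ℝ) ≤ (t:ℝ) ^ N := one_le_pow₀ (by rw [htm]; linarith)
  have hmt : (m:ℝ) ^ N ≤ (t:ℝ) ^ N := by gcongr; simp [t]
  rw [inv_mul_le_iff₀ (by positivity)]
  rw [← htm, div_pow] at hm2
  have hm2' : β * (1 + ‖ξ‖) * ((t:ℝ) ^ N - (m:ℝ) ^ N) ≤ (t:ℝ) ^ N * (η / 3) := by
    have := mul_le_mul_of_nonneg_left hm2.le (show 0 ≤ (t:ℝ) ^ N by positivity)
    refine le_trans (le_of_eq ?_) this
    field_simp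
  have h6 : (m:ℝ) ^ N * (Tfhom f M s ξ + η / 3) ≤ (t:ℝ) ^ N * (Tfhom f M s ξ + η / 3) := by gcongr
  have h7 : η / 3 ≤ (t:ℝ) ^ N * (η / 3) := le_mul_of_one_le_left (by positivity) ht1
  linarith
end

end

section
open MeasureTheory Filter Set
open scoped ENNReal RealInnerProductSpace Topology NNReal Pointwise

variable {N d : ℕ}

section

theorem hg_Tfhom_usc
    {f : EN N → Mat d N → ℝ} {α β L : ℝ} (hf : StdIntegrand N d f α β L) {M : Set (EN d)} {s : EN d}
    {G : EN d → EN d} {δ C : ℝ} (hR : hg_Ret M G δ C) (hsM : s ∈ M) (ξ : Mat d N) {η : ℝ} (hη : 0 < η) :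
    ∀ᶠ q : EN d × Mat d N in 𝓝 (s, ξ), q.1 ∈ M → Tfhom f M q.1 q.2 < Tfhom f M s ξ + η := by
  obtain ⟨t, ht, φ, hφ, hc, hs, hT, hE⟩ := hg_recover hf hR hsM ξ (half_pos hη)
  have hL := hf.lip_pos
  have ht' : (0:ℝ) < t := by exact_mod_cast ht
  have hcd : Continuous (fderiv ℝ φ) := hφ.continuous_fderiv (by simp)
  obtain ⟨Cφ, hCφ⟩ := hcd.bounded_above_of_compact_support (hc.fderiv ℝ)
  have hGc : Continuous (fderiv ℝ G) := hR.smooth.continuous_fderiv (by simp)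
  have hcont : Continuous (fun q : EN d × Mat d N => L * (‖q.2 - ξ‖ + ‖fderiv ℝ G q.1 - fderiv ℝ G s‖ * Cφ)) := by
    fun_prop
  have hev := hcont.continuousAt (x := (s, ξ)).eventually_lt_const (show _ < η / 2 by simpa using half_pos hη)
  filter_upwards [hev] with q hq hqM
  set P := fderiv ℝ G q.1
  set P0 := fderiv ℝ G s
  set ψ : EN N → EN d := fun x => P (φ x)
  have hφd := hφ.differentiable (by simp)
  have hψd : ∀ x, fderiv ℝ ψ x = P.comp (fderiv ℝ φ x) := fun x =>
    (P.hasFDerivAt.comp x (hφd x).hasFDerivAt).fderiv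
  have hP0 : ∀ x, fderiv ℝ φ x = P0.comp (fderiv ℝ φ x) := fun x => by
    have h1 := (P0.hasFDerivAt.comp x (hφd x).hasFDerivAt).fderiv
    have h2 : (fun x => P0 (φ x)) = φ := funext fun x => hR.tan_fix (hT _)
    rw [← h1]
    change _ = fderiv ℝ (fun x => P0 (φ x)) x
    rw [h2]
  have hsupψ : tsupport ψ ⊆ tsupport φ := closure_mono fun y hy h => hy (by simp [ψ, h])
  have main := hg_Tfhom_le hf (hR.tan_zero hqM) q.2 ht (φ := ψ) (P.contDiff.comp hφ)
    (hc.mono' (subset_tsupport _ |>.trans hsupψ)) (hsupψ.trans hs) (fun x => hR.tan_mem hqM _)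
  have : IsFiniteMeasure (volume.restrict (posCube N t)) := ⟨by
          simpa using (hg_volume_posCube_ne_top _ _).lt_top⟩
  have hi : Integrable (fderiv ℝ φ) := hcd.integrable_of_hasCompactSupport (hc.fderiv ℝ)
  have hP : Integrable (fun x => P.comp (fderiv ℝ φ x)) :=
    ((ContinuousLinearMap.compL ℝ (EN N) (EN d) (EN d)) P).integrable_comp hi
  have hdiff := hg_f_diff hf one_ne_zero (hg_volume_posCube_ne_top N t)
    (D1 := fun x => q.2 + P.comp (fderiv ℝ φ x)) (D2 := fun x => ξ + fderiv ℝ φ x)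
    ((integrable_const q.2).add hP.integrableOn)
    ((integrable_const ξ).add hi.integrableOn)
  simp only [one_smul] at hdiff
  have hb : ∫ x in posCube N t, ‖(q.2 + P.comp (fderiv ℝ φ x)) - (ξ + fderiv ℝ φ x)‖ ≤
      t ^ N * (‖q.2 - ξ‖ + ‖P - P0‖ * Cφ) := by
    calc _ ≤ ∫ x in posCube N t, (‖q.2 - ξ‖ + ‖P - P0‖ * Cφ) := by
          refine integral_mono_of_nonneg (Eventually.of_forall fun x => norm_nonneg _) (integrable_const _)
            (Eventually.of_forall fun x => ?_)
          dsimp only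
          rw [add_sub_add_comm]
          refine (norm_add_le _ _).trans (add_le_add le_rfl ?_)
          nth_rw 2 [hP0 x]
          rw [← ContinuousLinearMap.sub_comp]
          exact (ContinuousLinearMap.opNorm_comp_le _ _).trans (by gcongr; exact hCφ x)
      _ = _ := by simp [hg_volreal_posCube N ht'.le]
  simp only [hψd] at main
  have h3 := mul_le_mul_of_nonneg_left hb hL.le
  have h4 : ((t:ℝ) ^ N)⁻¹ * ∫ x in posCube N t, f x (q.2 + P.comp (fderiv ℝ φ x)) ≤
      ((t:ℝ) ^ N)⁻¹ * (∫ x in posCube N t, f x (ξ + fderiv ℝ φ x)) + L * (‖q.2 - ξ‖ + ‖P - P0‖ * Cφ) := by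
    calc _ ≤ ((t:ℝ) ^ N)⁻¹ * ((∫ x in posCube N t, f x (ξ + fderiv ℝ φ x)) +
          L * (t ^ N * (‖q.2 - ξ‖ + ‖P - P0‖ * Cφ))) := by gcongr; linarith
      _ = _ := by field_simp
  linarith

theorem hg_Tfhom_measurable
    {f : EN N → Mat d N → ℝ} {α β L : ℝ} (hf : StdIntegrand N d f α β L) {M : Set (EN d)}
    {G : EN d → EN d} {δ C : ℝ} (hR : hg_Ret M G δ C) :
    Measurable ((Prod.fst ⁻¹' M).indicator (fun p : EN d × Mat d N => Tfhom f M p.1 p.2)) := by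
  apply UpperSemicontinuous.measurable
  rintro ⟨s, ξ⟩ y hy
  by_cases hs : s ∈ M
  · rw [indicator_of_mem (by exact hs)] at hy
    dsimp only at hy
    have hn := hg_Tfhom_nonneg hf (hR.tan_zero hs) ξ
    filter_upwards [hg_Tfhom_usc hf hR hs ξ (sub_pos.2 hy)] with q hq
    by_cases hqM : q.1 ∈ M
    · rw [indicator_of_mem (by exact hqM)]
      linarith [hq hqM]
    · rw [indicator_of_notMem (by exact hqM)]; linarith
  · rw [indicator_of_notMem (by exact hs)] at hy
    have ho : IsOpen ((Prod.fst : EN d × Mat d N → EN d) ⁻¹' Mᶜ) :=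
      hR.cpt.isClosed.isOpen_compl.preimage continuous_fst
    filter_upwards [ho.mem_nhds (show (s, ξ) ∈ _ from hs)] with q hq
    rw [indicator_of_notMem (by exact hq)]; exact hy

theorem hg_Tfhom_aem
    {f : EN N → Mat d N → ℝ} {α β L : ℝ} (hf : StdIntegrand N d f α β L) {M : Set (EN d)}
    {G : EN d → EN d} {δ C : ℝ} (hR : hg_Ret M G δ C) {Ω : Set (EN N)} {u : EN N → EN d} {Du : EN N → Mat d N}
    (hu : MemW11 Ω u Du) (huM : AeIn Ω u M) :
    AEMeasurable (fun x => Tfhom f M (u x) (Du x)) (volume.restrict Ω) := by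
  have h1 : AEMeasurable (fun x => (u x, Du x)) (volume.restrict Ω) :=
    hu.1.aestronglyMeasurable.aemeasurable.prodMk hu.2.1.aestronglyMeasurable.aemeasurable
  refine ((hg_Tfhom_measurable hf hR).comp_aemeasurable h1).congr ?_
  filter_upwards [huM] with x hx
  simp only [Function.comp]
  rw [indicator_of_mem (by exact hx)]

theorem hg_Tfhom_integrable
    {f : EN N → Mat d N → ℝ} {α β L : ℝ} (hf : StdIntegrand N d f α β L) {M : Set (EN d)}
    {G : EN d → EN d} {δ C : ℝ} (hR : hg_Ret M G δ C) {Ω : Set (EN N)} (hΩ : volume Ω ≠ ⊤) {u : EN N → EN d} {Du : EN N → Mat d N}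
    (hu : MemW11 Ω u Du) (huM : AeIn Ω u M) :
    IntegrableOn (fun x => Tfhom f M (u x) (Du x)) Ω := by
  have : IsFiniteMeasure (volume.restrict Ω) := ⟨by simpa using hΩ.lt_top⟩
  refine Integrable.mono' (g := fun x => β * (1 + ‖Du x‖)) (((integrable_const 1).add hu.2.1.norm).const_mul β)
    (hg_Tfhom_aem hf hR hu huM).aestronglyMeasurable ?_
  filter_upwards [huM] with x hx
  rw [Real.norm_of_nonneg (hg_Tfhom_nonneg hf (hR.tan_zero hx) _)]
  exact hg_Tfhom_bd hf (hR.tan_zero hx) _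
end

end

section
open MeasureTheory Filter Set
open scoped ENNReal RealInnerProductSpace Topology NNReal Pointwise

variable {N d : ℕ}

theorem hg_tau_exists (d : ℕ) : ∃ (τ : EN d → EN d) (c : ℝ), 0 ≤ c ∧ ContDiff ℝ 1 τ ∧ (∀ z, ‖fderiv ℝ τ z‖ ≤ c) ∧
    (∀ z, ‖z‖ ≤ 1 → τ =ᶠ[𝓝 z] id) ∧ (∀ z, 2 ≤ ‖z‖ → τ =ᶠ[𝓝 z] fun _ => 0) ∧ ∀ z, ‖τ z‖ ≤ ‖z‖ := by
  obtain ⟨η, h1, h2, h3, h4, h5⟩ := hg_cutoff (isCompact_closedBall (0 : EN d) 1) (Metric.isOpen_ball (x := (0 : EN d)) (ε := 2))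
    (Metric.closedBall_subset_ball (by norm_num))
  have hsm : ContDiff ℝ 1 (fun z => η z • z) := (h1.of_le (by norm_cast)).smul contDiff_id
  have hc : HasCompactSupport (fun z => η z • z) := h2.smul_right
  obtain ⟨c, hcb⟩ := (hsm.continuous_fderiv (by simp)).bounded_above_of_compact_support (hc.fderiv ℝ)
  refine ⟨fun z => η z • z, c, (norm_nonneg _).trans (hcb 0), hsm, hcb, ?_, ?_, ?_⟩
  · intro z hz
    have := h5.filter_mono (nhds_le_nhdsSet (show z ∈ Metric.closedBall (0 : EN d) 1 by simpa using hz))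
    filter_upwards [this] with y hy
    simp [hy]
  · intro z hz
    have : z ∉ tsupport η := fun h => by
      have := h3 h
      simp at this; linarith
    filter_upwards [(isClosed_tsupport η).isOpen_compl.mem_nhds this] with y hy
    rw [image_eq_zero_of_notMem_tsupport hy, zero_smul]
  · intro z
    rw [norm_smul, Real.norm_of_nonneg (h4 z).1]
    exact mul_le_of_le_one_left (norm_nonneg _) (h4 z).2

set_option maxHeartbeats 1000000 in
/-- pointwise estimate -/
theorem hg_pointwise {f0 : Mat d N → ℝ} {β L : ℝ} (hβ : 0 ≤ β) (hL : 0 ≤ L)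
    (hg : ∀ ξ, 0 ≤ f0 ξ ∧ f0 ξ ≤ β * (1 + ‖ξ‖)) (hl : ∀ ξ ξ', |f0 ξ - f0 ξ'| ≤ L * ‖ξ - ξ'‖)
    {P Pv A : EN d →L[ℝ] EN d} {D ξ : Mat d N} {χ0 : ℝ} {ℓ : EN N →L[ℝ] ℝ} {z Tz : EN d}
    {C c cχ R ω ρ a : ℝ} (hC : 0 ≤ C) (hc : 0 ≤ c) (hcχ : 0 ≤ cχ) (hω0 : 0 ≤ ω) (hρ : 0 < ρ) (ha : ρ ≤ a)
    (hP : ‖P‖ ≤ C) (hPξ : P.comp ξ = ξ) (hPD : Pv.comp D = D) (hχ : 0 ≤ χ0 ∧ χ0 ≤ 1) (hℓ : ‖ℓ‖ ≤ cχ / ρ)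
    (hξ : ‖ξ‖ ≤ R) (hA : ‖A‖ ≤ c) (hT : ‖Tz‖ ≤ ‖z‖)
    (h1 : ‖z‖ ≤ a → A = ContinuousLinearMap.id ℝ _ ∧ Tz = z ∧ ‖Pv - P‖ ≤ ω)
    (h2 : 2 * a ≤ ‖z‖ → A = 0 ∧ Tz = 0) :
    f0 (ξ + P.comp (χ0 • (A.comp (D - ξ)) + ℓ.smulRight Tz)) ≤
      f0 D + L * ((1 - χ0) * (R + ‖D‖) + ω * ‖D‖) + (L * cχ * C + β * (1 + R + C * c * R + C * cχ)) * (‖z‖ / ρ)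
        + (if a ≤ ‖z‖ ∧ ‖z‖ < 2 * a then 1 else 0) * (β * C * c * ‖D‖) := by
  have hR : 0 ≤ R := (norm_nonneg _).trans hξ
  have hr : 0 ≤ ‖z‖ / ρ := by positivity
  have hl1 : ‖P.comp (ℓ.smulRight Tz)‖ ≤ C * (cχ * (‖z‖ / ρ)) := by
    refine (ContinuousLinearMap.opNorm_comp_le _ _).trans ?_
    refine mul_le_mul hP ?_ (norm_nonneg _) hC
    rw [ContinuousLinearMap.norm_smulRight_apply]
    calc _ ≤ cχ / ρ * ‖z‖ := mul_le_mul hℓ hT (norm_nonneg _) (by positivity)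
      _ = _ := by ring
  have hχ1 := sub_nonneg.2 hχ.2
  have hLω : 0 ≤ L * (ω * ‖D‖) := by positivity
  have hLχ : 0 ≤ L * ((1 - χ0) * (R + ‖D‖)) := by positivity
  rcases le_or_gt (2 * a) ‖z‖ with hz2 | hz2
  · obtain ⟨rfl, rfl⟩ := h2 hz2
    have hz1 : 1 ≤ ‖z‖ / ρ := by rw [le_div_iff₀ hρ]; linarith
    have e : ξ + P.comp (χ0 • ((0 : EN d →L[ℝ] EN d).comp (D - ξ)) + ℓ.smulRight 0) = ξ := by
      ext; simp
    rw [e, if_neg (by intro h; linarith [h.2])]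
    have h3 : f0 ξ ≤ β * (1 + R) := (hg ξ).2.trans (by gcongr)
    have h4 : β * (1 + R) ≤ (L * cχ * C + β * (1 + R + C * c * R + C * cχ)) * (‖z‖ / ρ) := by
      calc β * (1 + R) ≤ (L * cχ * C + β * (1 + R + C * c * R + C * cχ)) * 1 := by
            have : 0 ≤ L * cχ * C + β * (C * c * R + C * cχ) := by positivity
            linarith
        _ ≤ _ := by gcongr
    have := (hg D).1
    linarith
  · rcases le_or_gt ‖z‖ a with hz1 | hz1
    · obtain ⟨rfl, rfl, hPP⟩ := h1 hz1
      have e : ξ + P.comp (χ0 • ((ContinuousLinearMap.id ℝ (EN d)).comp (D - ξ)) + ℓ.smulRight Tz) - D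
          = (1 - χ0) • (ξ - D) - χ0 • ((Pv - P).comp D) + P.comp (ℓ.smulRight Tz) := by
        have hPD' : ∀ y, Pv (D y) = D y := fun y => by
          rw [← ContinuousLinearMap.comp_apply, hPD]
        have hPξ' : ∀ y, P (ξ y) = ξ y := fun y => by
          rw [← ContinuousLinearMap.comp_apply, hPξ]
        ext1 y
        simp only [ContinuousLinearMap.id_comp, add_apply, sub_apply, ContinuousLinearMap.comp_apply,
          smul_apply, map_add, map_smul, map_sub, hPD', hPξ', smul_sub, sub_smul, one_smul]
        abel
      have hn : ‖ξ + P.comp (χ0 • ((ContinuousLinearMap.id ℝ (EN d)).comp (D - ξ)) + ℓ.smulRight Tz) - D‖ ≤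
          (1 - χ0) * (R + ‖D‖) + ω * ‖D‖ + C * (cχ * (‖Tz‖ / ρ)) := by
        rw [e]
        refine (norm_add_le _ _).trans (add_le_add ((norm_sub_le _ _).trans (add_le_add ?_ ?_)) hl1)
        · rw [norm_smul, Real.norm_of_nonneg hχ1]
          exact mul_le_mul_of_nonneg_left ((norm_sub_le _ _).trans (by gcongr)) hχ1
        · rw [norm_smul, Real.norm_of_nonneg hχ.1]
          refine (mul_le_of_le_one_left (norm_nonneg _) hχ.2).trans ?_
          exact (ContinuousLinearMap.opNorm_comp_le _ _).trans (mul_le_mul_of_nonneg_right hPP (norm_nonneg _))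
      have h3 := (abs_le.1 (hl (ξ + P.comp (χ0 • ((ContinuousLinearMap.id ℝ (EN d)).comp (D - ξ)) + ℓ.smulRight Tz)) D)).2
      have h4 := mul_le_mul_of_nonneg_left hn hL
      have h5 : 0 ≤ β * (1 + R + C * c * R + C * cχ) * (‖Tz‖ / ρ) := by positivity
      have h6 : 0 ≤ (if a ≤ ‖Tz‖ ∧ ‖Tz‖ < 2 * a then (1:ℝ) else 0) * (β * C * c * ‖D‖) := by
        split_ifs <;> simp; positivity
      linarith [h3, h4, h5, h6]
    · have hz1' : 1 ≤ ‖z‖ / ρ := by rw [le_div_iff₀ hρ]; linarith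
      rw [if_pos ⟨hz1.le, hz2⟩, one_mul]
      have h8 : ‖ξ + P.comp (χ0 • (A.comp (D - ξ)) + ℓ.smulRight Tz)‖ ≤ R + (C * (c * (‖D‖ + R)) + C * (cχ * (‖z‖ / ρ))) := by
        refine (norm_add_le _ _).trans (add_le_add hξ ?_)
        rw [ContinuousLinearMap.comp_add]
        refine (norm_add_le _ _).trans (add_le_add ?_ hl1)
        refine (ContinuousLinearMap.opNorm_comp_le _ _).trans (mul_le_mul hP ?_ (norm_nonneg _) hC)
        rw [norm_smul, Real.norm_of_nonneg hχ.1]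
        refine (mul_le_of_le_one_left (norm_nonneg _) hχ.2).trans ?_
        refine (ContinuousLinearMap.opNorm_comp_le _ _).trans (mul_le_mul hA ?_ (norm_nonneg _) hc)
        exact (norm_sub_le _ _).trans (by gcongr)
      have h9 := (hg (ξ + P.comp (χ0 • (A.comp (D - ξ)) + ℓ.smulRight Tz))).2
      have h10 : β * (1 + ‖ξ + P.comp (χ0 • (A.comp (D - ξ)) + ℓ.smulRight Tz)‖) ≤
          β * (1 + (R + (C * (c * (‖D‖ + R)) + C * (cχ * (‖z‖ / ρ))))) := by gcongr
      have h11 : β * (1 + R + C * c * R) ≤ β * (1 + R + C * c * R) * (‖z‖ / ρ) := le_mul_of_one_le_right (by positivity) hz1'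
      have h12 : 0 ≤ L * cχ * C * (‖z‖ / ρ) := by positivity
      have := (hg D).1
      linarith [h9, h10, h11, h12, hLω, hLχ, this]

end

section
open MeasureTheory Filter Set
open scoped ENNReal RealInnerProductSpace Topology NNReal Pointwise

variable {N d : ℕ}

/-- the affine remainder -/
noncomputable def hg_z (v : EN N → EN d) (s : EN d) (ξ : Mat d N) (x0 x : EN N) : EN d := v x - s - ξ (x - x0)

theorem hg_trunc_W {Ω : Set (EN N)} (hΩ : IsOpen Ω) (hb : Bornology.IsBounded Ω)
    {v : EN N → EN d} {Dv : EN N → Mat d N} (h : MemW11 Ω v Dv)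
    {τ : EN d → EN d} {c : ℝ} (hτ : ContDiff ℝ 1 τ) (hτc : ∀ z, ‖fderiv ℝ τ z‖ ≤ c)
    {a : ℝ} (ha : 0 < a) (s : EN d) (ξ : Mat d N) (x0 : EN N) :
    MemW11 Ω (fun x => a • τ (a⁻¹ • hg_z v s ξ x0 x))
      (fun x => (fderiv ℝ τ (a⁻¹ • hg_z v s ξ x0 x)).comp (Dv x - ξ)) := by
  set H : EN N × EN d → EN d := fun p => a • τ (a⁻¹ • (p.2 - s - ξ (p.1 - x0))) with hH
  have hd : ∀ p, HasFDerivAt H ((fderiv ℝ τ (a⁻¹ • (p.2 - s - ξ (p.1 - x0)))).comp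
      (ContinuousLinearMap.snd ℝ (EN N) (EN d) - ξ.comp (ContinuousLinearMap.fst ℝ (EN N) (EN d)))) p := by
    intro p
    have h1 : HasFDerivAt (fun p : EN N × EN d => a⁻¹ • (p.2 - s - ξ (p.1 - x0)))
        (a⁻¹ • (ContinuousLinearMap.snd ℝ (EN N) (EN d) - ξ.comp (ContinuousLinearMap.fst ℝ (EN N) (EN d)))) p := by
      have h0 : HasFDerivAt (fun p : EN N × EN d => p.2 - s - ξ (p.1 - x0))
          (ContinuousLinearMap.snd ℝ (EN N) (EN d) - ξ.comp (ContinuousLinearMap.fst ℝ (EN N) (EN d))) p :=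
        (hasFDerivAt_snd.sub_const s).sub (ξ.hasFDerivAt.comp p (hasFDerivAt_fst.sub_const x0))
      exact h0.const_smul a⁻¹
    have h2 := ((hτ.differentiable (by simp) (a⁻¹ • (p.2 - s - ξ (p.1 - x0)))).hasFDerivAt.comp p h1).const_smul a
    refine HasFDerivAt.congr_fderiv h2 ?_
    refine ContinuousLinearMap.ext fun q => ?_
    simp only [ContinuousLinearMap.comp_apply, smul_apply, map_smul, smul_smul, mul_inv_cancel₀ ha.ne', one_smul]
  have hsm : ContDiff ℝ 1 H := by
    refine ContDiff.const_smul _ (hτ.comp (ContDiff.const_smul _ ?_))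
    fun_prop
  have hc := hg_chain hΩ hb hsm (C := c * (‖ContinuousLinearMap.snd ℝ (EN N) (EN d) - ξ.comp (ContinuousLinearMap.fst ℝ (EN N) (EN d))‖)) (fun p => by
    rw [(hd p).fderiv]
    refine (ContinuousLinearMap.opNorm_comp_le _ _).trans ?_
    gcongr
    exact hτc _) h
  refine ⟨hc.1, ?_, ?_⟩
  · refine hc.2.1.congr (Eventually.of_forall fun x => ?_)
    ext1 y
    simp only [hg_grad_apply, (hd _).fderiv]
    rfl
  · intro φ h1 h2 h3 y
    refine (hc.2.2 φ h1 h2 h3 y).trans ?_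
    simp only [hg_grad_apply, (hd _).fderiv]
    rfl

set_option maxHeartbeats 1000000 in
theorem hg_local1 {f : EN N → Mat d N → ℝ} {α β L : ℝ} (hf : StdIntegrand N d f α β L)
    {M : Set (EN d)} {G : EN d → EN d} {δ C : ℝ} (hR : hg_Ret M G δ C)
    {Ω : Set (EN N)} (hΩ : IsOpen Ω) (hb : Bornology.IsBounded Ω)
    {v : EN N → EN d} {Dv : EN N → Mat d N} (hv : MemW11 Ω v Dv) (hvM : AeIn Ω v M)
    {τ : EN d → EN d} {c : ℝ} (hc0 : 0 ≤ c) (hτ : ContDiff ℝ 1 τ) (hτc : ∀ z, ‖fderiv ℝ τ z‖ ≤ c)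
    (hτ1 : ∀ z, ‖z‖ ≤ 1 → τ =ᶠ[𝓝 z] id) (hτ2 : ∀ z, 2 ≤ ‖z‖ → τ =ᶠ[𝓝 z] fun _ => 0)
    (hτ3 : ∀ z, ‖τ z‖ ≤ ‖z‖)
    {χ : EN N → ℝ} (hχ : ContDiff ℝ (⊤ : ℕ∞) χ) (hχc : HasCompactSupport χ) (hχs : tsupport χ ⊆ posCube N 1)
    (hχ1 : ∀ x, 0 ≤ χ x ∧ χ x ≤ 1) {cχ : ℝ} (hcχ : ∀ x, ‖fderiv ℝ χ x‖ ≤ cχ)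
    {s : EN d} (hs : s ∈ M) {ξ : Mat d N} (hξt : (fderiv ℝ G s).comp ξ = ξ) {R : ℝ} (hξ : ‖ξ‖ ≤ R)
    {x0 : EN N} {ε ρ a ω : ℝ} (hε : 0 < ε) (hρ : 0 < ρ) (ha : ρ ≤ a) (hω : 0 ≤ ω)
    (hωG : ∀ p, ‖p - s‖ ≤ a + R * (N * ρ) → ‖fderiv ℝ G p - fderiv ℝ G s‖ ≤ ω)
    (hQ : hg_Q x0 ρ ⊆ Ω) :
    ρ ^ N * Tfhom f M s ξ ≤ (∫ x in hg_Q x0 ρ, (f (ε⁻¹ • x) (Dv x) +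
        L * ((1 - χ (ρ⁻¹ • (x - x0))) * (R + ‖Dv x‖) + ω * ‖Dv x‖) +
        (L * cχ * C + β * (1 + R + C * c * R + C * cχ)) * (‖hg_z v s ξ x0 x‖ / ρ)
        + (if a ≤ ‖hg_z v s ξ x0 x‖ ∧ ‖hg_z v s ξ x0 x‖ < 2 * a then 1 else 0) * (β * C * c * ‖Dv x‖)))
      + β * (1 + R) * ((ρ + 2 * ε) ^ N - ρ ^ N) := by
  have ha0 : 0 < a := hρ.trans_le ha
  have hβ := hg_beta_pos hf
  have hL := hf.lip_pos
  have hC0 : 0 ≤ C := zero_le_one.trans hR.C1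
  have hR0 : 0 ≤ R := (norm_nonneg _).trans hξ
  have hcχ0 : 0 ≤ cχ := (norm_nonneg _).trans (hcχ 0)
  have hQm := hg_Q_meas x0 ρ
  set χr : EN N → ℝ := fun x => χ (ρ⁻¹ • (x - x0)) with hχr
  have hW := hg_trunc_W hΩ hb hv hτ hτc ha0 s ξ x0
  have hχrs : ContDiff ℝ (⊤ : ℕ∞) χr := hχ.comp (by fun_prop)
  let e : EN N ≃ₜ EN N := (Homeomorph.subRight x0).trans (Homeomorph.smulOfNeZero ρ⁻¹ (inv_ne_zero hρ.ne'))
  have hχrc : HasCompactSupport χr := hχc.comp_homeomorph e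
  have hχrt : tsupport χr ⊆ hg_Q x0 ρ := by
    intro x hx
    have h1 : ρ⁻¹ • (x - x0) ∈ tsupport χ :=
      tsupport_comp_subset_preimage χ (f := fun x => ρ⁻¹ • (x - x0)) (by fun_prop) hx
    have h2 := hχs h1
    intro i
    have := h2 i
    simp only [PiLp.sub_apply, PiLp.smul_apply, smul_eq_mul, mem_Ioo] at this ⊢
    rw [inv_mul_lt_iff₀ hρ, mul_one] at this
    exact ⟨by simpa [hρ] using this.1, this.2⟩
  have hχd : ∀ x, ‖fderiv ℝ χr x‖ ≤ cχ / ρ := by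
    intro x
    have h1 : HasFDerivAt (fun x : EN N => ρ⁻¹ • (x - x0)) (ρ⁻¹ • ContinuousLinearMap.id ℝ (EN N)) x :=
      HasFDerivAt.const_smul (f := fun x : EN N => x - x0) ((hasFDerivAt_id x).sub_const x0) ρ⁻¹
    have h2 := ((hχ.differentiable (by simp) (ρ⁻¹ • (x - x0))).hasFDerivAt.comp x h1).fderiv
    have h3 : fderiv ℝ χr x = ρ⁻¹ • fderiv ℝ χ (ρ⁻¹ • (x - x0)) := by
      rw [show χr = χ ∘ (fun x : EN N => ρ⁻¹ • (x - x0)) from rfl, h2]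
      ext1 y; simp
    rw [h3, norm_smul, Real.norm_of_nonneg (by positivity), div_eq_inv_mul]
    have := hcχ (ρ⁻¹ • (x - x0))
    gcongr
  have hcut := hg_cut hΩ.measurableSet hW hχrs hχrc (hχrt.trans hQ)
  set φ : EN N → EN d := fun x => χr x • a • τ (a⁻¹ • hg_z v s ξ x0 x)
  have hφt : tsupport φ ⊆ tsupport χr := closure_mono fun y hy h => hy (by simp [φ, h])
  have hφc : HasCompactSupport φ := hχrc.mono' ((subset_tsupport _).trans hφt)
  have key := hg_cell_W hf hR hs ξ x0 hε hρ hcut hφc (hφt.trans hχrt)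
  have hfin := hg_Q_ne_top x0 ρ
  have : IsFiniteMeasure (volume.restrict (hg_Q x0 ρ)) := ⟨by simpa using hfin.lt_top⟩
  have hDv : IntegrableOn Dv (hg_Q x0 ρ) := hv.2.1.mono_set hQ
  have hvI : IntegrableOn v (hg_Q x0 ρ) := hv.1.mono_set hQ
  have hzI : IntegrableOn (fun x => hg_z v s ξ x0 x) (hg_Q x0 ρ) := by
    have h1 : IntegrableOn (fun x => s + ξ (x - x0)) (hg_Q x0 ρ) := by
      refine IntegrableOn.of_bound hfin.lt_top (Continuous.aestronglyMeasurable (by fun_prop)) (‖s‖ + R * (N * ρ)) ?_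
      filter_upwards [ae_restrict_mem hQm] with x hx
      refine (norm_add_le _ _).trans (add_le_add le_rfl ?_)
      refine (ξ.le_opNorm _).trans ?_
      have := hg_norm_posCube hx
      gcongr
    refine (hvI.sub h1).congr (Eventually.of_forall fun x => ?_)
    simp [hg_z, sub_sub]
  have hmono : (∫ x in hg_Q x0 ρ, f (ε⁻¹ • x) (ξ + (fderiv ℝ G s).comp (χr x • ((fderiv ℝ τ (a⁻¹ • hg_z v s ξ x0 x)).comp (Dv x - ξ)) +
        (fderiv ℝ χr x).smulRight (a • τ (a⁻¹ • hg_z v s ξ x0 x))))) ≤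
      ∫ x in hg_Q x0 ρ, (f (ε⁻¹ • x) (Dv x) +
        L * ((1 - χ (ρ⁻¹ • (x - x0))) * (R + ‖Dv x‖) + ω * ‖Dv x‖) +
        (L * cχ * C + β * (1 + R + C * c * R + C * cχ)) * (‖hg_z v s ξ x0 x‖ / ρ)
        + (if a ≤ ‖hg_z v s ξ x0 x‖ ∧ ‖hg_z v s ξ x0 x‖ < 2 * a then 1 else 0) * (β * C * c * ‖Dv x‖)) := by
    refine integral_mono_ae ?_ ?_ ?_
    · refine hg_integrable_f hf (inv_ne_zero hε.ne') hfin ?_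
      have h1 := (((ContinuousLinearMap.compL ℝ (EN N) (EN d) (EN d)) (fderiv ℝ G s)).integrable_comp hcut.2.1)
      rw [Measure.restrict_univ] at h1
      exact (integrable_const ξ).add h1.integrableOn
    · have i1 : IntegrableOn (fun x => f (ε⁻¹ • x) (Dv x)) (hg_Q x0 ρ) := hg_integrable_f hf (inv_ne_zero hε.ne') hfin hDv
      have i2 : IntegrableOn (fun x => (1 - χ (ρ⁻¹ • (x - x0))) * (R + ‖Dv x‖)) (hg_Q x0 ρ) := by
        refine Integrable.bdd_mul (c := 1) ((integrable_const R).add hDv.norm) ?_ ?_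
        · exact Continuous.aestronglyMeasurable (continuous_const.sub (hχ.continuous.comp (by fun_prop)))
        · refine Eventually.of_forall fun x => ?_
          rw [Real.norm_eq_abs, abs_le]
          constructor <;> linarith [(hχ1 (ρ⁻¹ • (x - x0))).1, (hχ1 (ρ⁻¹ • (x - x0))).2]
      have i3 : IntegrableOn (fun x => (if a ≤ ‖hg_z v s ξ x0 x‖ ∧ ‖hg_z v s ξ x0 x‖ < 2 * a then (1:ℝ) else 0) * (β * C * c * ‖Dv x‖)) (hg_Q x0 ρ) := by
        refine Integrable.bdd_mul (c := 1) (hDv.norm.const_mul _) ?_ ?_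
        · have hm : Measurable (fun r : ℝ => if a ≤ r ∧ r < 2 * a then (1:ℝ) else 0) :=
            Measurable.ite (measurableSet_Ico (a := a) (b := 2 * a)) measurable_const measurable_const
          exact (hm.comp_aemeasurable hzI.norm.aestronglyMeasurable.aemeasurable).aestronglyMeasurable
        · refine Eventually.of_forall fun x => ?_
          split_ifs <;> simp
      exact ((i1.add ((i2.add (hDv.norm.const_mul ω)).const_mul L)).add ((hzI.norm.div_const ρ).const_mul _)).add i3
    · have g1 := hg_ae_scale hf.growth (inv_ne_zero hε.ne') 0
      have g2 := hg_ae_scale hf.lip (inv_ne_zero hε.ne') 0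
      have g3 := ae_restrict_of_ae_restrict_of_subset hQ (hR.grad_tan hΩ hb hv hvM)
      filter_upwards [ae_restrict_of_ae g1, ae_restrict_of_ae g2, g3, ae_restrict_mem hQm] with x k1 k2 k3 k4
      simp only [add_zero] at k1 k2
      have hx := hg_norm_posCube k4
      refine hg_pointwise hβ.le hL.le (fun ξ => ⟨hf.nonneg _ _, (k1 ξ).2⟩) k2 hC0 hc0 hcχ0 hω hρ ha (hR.bd s) hξt k3
        (hχ1 _) (hχd x) hξ (hτc _) ?_ ?_ ?_
      · rw [norm_smul, Real.norm_of_nonneg ha0.le]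
        calc a * ‖τ (a⁻¹ • hg_z v s ξ x0 x)‖ ≤ a * ‖a⁻¹ • hg_z v s ξ x0 x‖ := by gcongr; exact hτ3 _
          _ = _ := by rw [norm_smul, norm_inv, Real.norm_of_nonneg ha0.le, ← mul_assoc, mul_inv_cancel₀ ha0.ne', one_mul]
      · intro hz
        have h1 := hτ1 (a⁻¹ • hg_z v s ξ x0 x) (by
          rw [norm_smul, norm_inv, Real.norm_of_nonneg ha0.le, inv_mul_le_iff₀ ha0]; simpa using hz)
        refine ⟨?_, ?_, ?_⟩
        · rw [h1.fderiv_eq, fderiv_id]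
        · rw [h1.self_of_nhds, id, smul_smul, mul_inv_cancel₀ ha0.ne', one_smul]
        · refine hωG _ ?_
          have e : v x - s = hg_z v s ξ x0 x + ξ (x - x0) := by simp [hg_z]
          rw [e]
          refine (norm_add_le _ _).trans (add_le_add hz ?_)
          refine (ξ.le_opNorm _).trans ?_
          gcongr
      · intro hz
        have h1 := hτ2 (a⁻¹ • hg_z v s ξ x0 x) (by
          rw [norm_smul, norm_inv, Real.norm_of_nonneg ha0.le, le_inv_mul_iff₀ ha0]; linarith)
        refine ⟨?_, ?_⟩
        · rw [h1.fderiv_eq]; simp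
        · rw [h1.self_of_nhds, smul_zero]
  have hpow : ρ ^ N ≤ (ρ + 2 * ε) ^ N := by gcongr; linarith
  have hpow' : β * (1 + ‖ξ‖) * ((ρ + 2 * ε) ^ N - ρ ^ N) ≤ β * (1 + R) * ((ρ + 2 * ε) ^ N - ρ ^ N) := by
    have := sub_nonneg.2 hpow
    gcongr
  linarith

end

section
open MeasureTheory Filter Set
open scoped ENNReal RealInnerProductSpace Topology NNReal Pointwise

variable {N d : ℕ}

theorem hg_dyadic_sum (K : ℕ) {ρ : ℝ} (hρ : 0 < ρ) (r : ℝ) :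
    ∑ i ∈ Finset.range K, (if 2 ^ i * ρ ≤ r ∧ r < 2 * (2 ^ i * ρ) then (1:ℝ) else 0) ≤ 1 := by
  rw [Finset.sum_ite, Finset.sum_const_zero, add_zero, Finset.sum_const, nsmul_eq_mul, mul_one]
  have : (Finset.filter (fun i => 2 ^ i * ρ ≤ r ∧ r < 2 * (2 ^ i * ρ)) (Finset.range K)).card ≤ 1 := by
    rw [Finset.card_le_one]
    have key : ∀ i j : ℕ, 2 ^ i * ρ ≤ r ∧ r < 2 * (2 ^ i * ρ) → 2 ^ j * ρ ≤ r ∧ r < 2 * (2 ^ j * ρ) → ¬ i < j := by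
      intro i j hi hj hij
      have h1 : (2:ℝ) ^ (i + 1) ≤ 2 ^ j := pow_le_pow_right₀ (by norm_num) hij
      have h2 : (2:ℝ) ^ (i + 1) * ρ ≤ 2 ^ j * ρ := by gcongr
      rw [pow_succ] at h2
      linarith [hi.2, hj.1]
    intro i hi j hj
    simp only [Finset.mem_filter] at hi hj
    have h1 := key i j hi.2 hj.2
    have h2 := key j i hj.2 hi.2
    omega
  exact_mod_cast this

set_option maxHeartbeats 1000000 in
theorem hg_local {f : EN N → Mat d N → ℝ} {α β L : ℝ} (hf : StdIntegrand N d f α β L)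
    {M : Set (EN d)} {G : EN d → EN d} {δ C : ℝ} (hR : hg_Ret M G δ C)
    {Ω : Set (EN N)} (hΩ : IsOpen Ω) (hb : Bornology.IsBounded Ω)
    {v : EN N → EN d} {Dv : EN N → Mat d N} (hv : MemW11 Ω v Dv) (hvM : AeIn Ω v M)
    {τ : EN d → EN d} {c : ℝ} (hc0 : 0 ≤ c) (hτ : ContDiff ℝ 1 τ) (hτc : ∀ z, ‖fderiv ℝ τ z‖ ≤ c)
    (hτ1 : ∀ z, ‖z‖ ≤ 1 → τ =ᶠ[𝓝 z] id) (hτ2 : ∀ z, 2 ≤ ‖z‖ → τ =ᶠ[𝓝 z] fun _ => 0)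
    (hτ3 : ∀ z, ‖τ z‖ ≤ ‖z‖)
    {χ : EN N → ℝ} (hχ : ContDiff ℝ (⊤ : ℕ∞) χ) (hχc : HasCompactSupport χ) (hχs : tsupport χ ⊆ posCube N 1)
    (hχ1 : ∀ x, 0 ≤ χ x ∧ χ x ≤ 1) {cχ : ℝ} (hcχ : ∀ x, ‖fderiv ℝ χ x‖ ≤ cχ)
    {s : EN d} (hs : s ∈ M) {ξ : Mat d N} (hξt : (fderiv ℝ G s).comp ξ = ξ) {R : ℝ} (hξ : ‖ξ‖ ≤ R)
    {x0 : EN N} {ε ρ ω : ℝ} {K : ℕ} (hK : 0 < K) (hε : 0 < ε) (hρ : 0 < ρ) (hω : 0 ≤ ω)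
    (hωG : ∀ p, ‖p - s‖ ≤ (2 ^ K + R * N) * ρ → ‖fderiv ℝ G p - fderiv ℝ G s‖ ≤ ω)
    (hQ : hg_Q x0 ρ ⊆ Ω) :
    Tfhom f M s ξ ≤ (∫ y in posCube N 1, (f (ε⁻¹ • (x0 + ρ • y)) (Dv (x0 + ρ • y)) +
        L * ((1 - χ y) * (R + ‖Dv (x0 + ρ • y)‖) + ω * ‖Dv (x0 + ρ • y)‖) +
        (L * cχ * C + β * (1 + R + C * c * R + C * cχ)) * (‖hg_z v s ξ x0 (x0 + ρ • y)‖ / ρ)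
        + (β * C * c / K) * ‖Dv (x0 + ρ • y)‖))
      + β * (1 + R) * ((1 + 2 * (ε / ρ)) ^ N - 1) := by
  have hβ := hg_beta_pos hf
  have hL := hf.lip_pos
  have hC0 : 0 ≤ C := zero_le_one.trans hR.C1
  have hR0 : 0 ≤ R := (norm_nonneg _).trans hξ
  have hcχ0 : 0 ≤ cχ := (norm_nonneg _).trans (hcχ 0)
  have hQm := hg_Q_meas x0 ρ
  have hfin := hg_Q_ne_top x0 ρ
  have : IsFiniteMeasure (volume.restrict (hg_Q x0 ρ)) := ⟨by simpa using hfin.lt_top⟩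
  have hDv : IntegrableOn Dv (hg_Q x0 ρ) := hv.2.1.mono_set hQ
  have hvI : IntegrableOn v (hg_Q x0 ρ) := hv.1.mono_set hQ
  have hzI : IntegrableOn (fun x => hg_z v s ξ x0 x) (hg_Q x0 ρ) := by
    have h1 : IntegrableOn (fun x => s + ξ (x - x0)) (hg_Q x0 ρ) := by
      refine IntegrableOn.of_bound hfin.lt_top (Continuous.aestronglyMeasurable (by fun_prop)) (‖s‖ + R * (N * ρ)) ?_
      filter_upwards [ae_restrict_mem hQm] with x hx
      refine (norm_add_le _ _).trans (add_le_add le_rfl ?_)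
      refine (ξ.le_opNorm _).trans ?_
      have := hg_norm_posCube hx
      gcongr
    refine (hvI.sub h1).congr (Eventually.of_forall fun x => ?_)
    simp [hg_z, sub_sub]
  have i1 : IntegrableOn (fun x => f (ε⁻¹ • x) (Dv x)) (hg_Q x0 ρ) := hg_integrable_f hf (inv_ne_zero hε.ne') hfin hDv
  have i2 : IntegrableOn (fun x => (1 - χ (ρ⁻¹ • (x - x0))) * (R + ‖Dv x‖)) (hg_Q x0 ρ) := by
    refine Integrable.bdd_mul (c := 1) ((integrable_const R).add hDv.norm) ?_ ?_
    · exact Continuous.aestronglyMeasurable (continuous_const.sub (hχ.continuous.comp (by fun_prop)))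
    · refine Eventually.of_forall fun x => ?_
      rw [Real.norm_eq_abs, abs_le]
      constructor <;> linarith [(hχ1 (ρ⁻¹ • (x - x0))).1, (hχ1 (ρ⁻¹ • (x - x0))).2]
  have i3 : ∀ a : ℝ, IntegrableOn (fun x => (if a ≤ ‖hg_z v s ξ x0 x‖ ∧ ‖hg_z v s ξ x0 x‖ < 2 * a then (1:ℝ) else 0) * (β * C * c * ‖Dv x‖)) (hg_Q x0 ρ) := by
    intro a
    refine Integrable.bdd_mul (c := 1) (hDv.norm.const_mul _) ?_ ?_
    · have hm : Measurable (fun r : ℝ => if a ≤ r ∧ r < 2 * a then (1:ℝ) else 0) :=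
        Measurable.ite (measurableSet_Ico (a := a) (b := 2 * a)) measurable_const measurable_const
      exact (hm.comp_aemeasurable hzI.norm.aestronglyMeasurable.aemeasurable).aestronglyMeasurable
    · refine Eventually.of_forall fun x => ?_
      split_ifs <;> simp
  set base : EN N → ℝ := fun x => f (ε⁻¹ • x) (Dv x) +
        L * ((1 - χ (ρ⁻¹ • (x - x0))) * (R + ‖Dv x‖) + ω * ‖Dv x‖) +
        (L * cχ * C + β * (1 + R + C * c * R + C * cχ)) * (‖hg_z v s ξ x0 x‖ / ρ) with hbase
  have ib : IntegrableOn base (hg_Q x0 ρ) :=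
    ((i1.add ((i2.add (hDv.norm.const_mul ω)).const_mul L)).add ((hzI.norm.div_const ρ).const_mul _))
  have hK' : (0:ℝ) < K := by exact_mod_cast hK
  set err := β * (1 + R) * ((ρ + 2 * ε) ^ N - ρ ^ N) with herr
  have step : ∀ i ∈ Finset.range K, ρ ^ N * Tfhom f M s ξ ≤ (∫ x in hg_Q x0 ρ, (base x
      + (if 2 ^ i * ρ ≤ ‖hg_z v s ξ x0 x‖ ∧ ‖hg_z v s ξ x0 x‖ < 2 * (2 ^ i * ρ) then 1 else 0) * (β * C * c * ‖Dv x‖))) + err := by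
    intro i hi
    have hi' := Finset.mem_range.1 hi
    have h2 : (2:ℝ) ^ i ≤ 2 ^ K := pow_le_pow_right₀ (by norm_num) hi'.le
    refine hg_local1 hf hR hΩ hb hv hvM hc0 hτ hτc hτ1 hτ2 hτ3 hχ hχc hχs hχ1 hcχ hs hξt hξ hε hρ ?_ hω ?_ hQ
    · exact le_mul_of_one_le_left hρ.le (one_le_pow₀ (by norm_num))
    · intro p hp
      refine hωG p (hp.trans ?_)
      have : (2:ℝ) ^ i * ρ ≤ 2 ^ K * ρ := by gcongr
      linarith
  have i4 : ∀ i ∈ Finset.range K, IntegrableOn (fun x => base x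
      + (if 2 ^ i * ρ ≤ ‖hg_z v s ξ x0 x‖ ∧ ‖hg_z v s ξ x0 x‖ < 2 * (2 ^ i * ρ) then 1 else 0) * (β * C * c * ‖Dv x‖)) (hg_Q x0 ρ) :=
    fun i _ => ib.add (i3 _)
  have hsum := Finset.sum_le_sum step
  rw [Finset.sum_const, Finset.card_range, nsmul_eq_mul, Finset.sum_add_distrib, Finset.sum_const, Finset.card_range,
    nsmul_eq_mul, ← integral_finsetSum _ i4] at hsum
  have hle : (∫ x in hg_Q x0 ρ, ∑ i ∈ Finset.range K, (base x
      + (if 2 ^ i * ρ ≤ ‖hg_z v s ξ x0 x‖ ∧ ‖hg_z v s ξ x0 x‖ < 2 * (2 ^ i * ρ) then 1 else 0) * (β * C * c * ‖Dv x‖)))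
      ≤ ∫ x in hg_Q x0 ρ, K * (base x + (β * C * c / K) * ‖Dv x‖) := by
    refine integral_mono (integrable_finsetSum _ i4) ((ib.add (hDv.norm.const_mul _)).const_mul _) fun x => ?_
    simp only
    rw [Finset.sum_add_distrib, Finset.sum_const, Finset.card_range, nsmul_eq_mul, ← Finset.sum_mul]
    have h1 := hg_dyadic_sum K hρ ‖hg_z v s ξ x0 x‖
    have h2 : (∑ i ∈ Finset.range K, (if 2 ^ i * ρ ≤ ‖hg_z v s ξ x0 x‖ ∧ ‖hg_z v s ξ x0 x‖ < 2 * (2 ^ i * ρ) then (1:ℝ) else 0)) * (β * C * c * ‖Dv x‖)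
        ≤ 1 * (β * C * c * ‖Dv x‖) := by gcongr
    have h3 : (K:ℝ) * ((β * C * c / K) * ‖Dv x‖) = β * C * c * ‖Dv x‖ := by field_simp
    linarith
  rw [integral_const_mul] at hle
  have h4 : ρ ^ N * Tfhom f M s ξ ≤ (∫ x in hg_Q x0 ρ, (base x + (β * C * c / K) * ‖Dv x‖)) + err := by
    have := hsum.trans (add_le_add hle le_rfl)
    rw [← mul_add] at this
    exact le_of_mul_le_mul_left this hK'
  have e2 := hg_Q_int x0 hρ 1 (fun x => base x + (β * C * c / K) * ‖Dv x‖)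
  rw [mul_one] at e2
  rw [e2] at h4
  have e3 : err = ρ ^ N * (β * (1 + R) * ((1 + 2 * (ε / ρ)) ^ N - 1)) := by
    have : ρ + 2 * ε = ρ * (1 + 2 * (ε / ρ)) := by field_simp
    rw [herr, this, mul_pow]; ring
  rw [e3, ← mul_add] at h4
  have h5 := le_of_mul_le_mul_left h4 (by positivity : 0 < ρ ^ N)
  refine h5.trans (le_of_eq ?_)
  congr 1
  refine integral_congr_ae (Eventually.of_forall fun y => ?_)
  simp only [hbase, add_sub_cancel_left, smul_smul, inv_mul_cancel₀ hρ.ne', one_smul]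

end

section
open MeasureTheory Filter Set
open scoped ENNReal RealInnerProductSpace Topology NNReal Pointwise

variable {N d : ℕ}

theorem hg_fub {F k : EN N → ℝ≥0∞} (hF : Measurable F) (hk : Measurable k) (ρ : ℝ) (S Y : Set (EN N)) :
    ∫⁻ x in S, ∫⁻ y in Y, F (x + ρ • y) * k y ≤ (∫⁻ x, F x) * ∫⁻ y in Y, k y := by
  rw [lintegral_lintegral_swap (by fun_prop), ← lintegral_const_mul _ hk]
  refine lintegral_mono fun y => ?_
  simp only
  rw [lintegral_mul_const _ (by fun_prop)]
  refine mul_le_mul_left ?_ _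
  calc ∫⁻ x in S, F (x + ρ • y) ≤ ∫⁻ x, F (x + ρ • y) := setLIntegral_le_lintegral _ _
    _ = ∫⁻ x, F x := lintegral_add_right_eq_self F _

theorem hg_int_abs {T Fa Fb k : EN N → ℝ≥0∞} {W : EN N → EN N → ℝ≥0∞} (hFa : Measurable Fa) (hFb : Measurable Fb)
    (hk : Measurable k) (hW : Measurable (Function.uncurry W)) (ρ : ℝ) (S : Set (EN N)) (e : ℝ≥0∞)
    (h : ∀ᵐ x ∂(volume.restrict S), T x ≤ (∫⁻ y in posCube N 1, (Fa (x + ρ • y) + Fb (x + ρ • y) * k y + W x y)) + e) :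
    ∫⁻ x in S, T x ≤ (∫⁻ x, Fa x) + (∫⁻ x, Fb x) * (∫⁻ y in posCube N 1, k y) +
      (∫⁻ y in posCube N 1, ∫⁻ x, W x y) + e * volume S := by
  have hv : volume (posCube N 1) = 1 := by simp [hg_volume_posCube]
  refine (lintegral_mono_ae h).trans ?_
  rw [lintegral_add_right _ measurable_const, setLIntegral_const]
  gcongr
  have m1 : Measurable (fun x => ∫⁻ y in posCube N 1, Fa (x + ρ • y)) :=
    Measurable.lintegral_prod_right' (f := fun p : EN N × EN N => Fa (p.1 + ρ • p.2)) (by fun_prop)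
  have m2 : Measurable (fun x => ∫⁻ y in posCube N 1, Fb (x + ρ • y) * k y) :=
    Measurable.lintegral_prod_right' (f := fun p : EN N × EN N => Fb (p.1 + ρ • p.2) * k p.2) (by fun_prop)
  have : ∀ x, ∫⁻ y in posCube N 1, (Fa (x + ρ • y) + Fb (x + ρ • y) * k y + W x y) =
      (∫⁻ y in posCube N 1, Fa (x + ρ • y)) + (∫⁻ y in posCube N 1, Fb (x + ρ • y) * k y) + ∫⁻ y in posCube N 1, W x y := by
    intro x
    rw [lintegral_add_left (by fun_prop), lintegral_add_left (by fun_prop)]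
  simp only [this]
  have m3 : Measurable (fun x => (∫⁻ y in posCube N 1, Fa (x + ρ • y)) + ∫⁻ y in posCube N 1, Fb (x + ρ • y) * k y) := m1.add m2
  rw [lintegral_add_left m3, lintegral_add_left m1]
  refine add_le_add (add_le_add ?_ ?_) ?_
  · have := hg_fub hFa (measurable_const (a := (1:ℝ≥0∞))) ρ S (posCube N 1)
    simpa [hv] using this
  · exact hg_fub hFb hk ρ S _
  · rw [lintegral_lintegral_swap hW.aemeasurable]
    exact lintegral_mono fun y => setLIntegral_le_lintegral _ _

theorem hg_posCube_one_norm {y : EN N} (h : y ∈ posCube N 1) : ‖y‖ ≤ N := by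
  have := hg_norm_posCube h
  simpa using this

theorem hg_L1diff' {w : EN N → EN d} {Dw : EN N → Mat d N} (hw : MemW11 univ w Dw) {η ρ c : ℝ} (hη : 0 ≤ η) (hρ : 0 < ρ) (hc : 0 ≤ c)
    (h : ∀ y ∈ posCube N 1, ∫ x, ‖w (x + ρ • y) - w x - Dw x (ρ • y)‖ ≤ η * ‖ρ • y‖) 
    {w' : EN N → EN d} {Dw' : EN N → Mat d N} (e1 : w =ᵐ[volume] w') (e2 : Dw =ᵐ[volume] Dw') :
    ∫⁻ y in posCube N 1, ∫⁻ x, ENNReal.ofReal (c / ρ * ‖w' (x + ρ • y) - w' x - Dw' x (ρ • y)‖) ≤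
      ENNReal.ofReal (c * (η * N)) := by
  have hv : volume (posCube N 1) = 1 := by simp [hg_volume_posCube]
  have hw1 := hw.1; have hw2 := hw.2.1
  rw [integrableOn_univ] at hw1 hw2
  calc _ ≤ ∫⁻ y in posCube N 1, ENNReal.ofReal (c * (η * N)) := by
        refine setLIntegral_mono' (hg_measurableSet_posCube N 1) fun y hy => ?_
        have h1 : ∀ᵐ x, w (x + ρ • y) = w' (x + ρ • y) := by
          have := hg_ae_scale e1 one_ne_zero (ρ • y)
          simpa using this
        have h2 : ∫⁻ x, ENNReal.ofReal (c / ρ * ‖w' (x + ρ • y) - w' x - Dw' x (ρ • y)‖) =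
            ∫⁻ x, ENNReal.ofReal (c / ρ * ‖w (x + ρ • y) - w x - Dw x (ρ • y)‖) := by
          refine lintegral_congr_ae ?_
          filter_upwards [h1, e1, e2] with x a1 a2 a3
          rw [a1, a2, a3]
        have hi : Integrable (fun x => w (x + ρ • y) - w x - Dw x (ρ • y)) := by
          refine ((hw1.comp_add_right (ρ • y)).sub hw1).sub ?_
          exact (ContinuousLinearMap.apply ℝ (EN d) (ρ • y)).integrable_comp hw2
        rw [h2, ← ofReal_integral_eq_lintegral_ofReal (hi.norm.const_mul _) (Eventually.of_forall fun x => by positivity),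
          integral_const_mul]
        refine ENNReal.ofReal_le_ofReal ?_
        have h3 := h y hy
        have h4 := hg_posCube_one_norm hy
        calc c / ρ * _ ≤ c / ρ * (η * ‖ρ • y‖) := by gcongr
          _ = c * (η * ‖y‖) := by rw [norm_smul, Real.norm_of_nonneg hρ.le]; field_simp
          _ ≤ _ := by gcongr
    _ = _ := by simp [hv]

end

section
open MeasureTheory Filter Set
open scoped ENNReal RealInnerProductSpace Topology NNReal Pointwise

variable {N d : ℕ}

theorem hg_ofReal_int_le {μ : Measure (EN N)} {g : EN N → ℝ} (h : ∀ x, 0 ≤ g x) :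
    ENNReal.ofReal (∫ x, g x ∂μ) ≤ ∫⁻ x, ENNReal.ofReal (g x) ∂μ := by
  have h1 := enorm_integral_le_lintegral_enorm (μ := μ) g
  rw [Real.enorm_of_nonneg (integral_nonneg h)] at h1
  refine h1.trans (le_of_eq (lintegral_congr fun x => Real.enorm_of_nonneg (h x)))

set_option maxHeartbeats 2000000 in
theorem hg_integrated {f : EN N → Mat d N → ℝ} {α β L : ℝ} (hf : StdIntegrand N d f α β L)
    {M : Set (EN d)} {G : EN d → EN d} {δ C : ℝ} (hR : hg_Ret M G δ C)
    {Ω : Set (EN N)} (hΩ : IsOpen Ω) (hb : Bornology.IsBounded Ω)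
    {u : EN N → EN d} {Du : EN N → Mat d N} (hu : MemW11 Ω u Du) (huM : AeIn Ω u M)
    {v : EN N → EN d} {Dv : EN N → Mat d N} (hv : MemW11 Ω v Dv) (hvM : AeIn Ω v M)
    {τ : EN d → EN d} {c : ℝ} (hc0 : 0 ≤ c) (hτ : ContDiff ℝ 1 τ) (hτc : ∀ z, ‖fderiv ℝ τ z‖ ≤ c)
    (hτ1 : ∀ z, ‖z‖ ≤ 1 → τ =ᶠ[𝓝 z] id) (hτ2 : ∀ z, 2 ≤ ‖z‖ → τ =ᶠ[𝓝 z] fun _ => 0)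
    (hτ3 : ∀ z, ‖τ z‖ ≤ ‖z‖)
    {χ : EN N → ℝ} (hχ : ContDiff ℝ (⊤ : ℕ∞) χ) (hχc : HasCompactSupport χ) (hχs : tsupport χ ⊆ posCube N 1)
    (hχ1 : ∀ x, 0 ≤ χ x ∧ χ x ≤ 1) {cχ : ℝ} (hcχ : ∀ x, ‖fderiv ℝ χ x‖ ≤ cχ)
    {R : ℝ} (hR0 : 0 ≤ R) {ε ρ ω η : ℝ} {K : ℕ} (hK : 0 < K) (hε : 0 < ε) (hρ : 0 < ρ) (hω : 0 ≤ ω) (hη : 0 ≤ η)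
    (hωG : ∀ p q, ‖p - q‖ ≤ (2 ^ K + R * N) * ρ → ‖fderiv ℝ G p - fderiv ℝ G q‖ ≤ ω)
    {S : Set (EN N)} (hSm : MeasurableSet S) (hSΩ : S ⊆ Ω) (hSR : ∀ᵐ x ∂(volume.restrict S), ‖Du x‖ ≤ R)
    (hQ : ∀ x ∈ S, hg_Q x ρ ⊆ Ω)
    {w : EN N → EN d} {Dw : EN N → Mat d N} (hw : MemW11 univ w Dw)
    (hwu : ∀ x ∈ S, w x = u x ∧ Dw x = Du x ∧ ∀ y ∈ hg_Q x ρ, w y = u y)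
    (hwη : ∀ y ∈ posCube N 1, ∫ x, ‖w (x + ρ • y) - w x - Dw x (ρ • y)‖ ≤ η * ‖ρ • y‖) :
    ∫⁻ x in S, ENNReal.ofReal (Tfhom f M (u x) (Du x)) ≤
      ENNReal.ofReal ((∫ x in Ω, f (ε⁻¹ • x) (Dv x)) + (L * ω + β * C * c / K) * (∫ x in Ω, ‖Dv x‖)
        + (L * cχ * C + β * (1 + R + C * c * R + C * cχ)) / ρ * ∫ x in Ω, ‖v x - u x‖)
      + ENNReal.ofReal (L * (R * volume.real Ω + ∫ x in Ω, ‖Dv x‖)) * ENNReal.ofReal (∫ y in posCube N 1, (1 - χ y))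
      + ENNReal.ofReal ((L * cχ * C + β * (1 + R + C * c * R + C * cχ)) * (η * N))
      + ENNReal.ofReal (β * (1 + R) * ((1 + 2 * (ε / ρ)) ^ N - 1)) * volume S := by
  have hβ := hg_beta_pos hf
  have hL := hf.lip_pos
  have hC0 : 0 ≤ C := zero_le_one.trans hR.C1
  have hcχ0 : 0 ≤ cχ := (norm_nonneg _).trans (hcχ 0)
  have hfin : volume Ω ≠ ⊤ := hb.measure_lt_top.ne
  have : IsFiniteMeasure (volume.restrict Ω) := ⟨by simpa using hfin.lt_top⟩
  have hK' : (0:ℝ) < K := by exact_mod_cast hK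
  set C1 := L * cχ * C + β * (1 + R + C * c * R + C * cχ) with hC1
  have hC1p : 0 ≤ C1 := by positivity
  set C2 := β * C * c / K with hC2
  have hC2p : 0 ≤ C2 := by positivity
  have hDv := hv.2.1
  have if1 : IntegrableOn (fun x => f (ε⁻¹ • x) (Dv x)) Ω := hg_integrable_f hf (inv_ne_zero hε.ne') hfin hDv
  have ivu : IntegrableOn (fun x => v x - u x) Ω := hv.1.sub hu.1
  set ga : EN N → ℝ := fun x => f (ε⁻¹ • x) (Dv x) + (L * ω + C2) * ‖Dv x‖ + C1 / ρ * ‖v x - u x‖ with hga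
  set gb : EN N → ℝ := fun x => L * (R + ‖Dv x‖) with hgb
  have iga : IntegrableOn ga Ω := (if1.add (hDv.norm.const_mul _)).add (ivu.norm.const_mul _)
  have igb : IntegrableOn gb Ω := ((integrable_const R).add hDv.norm).const_mul L
  have ga0 : ∀ x, 0 ≤ ga x := fun x => by have := hf.nonneg (ε⁻¹ • x) (Dv x); positivity
  have gb0 : ∀ x, 0 ≤ gb x := fun x => by positivity
  set Fa : EN N → ℝ≥0∞ := Ω.indicator (fun x => ENNReal.ofReal (ga x)) with hFa
  set Fb : EN N → ℝ≥0∞ := Ω.indicator (fun x => ENNReal.ofReal (gb x)) with hFb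
  have mFa : AEMeasurable Fa := (aemeasurable_indicator_iff hΩ.measurableSet).2 iga.aestronglyMeasurable.aemeasurable.ennreal_ofReal
  have mFb : AEMeasurable Fb := (aemeasurable_indicator_iff hΩ.measurableSet).2 igb.aestronglyMeasurable.aemeasurable.ennreal_ofReal
  have hw1 := hw.1; have hw2 := hw.2.1
  rw [integrableOn_univ] at hw1 hw2
  obtain ⟨w', mw', ew⟩ := hw1.aestronglyMeasurable
  obtain ⟨Dw', mDw', eDw⟩ := hw2.aestronglyMeasurable
  have mw := mw'.measurable
  have mDw := mDw'.measurable
  set W : EN N → EN N → ℝ≥0∞ := fun x y => ENNReal.ofReal (C1 / ρ * ‖w' (x + ρ • y) - w' x - Dw' x (ρ • y)‖) with hW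
  have mW : Measurable (Function.uncurry W) := by
    have : Measurable (fun p : EN N × EN N => Dw' p.1 (ρ • p.2)) := by
      have h1 : Continuous (fun q : Mat d N × EN N => q.1 q.2) := by fun_prop
      exact h1.measurable.comp ((mDw.comp measurable_fst).prodMk (measurable_snd.const_smul ρ))
    simp only [Function.uncurry_def, hW]
    refine ENNReal.measurable_ofReal.comp (Measurable.const_mul ?_ _)
    exact (((mw.comp (by fun_prop)).sub (mw.comp measurable_fst)).sub this).norm
  have mk : Measurable (fun y => ENNReal.ofReal (1 - χ y)) :=
    (ENNReal.continuous_ofReal.comp (continuous_const.sub hχ.continuous)).measurable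
  have key := hg_int_abs (T := fun x => ENNReal.ofReal (Tfhom f M (u x) (Du x))) mFa.measurable_mk mFb.measurable_mk mk mW ρ S
    (ENNReal.ofReal (β * (1 + R) * ((1 + 2 * (ε / ρ)) ^ N - 1))) ?_
  · refine key.trans ?_
    refine add_le_add (add_le_add (add_le_add ?_ ?_) ?_) le_rfl
    · rw [← lintegral_congr_ae mFa.ae_eq_mk, hFa, lintegral_indicator hΩ.measurableSet,
        ← ofReal_integral_eq_lintegral_ofReal iga (Eventually.of_forall ga0)]
      refine ENNReal.ofReal_le_ofReal (le_of_eq ?_)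
      have i1 : IntegrableOn (fun x => f (ε⁻¹ • x) (Dv x) + (L * ω + C2) * ‖Dv x‖) Ω := if1.add (hDv.norm.const_mul _)
      have i2 : IntegrableOn (fun x => (L * ω + C2) * ‖Dv x‖) Ω := hDv.norm.const_mul _
      have i3 : IntegrableOn (fun x => C1 / ρ * ‖v x - u x‖) Ω := ivu.norm.const_mul _
      rw [hga, integral_add i1 i3, integral_add if1 i2, integral_const_mul, integral_const_mul]
    · refine mul_le_mul' (le_of_eq ?_) (le_of_eq ?_)
      · rw [← lintegral_congr_ae mFb.ae_eq_mk, hFb, lintegral_indicator hΩ.measurableSet,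
          ← ofReal_integral_eq_lintegral_ofReal igb (Eventually.of_forall gb0), hgb, integral_const_mul,
          integral_add (integrable_const R) hDv.norm]
        simp [mul_comm]
      · rw [← ofReal_integral_eq_lintegral_ofReal]
        · refine IntegrableOn.of_bound (hg_volume_posCube_ne_top N 1).lt_top (continuous_const.sub hχ.continuous).aestronglyMeasurable 1
            (Eventually.of_forall fun x => ?_)
          rw [Real.norm_eq_abs, abs_le]
          constructor <;> linarith [(hχ1 x).1, (hχ1 x).2]
        · exact Eventually.of_forall fun x => sub_nonneg.2 (hχ1 x).2
    · exact hg_L1diff' hw hη hρ hC1p hwη ew eDw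
  · have g3 := ae_restrict_of_ae_restrict_of_subset hSΩ (hR.grad_tan hΩ hb hu huM)
    have g4 := ae_restrict_of_ae_restrict_of_subset hSΩ huM
    filter_upwards [hSR, g3, g4, ae_restrict_mem hSm, ae_restrict_of_ae ew, ae_restrict_of_ae eDw] with x0 k2 k3 k4 k5 k6 k7
    have hloc := hg_local hf hR hΩ hb hv hvM hc0 hτ hτc hτ1 hτ2 hτ3 hχ hχc hχs hχ1 hcχ k4 k3 k2 hK hε hρ hω
      (fun p => hωG p _) (hQ x0 k5)
    refine (ENNReal.ofReal_le_ofReal hloc).trans (ENNReal.ofReal_add_le.trans ?_)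
    gcongr
    refine (hg_ofReal_int_le fun y => ?_).trans ?_
    · have := hf.nonneg (ε⁻¹ • (x0 + ρ • y)) (Dv (x0 + ρ • y))
      have h2 := sub_nonneg.2 (hχ1 y).2
      positivity
    · have sc : ∀ {p : EN N → Prop}, (∀ᵐ x, p x) → ∀ᵐ y, p (x0 + ρ • y) := fun h => by
        have := hg_ae_scale h hρ.ne' x0
        simpa [add_comm] using this
      refine lintegral_mono_ae ?_
      filter_upwards [ae_restrict_of_ae (sc mFa.ae_eq_mk), ae_restrict_of_ae (sc mFb.ae_eq_mk), ae_restrict_of_ae (sc ew),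
        ae_restrict_mem (hg_measurableSet_posCube N 1)] with y j1 j2 j3 j4
      have hyQ : x0 + ρ • y ∈ hg_Q x0 ρ := by
        intro i
        have := j4 i
        simp only [add_sub_cancel_left, PiLp.smul_apply, smul_eq_mul, mem_Ioo] at this ⊢
        exact ⟨mul_pos hρ this.1, by nlinarith⟩
      have hyΩ := hQ x0 k5 hyQ
      obtain ⟨q1, q2, q3⟩ := hwu x0 k5
      rw [← j1, ← j2, hFa, hFb, indicator_of_mem hyΩ, indicator_of_mem hyΩ]
      simp only [hW]
      rw [← k6, ← k7, ← j3, q1, q2, q3 _ hyQ]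
      have h2 := sub_nonneg.2 (hχ1 y).2
      rw [← ENNReal.ofReal_mul (gb0 _), ← ENNReal.ofReal_add (ga0 _) (mul_nonneg (gb0 _) h2),
        ← ENNReal.ofReal_add (add_nonneg (ga0 _) (mul_nonneg (gb0 _) h2)) (by positivity)]
      refine ENNReal.ofReal_le_ofReal ?_
      have hz : ‖hg_z v (u x0) (Du x0) x0 (x0 + ρ • y)‖ ≤ ‖v (x0 + ρ • y) - u (x0 + ρ • y)‖ +
          ‖u (x0 + ρ • y) - u x0 - Du x0 (ρ • y)‖ := by
        refine le_trans (le_of_eq ?_) (norm_add_le _ _)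
        congr 1
        simp only [hg_z, add_sub_cancel_left]
        abel
      have hz2 : C1 * (‖hg_z v (u x0) (Du x0) x0 (x0 + ρ • y)‖ / ρ) ≤ C1 / ρ * (‖v (x0 + ρ • y) - u (x0 + ρ • y)‖ +
          ‖u (x0 + ρ • y) - u x0 - Du x0 (ρ • y)‖) := by
        rw [mul_div_assoc', div_mul_eq_mul_div]
        gcongr
      simp only [hga, hgb]
      linarith

end

section
open MeasureTheory Filter Set
open scoped ENNReal RealInnerProductSpace Topology NNReal Pointwise

variable {N d : ℕ}

/-- points at distance at least r from the complement -/
def hg_in (Ω : Set (EN N)) (r : ℝ) : Set (EN N) := (Metric.thickening r Ωᶜ)ᶜ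

theorem hg_in_closed (Ω : Set (EN N)) (r : ℝ) : IsClosed (hg_in Ω r) := Metric.isOpen_thickening.isClosed_compl

theorem hg_in_sub (Ω : Set (EN N)) {r : ℝ} (hr : 0 < r) : hg_in Ω r ⊆ Ω := by
  intro x hx
  by_contra h
  exact hx (Metric.self_subset_thickening hr _ h)

theorem hg_in_near {Ω : Set (EN N)} {r : ℝ} {x y : EN N} (hx : x ∈ hg_in Ω r) (hy : ‖y - x‖ < r / 2) : y ∈ hg_in Ω (r / 2) := by
  intro h
  rw [Metric.mem_thickening_iff] at h
  obtain ⟨z, hz, hzy⟩ := h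
  refine hx (Metric.mem_thickening_iff.2 ⟨z, hz, ?_⟩)
  have := dist_triangle x y z
  rw [dist_comm x y, dist_eq_norm y x] at this
  linarith

theorem hg_exhaust {Ω : Set (EN N)} (hΩ : IsOpen Ω) {T : EN N → ℝ} (hT : IntegrableOn T Ω)
    {Du : EN N → Mat d N} (hDu : AEStronglyMeasurable Du (volume.restrict Ω)) {θ : ℝ} (hθ : 0 < θ) :
    ∃ (r R : ℝ) (S : Set (EN N)), 0 < r ∧ 0 ≤ R ∧ MeasurableSet S ∧ S ⊆ hg_in Ω r ∧ (∀ᵐ x ∂(volume.restrict S), ‖Du x‖ ≤ R) ∧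
      ∫ x in Ω, T x ≤ (∫ x in S, T x) + θ := by
  obtain ⟨D', mD, eD⟩ := hDu
  set S : ℕ → Set (EN N) := fun n => hg_in Ω (1 / ((n:ℝ) + 1)) ∩ {x | ‖D' x‖ ≤ n}
  have hp : ∀ n : ℕ, (0:ℝ) < 1 / ((n:ℝ) + 1) := fun n => by positivity
  have hSm : ∀ n, MeasurableSet (S n) := fun n => (hg_in_closed _ _).measurableSet.inter
    (measurableSet_le mD.norm.measurable measurable_const)
  have hmono : Monotone S := by
    intro n m hnm
    have h1 : (n:ℝ) ≤ m := by exact_mod_cast hnm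
    refine inter_subset_inter (compl_subset_compl.2 (Metric.thickening_mono ?_ _)) fun x hx => ?_
    · gcongr
    · exact le_trans hx h1
  have hU : ⋃ n, S n = Ω := by
    refine subset_antisymm (iUnion_subset fun n => inter_subset_left.trans (hg_in_sub Ω (hp n))) fun x hx => ?_
    obtain ⟨δ, hδ, hb⟩ := Metric.isOpen_iff.1 hΩ x hx
    obtain ⟨n, hn⟩ := exists_nat_gt (max ‖D' x‖ δ⁻¹)
    refine mem_iUnion.2 ⟨n, ?_, ?_⟩
    · intro h
      obtain ⟨z, hz, hzx⟩ := Metric.mem_thickening_iff.1 h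
      refine hz (hb ?_)
      rw [Metric.mem_ball, dist_comm]
      refine hzx.trans_le ?_
      rw [div_le_iff₀ (by positivity)]
      have h1 : δ⁻¹ < n := (le_max_right _ _).trans_lt hn
      rw [inv_lt_iff_one_lt_mul₀ hδ] at h1
      linarith
    · exact ((le_max_left _ _).trans_lt hn).le
  have ht := tendsto_setIntegral_of_monotone (μ := volume) (f := T) hSm hmono (by rwa [hU])
  rw [hU] at ht
  obtain ⟨n, hn⟩ := (ht.eventually (lt_mem_nhds (show (∫ x in Ω, T x) - θ < ∫ x in Ω, T x by linarith))).exists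
  refine ⟨1 / ((n:ℝ) + 1), n, S n, hp n, by positivity, hSm n, inter_subset_left, ?_, by linarith⟩
  have hsub : S n ⊆ Ω := inter_subset_left.trans (hg_in_sub Ω (hp n))
  filter_upwards [ae_restrict_mem (hSm n), ae_restrict_of_ae_restrict_of_subset hsub eD] with x h1 h2
  rw [h2]; exact h1.2

theorem hg_chi_exists (N : ℕ) {κ : ℝ} (hκ : 0 < κ) : ∃ χ : EN N → ℝ, ContDiff ℝ (⊤ : ℕ∞) χ ∧ HasCompactSupport χ ∧
    tsupport χ ⊆ posCube N 1 ∧ (∀ x, 0 ≤ χ x ∧ χ x ≤ 1) ∧ (∃ c, ∀ x, ‖fderiv ℝ χ x‖ ≤ c) ∧ 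
    ∫ y in posCube N 1, (1 - χ y) ≤ κ := by
  have hY := hg_measurableSet_posCube N 1
  have hYt := hg_volume_posCube_ne_top N 1
  obtain ⟨K, hKs, hKc, hK⟩ := hY.exists_isCompact_sdiff_lt hYt (ε := ENNReal.ofReal κ) (by simpa using hκ)
  obtain ⟨χ, h1, h2, h3, h4, h5⟩ := hg_cutoff hKc (hg_isOpen_posCube N 1) hKs
  refine ⟨χ, h1, h2, h3, h4, (h1.continuous_fderiv (by simp)).bounded_above_of_compact_support (h2.fderiv ℝ), ?_⟩
  have hχK : ∀ x ∈ K, χ x = 1 := fun x hx => by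
    have := h5.filter_mono (nhds_le_nhdsSet hx)
    exact this.self_of_nhds
  have : IsFiniteMeasure (volume.restrict (posCube N 1)) := ⟨by simpa using hYt.lt_top⟩
  calc ∫ y in posCube N 1, (1 - χ y) ≤ ∫ y in posCube N 1, (posCube N 1 \ K).indicator (fun _ => (1:ℝ)) y := by
        refine setIntegral_mono_on ?_ ?_ hY ?_
        · refine Integrable.of_bound (continuous_const.sub h1.continuous).aestronglyMeasurable 1
            (Eventually.of_forall fun x => ?_)
          rw [Real.norm_eq_abs, abs_le]
          constructor <;> linarith [(h4 x).1, (h4 x).2]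
        · exact (integrable_const (1:ℝ)).indicator (hY.diff hKc.measurableSet)
        · intro x hx
          by_cases hxK : x ∈ K
          · simp [hχK x hxK, hxK]
          · rw [indicator_of_mem (show x ∈ posCube N 1 \ K from ⟨hx, hxK⟩)]; linarith [(h4 x).1]
    _ = volume.real (posCube N 1 \ K) := by
        rw [show (fun _ : EN N => (1:ℝ)) = 1 from rfl, integral_indicator_one (hY.diff hKc.measurableSet), measureReal_restrict_apply (hY.diff hKc.measurableSet),
          inter_eq_left.2 sdiff_subset]
    _ ≤ κ := by
        rw [Measure.real]
        exact ENNReal.toReal_le_of_le_ofReal hκ.le hK.le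

end

section
open MeasureTheory Filter Set
open scoped ENNReal RealInnerProductSpace Topology NNReal Pointwise

variable {N d : ℕ}

set_option maxHeartbeats 2000000 in
theorem hg_lower_pre {f : EN N → Mat d N → ℝ} {α β L : ℝ} (hf : StdIntegrand N d f α β L)
    {M : Set (EN d)} {G : EN d → EN d} {δ C : ℝ} (hR : hg_Ret M G δ C)
    {Ω : Set (EN N)} (hΩ : IsOpen Ω) (hb : Bornology.IsBounded Ω)
    {u : EN N → EN d} {Du : EN N → Mat d N} (hu : MemW11 Ω u Du) (huM : AeIn Ω u M) {θ : ℝ} (hθ : 0 < θ) :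
    ∃ σ > 0, ∀ᶠ ε in 𝓝[>] (0:ℝ), ∀ (v : EN N → EN d) (Dv : EN N → Mat d N), MemW11 Ω v Dv → AeIn Ω v M →
      ∫ x in Ω, ‖v x - u x‖ < σ →
      ∫ x in Ω, Tfhom f M (u x) (Du x) ≤ (1 + 3 * θ) * (∫ x in Ω, f (ε⁻¹ • x) (Dv x)) + 5 * θ := by
  have hβ := hg_beta_pos hf
  have hL := hf.lip_pos
  have hα := hf.alpha_pos
  have hC0 : 0 ≤ C := zero_le_one.trans hR.C1
  have hfin : volume Ω ≠ ⊤ := hb.measure_lt_top.ne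
  have hfinR : IsFiniteMeasure (volume.restrict Ω) := ⟨by simpa using hfin.lt_top⟩
  have hT := hg_Tfhom_integrable hf hR hfin hu huM
  obtain ⟨r, R, S, hr, hR0, hSm, hSr, hSR, hST⟩ := hg_exhaust hΩ hT hu.2.1.aestronglyMeasurable hθ
  have hSΩ : S ⊆ Ω := hSr.trans (hg_in_sub Ω hr)
  obtain ⟨τ, c, hc0, hτ, hτc, hτ1, hτ2, hτ3⟩ := hg_tau_exists d
  set V := volume.real Ω with hV
  have hV0 : 0 ≤ V := measureReal_nonneg
  -- the cutoff in the cell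
  set κ := min (θ * α / L) (θ / (L * (R * V) + 1)) with hκ
  have hκp : 0 < κ := by positivity
  obtain ⟨χ, hχ, hχc, hχs, hχ1, ⟨cχ, hcχ⟩, hχκ⟩ := hg_chi_exists N hκp
  have hcχ0 : 0 ≤ cχ := (norm_nonneg _).trans (hcχ 0)
  have hκ1 : L * κ ≤ θ * α := by
    have : κ ≤ θ * α / L := min_le_left _ _
    rw [le_div_iff₀ hL] at this; linarith
  have hκ2 : L * (R * V) * κ ≤ θ := by
    have h1 : κ ≤ θ / (L * (R * V) + 1) := min_le_right _ _
    have h0 : 0 ≤ L * (R * V) := by positivity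
    rw [le_div_iff₀ (by positivity)] at h1
    linarith
  obtain ⟨K0, hK0⟩ := exists_nat_gt (β * C * c / (θ * α))
  set K := K0 + 1 with hKdef
  have hK : 0 < K := Nat.succ_pos _
  have hK' : (0:ℝ) < K := by exact_mod_cast hK
  have hKC : β * C * c / K ≤ θ * α := by
    rw [div_lt_iff₀ (by positivity)] at hK0
    rw [div_le_iff₀ hK']
    have : (K:ℝ) = K0 + 1 := by simp [hKdef]
    rw [this]
    have : 0 < θ * α := by positivity
    linarith
  set C1 := L * cχ * C + β * (1 + R + C * c * R + C * cχ) with hC1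
  have hC1p : 0 ≤ C1 := by positivity
  set η := θ / (C1 * N + 1) with hη
  have hηp : 0 < η := by positivity
  have hηC : C1 * (η * N) ≤ θ := by
    have h1 : η * (C1 * N + 1) = θ := div_mul_cancel₀ _ (by positivity)
    linarith
  -- the global extension
  have hKc : IsCompact (hg_in Ω (r / 2)) := Metric.isCompact_of_isClosed_isBounded (hg_in_closed _ _)
    (hb.subset (hg_in_sub Ω (half_pos hr)))
  obtain ⟨ζ, hζ1, hζ2, hζ3, hζ4, hζ5⟩ := hg_cutoff hKc hΩ (hg_in_sub Ω (half_pos hr))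
  have hζK : ∀ x ∈ hg_in Ω (r / 2), ζ =ᶠ[𝓝 x] fun _ => 1 := fun x hx => hζ5.filter_mono (nhds_le_nhdsSet hx)
  have hw := hg_cut hΩ.measurableSet hu hζ1 hζ2 hζ3
  obtain ⟨δ1, hδ1, hδ1'⟩ := hg_L1diff hw hηp
  set ω := θ * α / L with hω
  have hωp : 0 < ω := by positivity
  obtain ⟨δ2, hδ2, hδ2'⟩ := Metric.uniformContinuous_iff.1 hR.uc ω hωp
  set m := min δ1 (min δ2 (r / 2)) with hm
  have hmp : 0 < m := by positivity
  set B : ℝ := N + 2 ^ K + R * N with hB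
  have hBp : 0 < B := by positivity
  set ρ := m / (B + 1) with hρ
  have hρp : 0 < ρ := by positivity
  have hBρ : B * ρ < m := by
    have h1 : ρ * (B + 1) = m := div_mul_cancel₀ _ (by positivity)
    linarith
  have hNρ : N * ρ < m := by
    have h1 : (0:ℝ) ≤ (2 ^ K + R * N) * ρ := by positivity
    rw [hB] at hBρ; linarith
  have hKρ : (2 ^ K + R * N) * ρ < m := by
    have h1 : (0:ℝ) ≤ N * ρ := by positivity
    rw [hB] at hBρ; linarith
  have hmd1 : m ≤ δ1 := min_le_left _ _
  have hmd2 : m ≤ δ2 := (min_le_right _ _).trans (min_le_left _ _)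
  have hmd3 : m ≤ r / 2 := (min_le_right _ _).trans (min_le_right _ _)
  have hQin : ∀ x ∈ S, hg_Q x ρ ⊆ hg_in Ω (r / 2) := by
    intro x hx y hy
    refine hg_in_near (hSr hx) ?_
    have := hg_norm_posCube hy
    linarith
  have hSin : ∀ x ∈ S, x ∈ hg_in Ω (r / 2) := fun x hx => hg_in_near (hSr hx) (by simpa using hr)
  refine ⟨θ / (C1 / ρ + 1), by positivity, ?_⟩
  have hlim : Tendsto (fun ε : ℝ => β * (1 + R) * ((1 + 2 * (ε / ρ)) ^ N - 1) * V) (𝓝[>] 0) (𝓝 0) := by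
    have : Continuous (fun ε : ℝ => β * (1 + R) * ((1 + 2 * (ε / ρ)) ^ N - 1) * V) := by fun_prop
    have := (this.tendsto 0).mono_left (nhdsWithin_le_nhds (s := Ioi 0))
    simpa using this
  filter_upwards [hlim.eventually_lt_const hθ, self_mem_nhdsWithin] with ε hεθ hε v Dv hv hvM hvσ
  have hε : 0 < ε := hε
  have key := hg_integrated hf hR hΩ hb hu huM hv hvM hc0 hτ hτc hτ1 hτ2 hτ3 hχ hχc hχs hχ1 hcχ hR0 hK hε hρp hωp.le hηp.le
    (fun p q hpq => by
      have := hδ2' (a := p) (b := q) (by rw [dist_eq_norm]; linarith)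
      rw [dist_eq_norm] at this
      exact this.le) hSm hSΩ hSR (fun x hx => (hQin x hx).trans (hg_in_sub Ω (half_pos hr))) hw
    (fun x hx => by
      have h1 := hζK x (hSin x hx)
      refine ⟨?_, ?_, fun y hy => ?_⟩
      · simp [h1.self_of_nhds]
      · simp [h1.self_of_nhds, h1.fderiv_eq]
      · simp [(hζK y (hQin x hx hy)).self_of_nhds])
    (fun y hy => by
      refine hδ1' _ ?_
      rw [norm_smul, Real.norm_of_nonneg hρp.le]
      have := hg_posCube_one_norm hy
      have : ρ * ‖y‖ ≤ ρ * N := by gcongr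
      linarith)
  set I := ∫ x in Ω, ‖Dv x‖ with hI
  have hI0 : 0 ≤ I := integral_nonneg fun x => norm_nonneg _
  set E := ∫ x in Ω, f (ε⁻¹ • x) (Dv x) with hE
  have hαI : α * I ≤ E := by
    rw [hI, ← integral_const_mul]
    refine integral_mono_ae (hv.2.1.norm.const_mul _) (hg_integrable_f hf (inv_ne_zero hε.ne') hfin hv.2.1) ?_
    filter_upwards [ae_restrict_of_ae (hg_ae_scale' hf.growth (inv_ne_zero hε.ne'))] with x hx
    exact (hx _).1
  have hE0 : 0 ≤ E := le_trans (by positivity) hαI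
  set J := ∫ x in Ω, ‖v x - u x‖ with hJ
  have hσ : C1 / ρ * J ≤ θ := by
    have hJ0 : 0 ≤ J := integral_nonneg fun x => norm_nonneg _
    rw [lt_div_iff₀ (by positivity)] at hvσ
    linarith
  have hχκ0 : 0 ≤ ∫ y in posCube N 1, (1 - χ y) := integral_nonneg fun y => sub_nonneg.2 (hχ1 y).2
  have hpow0 : 0 ≤ β * (1 + R) * ((1 + 2 * (ε / ρ)) ^ N - 1) := by
    have : (1:ℝ) ≤ (1 + 2 * (ε / ρ)) ^ N := one_le_pow₀ (by linarith [div_pos hε hρp])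
    have := sub_nonneg.2 this
    positivity
  have hSV : volume S ≤ ENNReal.ofReal V := by
    rw [hV, ofReal_measureReal hfin]
    exact measure_mono hSΩ
  have key2 : ∫⁻ x in S, ENNReal.ofReal (Tfhom f M (u x) (Du x)) ≤ ENNReal.ofReal ((1 + 3 * θ) * E + 4 * θ) := by
    refine key.trans ?_
    have b1 : L * (R * V + I) * (∫ y in posCube N 1, (1 - χ y)) ≤ θ + θ * E := by
      have h1 : L * (R * V + I) * (∫ y in posCube N 1, (1 - χ y)) ≤ L * (R * V + I) * κ := by gcongr
      have h2 : L * κ * I ≤ θ * α * I := by gcongr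
      have h3 : θ * (α * I) ≤ θ * E := by gcongr
      linarith
    have b2 : (L * ω + β * C * c / K) * I ≤ 2 * (θ * E) := by
      have h1 : L * ω = θ * α := by rw [hω]; field_simp
      have h2 : β * C * c / K * I ≤ θ * α * I := by gcongr
      have h3 : θ * (α * I) ≤ θ * E := by gcongr
      rw [h1]; linarith
    calc _ ≤ ENNReal.ofReal (E + 2 * (θ * E) + θ) + ENNReal.ofReal (θ + θ * E) + ENNReal.ofReal θ + ENNReal.ofReal θ := by
          refine add_le_add (add_le_add (add_le_add ?_ ?_) ?_) ?_
          · exact ENNReal.ofReal_le_ofReal (by linarith)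
          · rw [← ENNReal.ofReal_mul (by positivity)]
            exact ENNReal.ofReal_le_ofReal b1
          · exact ENNReal.ofReal_le_ofReal hηC
          · refine (mul_le_mul_right hSV _).trans ?_
            rw [← ENNReal.ofReal_mul hpow0]
            exact ENNReal.ofReal_le_ofReal hεθ.le
      _ = _ := by
          rw [← ENNReal.ofReal_add (by positivity) (by positivity), ← ENNReal.ofReal_add (by positivity) (by positivity),
            ← ENNReal.ofReal_add (by positivity) (by positivity)]
          congr 1; ring
  rw [← ofReal_integral_eq_lintegral_ofReal (hT.mono_set hSΩ) (by
    filter_upwards [ae_restrict_of_ae_restrict_of_subset hSΩ huM] with x hx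
    exact hg_Tfhom_nonneg hf (hR.tan_zero hx) _), ENNReal.ofReal_le_ofReal_iff (by positivity)] at key2
  linarith

theorem hg_lower {f : EN N → Mat d N → ℝ} {α β L : ℝ} (hf : StdIntegrand N d f α β L)
    {M : Set (EN d)} {G : EN d → EN d} {δ C : ℝ} (hR : hg_Ret M G δ C)
    {Ω : Set (EN N)} (hΩ : IsOpen Ω) (hb : Bornology.IsBounded Ω)
    {u : EN N → EN d} {Du : EN N → Mat d N} (hu : MemW11 Ω u Du) (huM : AeIn Ω u M)
    (v : ℝ → EN N → EN d) (hv : TendstoL1 Ω v u) :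
    ENNReal.ofReal (∫ x in Ω, Tfhom f M (u x) (Du x)) ≤ liminf (fun ε => FepsSet f M ε (v ε) Ω) (𝓝[>] 0) := by
  set A := ∫ x in Ω, Tfhom f M (u x) (Du x) with hA
  have h1 : ∀ θ > 0, ENNReal.ofReal ((A - 5 * θ) / (1 + 3 * θ)) ≤ liminf (fun ε => FepsSet f M ε (v ε) Ω) (𝓝[>] 0) := by
    intro θ hθ
    obtain ⟨σ, hσ, h⟩ := hg_lower_pre hf hR hΩ hb hu huM hθ
    refine le_liminf_of_le (by isBoundedDefault) ?_
    have hv' : ∀ᶠ ε in 𝓝[>] (0:ℝ), ∫ x in Ω, ‖v ε x - u x‖ < σ := hv.eventually_lt_const hσ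
    filter_upwards [h, hv'] with ε h1 h2
    refine le_iInf₂ fun Dv hDv => ENNReal.ofReal_le_ofReal ?_
    rw [div_le_iff₀ (by positivity)]
    have := h1 (v ε) Dv hDv.1 hDv.2 h2
    linarith
  have hc : ContinuousAt (fun θ : ℝ => ENNReal.ofReal ((A - 5 * θ) / (1 + 3 * θ))) 0 := by
    refine ENNReal.continuous_ofReal.continuousAt.comp ?_
    exact ContinuousAt.div (by fun_prop) (by fun_prop) (by simp)
  have h2 : Tendsto (fun θ : ℝ => ENNReal.ofReal ((A - 5 * θ) / (1 + 3 * θ))) (𝓝[>] 0) (𝓝 (ENNReal.ofReal A)) := by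
    have := hc.tendsto.mono_left (nhdsWithin_le_nhds (s := Ioi 0))
    simpa using this
  refine le_of_tendsto h2 ?_
  filter_upwards [self_mem_nhdsWithin] with θ hθ using h1 θ hθ

end

section
open MeasureTheory Filter Set
open scoped ENNReal RealInnerProductSpace Topology NNReal Pointwise

variable {N d : ℕ}

theorem hg_chi_approx {A : Set (EN N)} (hA : MeasurableSet A) (hA' : volume A ≠ ⊤) {η : ℝ} (hη : 0 < η) :
    ∃ (χ : EN N → ℝ) (B : ℝ), ContDiff ℝ (⊤ : ℕ∞) χ ∧ (∀ x, 0 ≤ χ x ∧ χ x ≤ 1) ∧ (∀ x, ‖fderiv ℝ χ x‖ ≤ B) ∧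
      Integrable (fun x => |χ x - A.indicator 1 x|) ∧ ∫ x, |χ x - A.indicator 1 x| ≤ η := by
  have hη2 : ENNReal.ofReal (η/2) ≠ 0 := by simp [hη]
  obtain ⟨K, hKA, hK, hKm⟩ := hA.exists_isCompact_sdiff_lt hA' hη2
  obtain ⟨U, hAU, hU, hUf, hUm⟩ := hA.exists_isOpen_sdiff_lt hA' hη2
  obtain ⟨χ, h1, h2, h3, h4, h5⟩ := hg_cutoff hK hU (hKA.trans hAU)
  obtain ⟨B, hB⟩ := (h2.fderiv (𝕜 := ℝ)).exists_bound_of_continuous (h1.continuous_fderiv (by simp))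
  have hle : ∀ x, |χ x - A.indicator 1 x| ≤ (U \ K).indicator 1 x := by
    intro x
    by_cases hxK : x ∈ K
    · have : χ x = 1 := (h5.filter_mono (nhds_le_nhdsSet hxK)).self_of_nhds
      simp [this, hKA hxK, hxK]
    · by_cases hxU : x ∈ U
      · rw [indicator_of_mem (show x ∈ U \ K from ⟨hxU, hxK⟩)]
        by_cases hxA : x ∈ A
        · rw [indicator_of_mem hxA, abs_le]; simp; constructor <;> linarith [(h4 x).1, (h4 x).2]
        · rw [indicator_of_notMem hxA, abs_le]; simp; constructor <;> linarith [(h4 x).1, (h4 x).2]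
      · have hz : χ x = 0 := by
          by_contra hne
          exact hxU (h3 (subset_tsupport _ hne))
        have hxA : x ∉ A := fun h => hxU (hAU h)
        simp [hz, hxA, hxU]
  have hm : MeasurableSet (U \ K) := hU.measurableSet.diff hK.measurableSet
  have hv : volume (U \ K) ≤ ENNReal.ofReal η := by
    have : U \ K ⊆ (U \ A) ∪ (A \ K) := by
      intro x hx
      by_cases hxA : x ∈ A
      · exact Or.inr ⟨hxA, hx.2⟩
      · exact Or.inl ⟨hx.1, hxA⟩
    calc volume (U \ K) ≤ volume ((U \ A) ∪ (A \ K)) := measure_mono this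
      _ ≤ volume (U \ A) + volume (A \ K) := measure_union_le _ _
      _ ≤ ENNReal.ofReal (η/2) + ENNReal.ofReal (η/2) := add_le_add hUm.le hKm.le
      _ = ENNReal.ofReal η := by rw [← ENNReal.ofReal_add (by positivity) (by positivity)]; simp
  have hvt : volume (U \ K) ≠ ⊤ := (hv.trans_lt ENNReal.ofReal_lt_top).ne
  have hI : Integrable ((U \ K).indicator (1 : EN N → ℝ)) := by
    rw [integrable_indicator_iff hm]
    exact integrableOn_const hvt
  have hI2 : Integrable (fun x => |χ x - A.indicator 1 x|) := by
    refine hI.mono' ?_ (Eventually.of_forall fun x => ?_)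
    · have : Measurable (fun x => |χ x - A.indicator 1 x|) :=
        (h1.continuous.measurable.sub (measurable_one.indicator hA)).abs
      exact this.aestronglyMeasurable
    · simpa using hle x
  refine ⟨χ, B, h1, h4, hB, hI2, ?_⟩
  calc ∫ x, |χ x - A.indicator 1 x| ≤ ∫ x, (U \ K).indicator 1 x := integral_mono hI2 hI hle
    _ = volume.real (U \ K) := by rw [integral_indicator_one hm]
    _ ≤ η := ENNReal.toReal_le_of_le_ofReal hη.le hv

theorem hg_part_int {κ : EN N → ℕ} (hκ : Measurable κ) {n : ℕ} (hn : ∀ x, κ x < n) {Ω : Set (EN N)} (hΩ : MeasurableSet Ω)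
    {g : EN N → ℝ} (hg : IntegrableOn g Ω) :
    ∫ x in Ω, g x = ∑ k ∈ Finset.range n, ∫ x in Ω ∩ κ ⁻¹' {k}, g x := by
  have hU : Ω = ⋃ k ∈ Finset.range n, (Ω ∩ κ ⁻¹' {k}) := by
    ext x
    simp only [Finset.mem_range, mem_iUnion, mem_inter_iff, mem_preimage, mem_singleton_iff, exists_prop]
    constructor
    · intro h; exact ⟨κ x, hn x, h, rfl⟩
    · rintro ⟨k, -, h, -⟩; exact h
  conv_lhs => rw [hU]
  refine integral_biUnion_finset _ (fun k _ => hΩ.inter (hκ (measurableSet_singleton k))) ?_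
    (fun k _ => hg.mono_set inter_subset_left)
  intro i _ j _ hij
  refine disjoint_left.2 ?_
  rintro x ⟨-, h1⟩ ⟨-, h2⟩
  simp only [mem_preimage, mem_singleton_iff] at h1 h2
  exact hij (h1.symm.trans h2)

/-- the recovery ansatz for a smooth perturbation -/
theorem hg_ansatz {M : Set (EN d)} {G : EN d → EN d} {δ C : ℝ} (hR : hg_Ret M G δ C)
    {Ω : Set (EN N)} (hΩ : IsOpen Ω) (hb : Bornology.IsBounded Ω)
    {u : EN N → EN d} {Du : EN N → Mat d N} (hu : MemW11 Ω u Du) (huM : AeIn Ω u M)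
    {w : EN N → EN d} (hw : ContDiff ℝ 1 w) {B : ℝ} (hB : ∀ x, ‖fderiv ℝ w x‖ ≤ B) (hd : ∀ x, ‖w x‖ < δ) :
    MemW11 Ω (fun x => G (u x + w x)) (fun x => (fderiv ℝ G (u x + w x)).comp (Du x + fderiv ℝ w x)) ∧
      AeIn Ω (fun x => G (u x + w x)) M := by
  constructor
  · set H : EN N × EN d → EN d := fun p => G (p.2 + w p.1)
    have hH : ContDiff ℝ 1 H := hR.smooth.comp (contDiff_snd.add (hw.comp contDiff_fst))
    have hfd : ∀ p, fderiv ℝ H p = (fderiv ℝ G (p.2 + w p.1)).comp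
        (ContinuousLinearMap.snd ℝ (EN N) (EN d) + (fderiv ℝ w p.1).comp (ContinuousLinearMap.fst ℝ (EN N) (EN d))) := by
      intro p
      have h1 : HasFDerivAt (fun p : EN N × EN d => w p.1) ((fderiv ℝ w p.1).comp (ContinuousLinearMap.fst ℝ (EN N) (EN d))) p :=
        HasFDerivAt.comp p ((hw.differentiable (by simp)) p.1).hasFDerivAt hasFDerivAt_fst
      have h2 : HasFDerivAt (fun p : EN N × EN d => p.2 + w p.1) _ p := hasFDerivAt_snd.add h1
      exact (HasFDerivAt.comp p ((hR.smooth.differentiable (by simp)) (p.2 + w p.1)).hasFDerivAt h2).fderiv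
    have hC0 : 0 ≤ C := zero_le_one.trans hR.C1
    have hC : ∀ p, ‖fderiv ℝ H p‖ ≤ C * (1 + B) := by
      intro p
      rw [hfd]
      refine (ContinuousLinearMap.opNorm_comp_le _ _).trans ?_
      refine mul_le_mul (hR.bd _) ?_ (norm_nonneg _) hC0
      refine (norm_add_le _ _).trans (add_le_add (ContinuousLinearMap.norm_snd_le ..) ?_)
      refine (ContinuousLinearMap.opNorm_comp_le _ _).trans ?_
      calc _ ≤ ‖fderiv ℝ w p.1‖ * 1 := mul_le_mul_of_nonneg_left (ContinuousLinearMap.norm_fst_le ..) (norm_nonneg _)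
        _ ≤ B := by rw [mul_one]; exact hB _
    have := hg_chain hΩ hb hH hC hu
    convert this using 1
    funext x
    refine ContinuousLinearMap.ext fun y => ?_
    rw [hg_grad_apply, hfd]
    simp
  · filter_upwards [huM] with x hx
    refine hR.mem _ ((Metric.infDist_le_dist_of_mem hx).trans_lt ?_)
    simpa [dist_eq_norm] using hd x

end

section
open MeasureTheory Filter Set
open scoped ENNReal RealInnerProductSpace Topology NNReal Pointwise

variable {N d : ℕ}

/-- oscillating perturbation -/
noncomputable def hg_w (n : ℕ) (χ : ℕ → EN N → ℝ) (ψ : ℕ → EN N → EN d) (ε : ℝ) (x : EN N) : EN d :=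
  ∑ k ∈ Finset.range n, χ k x • (ε • ψ k (ε⁻¹ • x))

theorem hg_w_hasFDerivAt {n : ℕ} {χ : ℕ → EN N → ℝ} {ψ : ℕ → EN N → EN d} {ε : ℝ} (hε : 0 < ε)
    (hχ : ∀ k, ContDiff ℝ (⊤ : ℕ∞) (χ k)) (hψ : ∀ k, ContDiff ℝ 1 (ψ k)) (x : EN N) :
    HasFDerivAt (hg_w n χ ψ ε) (∑ k ∈ Finset.range n, (χ k x • fderiv ℝ (ψ k) (ε⁻¹ • x) +
      (fderiv ℝ (χ k) x).smulRight (ε • ψ k (ε⁻¹ • x)))) x := by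
  have : hg_w n χ ψ ε = fun x => ∑ k ∈ Finset.range n, χ k x • (ε • ψ k (ε⁻¹ • x)) := rfl
  rw [this]
  refine HasFDerivAt.fun_sum fun k _ => ?_
  have h1 : HasFDerivAt (χ k) (fderiv ℝ (χ k) x) x := (((hχ k).differentiable (by simp)) x).hasFDerivAt
  have h0 : HasFDerivAt (fun x : EN N => ε⁻¹ • x) (ε⁻¹ • ContinuousLinearMap.id ℝ (EN N)) x :=
    HasFDerivAt.const_smul (f := fun x : EN N => x) (hasFDerivAt_id x) ε⁻¹
  have h2 : HasFDerivAt (fun x => ψ k (ε⁻¹ • x)) ((fderiv ℝ (ψ k) (ε⁻¹ • x)).comp (ε⁻¹ • ContinuousLinearMap.id ℝ (EN N))) x :=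
    HasFDerivAt.comp x (((hψ k).differentiable (by simp)) (ε⁻¹ • x)).hasFDerivAt h0
  have h4 : HasFDerivAt (fun x => ε • ψ k (ε⁻¹ • x)) (fderiv ℝ (ψ k) (ε⁻¹ • x)) x := by
    have e : fderiv ℝ (ψ k) (ε⁻¹ • x) = ε • (fderiv ℝ (ψ k) (ε⁻¹ • x)).comp (ε⁻¹ • ContinuousLinearMap.id ℝ (EN N)) := by
      refine ContinuousLinearMap.ext fun q => ?_
      simp [smul_smul, hε.ne']
    rw [e]
    exact HasFDerivAt.const_smul (f := fun x => ψ k (ε⁻¹ • x)) h2 ε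
  exact HasFDerivAt.smul h1 h4

theorem hg_w_contDiff {n : ℕ} {χ : ℕ → EN N → ℝ} {ψ : ℕ → EN N → EN d} {ε : ℝ} 
    (hχ : ∀ k, ContDiff ℝ (⊤ : ℕ∞) (χ k)) (hψ : ∀ k, ContDiff ℝ 1 (ψ k)) : ContDiff ℝ 1 (hg_w n χ ψ ε) := by
  refine ContDiff.sum fun k _ => ?_
  have h1 : ContDiff ℝ 1 (fun x : EN N => ε⁻¹ • x) := contDiff_const_smul ε⁻¹
  have h2 : ContDiff ℝ 1 (fun x : EN N => ε • ψ k (ε⁻¹ • x)) := ContDiff.const_smul ε ((hψ k).comp h1)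
  exact ContDiff.smul ((hχ k).of_le (by norm_cast)) h2

theorem hg_w_norm {n : ℕ} {χ : ℕ → EN N → ℝ} {ψ : ℕ → EN N → EN d} {ε B : ℝ} (hε : 0 < ε)
    (hχ : ∀ k x, 0 ≤ χ k x ∧ χ k x ≤ 1) (hB : ∀ k x, ‖ψ k x‖ ≤ B) (x : EN N) : ‖hg_w n χ ψ ε x‖ ≤ ε * (n * B) := by
  have hB0 : 0 ≤ B := (norm_nonneg _).trans (hB 0 0)
  calc _ ≤ ∑ k ∈ Finset.range n, ε * B := by
        refine norm_sum_le_of_le _ fun k _ => ?_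
        rw [norm_smul, norm_smul, Real.norm_of_nonneg hε.le, Real.norm_of_nonneg (hχ k x).1]
        calc _ ≤ 1 * (ε * B) := mul_le_mul (hχ k x).2 (mul_le_mul_of_nonneg_left (hB _ _) hε.le) (by positivity) zero_le_one
          _ = _ := one_mul _
    _ = _ := by simp; ring

theorem hg_w_fderiv {n : ℕ} {χ : ℕ → EN N → ℝ} {ψ : ℕ → EN N → EN d} {ε B B2 : ℝ} (hε : 0 < ε)
    (hχ : ∀ k, ContDiff ℝ (⊤ : ℕ∞) (χ k)) (hψ : ∀ k, ContDiff ℝ 1 (ψ k))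
    (hB : ∀ k x, ‖ψ k x‖ ≤ B) (hB' : ∀ k x, ‖fderiv ℝ (ψ k) x‖ ≤ B) 
    (hB2 : ∀ k ∈ Finset.range n, ∀ x, ‖fderiv ℝ (χ k) x‖ ≤ B2) (c : ℕ → ℝ) (x : EN N) :
    ‖fderiv ℝ (hg_w n χ ψ ε) x - ∑ k ∈ Finset.range n, c k • fderiv ℝ (ψ k) (ε⁻¹ • x)‖ ≤
      (∑ k ∈ Finset.range n, |χ k x - c k|) * B + ε * (n * (B2 * B)) := by
  rw [(hg_w_hasFDerivAt hε hχ hψ x).fderiv, ← Finset.sum_sub_distrib]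
  calc _ ≤ ∑ k ∈ Finset.range n, (|χ k x - c k| * B + ε * (B2 * B)) := by
        refine norm_sum_le_of_le _ fun k hk => ?_
        have : χ k x • fderiv ℝ (ψ k) (ε⁻¹ • x) + (fderiv ℝ (χ k) x).smulRight (ε • ψ k (ε⁻¹ • x)) -
          c k • fderiv ℝ (ψ k) (ε⁻¹ • x) = (χ k x - c k) • fderiv ℝ (ψ k) (ε⁻¹ • x) + 
            (fderiv ℝ (χ k) x).smulRight (ε • ψ k (ε⁻¹ • x)) := by module
        rw [this]
        refine (norm_add_le _ _).trans (add_le_add ?_ ?_)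
        · rw [norm_smul, Real.norm_eq_abs]
          exact mul_le_mul_of_nonneg_left (hB' _ _) (abs_nonneg _)
        · rw [ContinuousLinearMap.norm_smulRight_apply, norm_smul, Real.norm_of_nonneg hε.le]
          have h0 : 0 ≤ B2 := (norm_nonneg _).trans (hB2 k hk x)
          calc _ ≤ B2 * (ε * B) := mul_le_mul (hB2 k hk x) (mul_le_mul_of_nonneg_left (hB _ _) hε.le) (by positivity) h0
            _ = _ := by ring
    _ = _ := by rw [Finset.sum_add_distrib, Finset.sum_mul]; simp; ring

/-- pointwise algebra of the gradient error -/
theorem hg_grad_err {P Q : EN d →L[ℝ] EN d} {D Dw Z X : Mat d N} {ω C B a r : ℝ} (hP : ‖P‖ ≤ C) (hω : ‖P - Q‖ ≤ ω)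
    (hD : Q.comp D = D) (hZ : ‖Z‖ ≤ B) (hr : ‖Dw - Z‖ ≤ r) (hC : 0 ≤ C) (h0 : 0 ≤ ω)
    (ha : ‖D - X‖ + ‖Q.comp Z - Z‖ ≤ a) :
    ‖P.comp (D + Dw) - (X + Z)‖ ≤ ω * ‖D‖ + C * r + ω * B + a := by
  have : P.comp (D + Dw) - (X + Z) = (P - Q).comp D + P.comp (Dw - Z) + (P - Q).comp Z + ((D - X) + (Q.comp Z - Z)) := by
    have h1 : (P - Q).comp D = P.comp D - D := by
      rw [ContinuousLinearMap.sub_comp, hD]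
    rw [h1, ContinuousLinearMap.comp_add, ContinuousLinearMap.comp_sub, ContinuousLinearMap.sub_comp]
    abel
  rw [this]
  refine (norm_add_le _ _).trans (add_le_add ((norm_add_le _ _).trans (add_le_add ((norm_add_le _ _).trans (add_le_add ?_ ?_)) ?_)) ((norm_add_le _ _).trans ha))
  · exact (ContinuousLinearMap.opNorm_comp_le _ _).trans (mul_le_mul_of_nonneg_right hω (norm_nonneg _))
  · exact (ContinuousLinearMap.opNorm_comp_le _ _).trans (mul_le_mul hP hr (norm_nonneg _) hC)
  · exact (ContinuousLinearMap.opNorm_comp_le _ _).trans (mul_le_mul hω hZ (norm_nonneg _) h0)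

end

section
open MeasureTheory Filter Set
open scoped ENNReal RealInnerProductSpace Topology NNReal Pointwise

variable {N d : ℕ}

theorem hg_small_ev (K : ℝ) {c : ℝ} (hc : 0 < c) : ∀ᶠ ε : ℝ in 𝓝[>] 0, K * ε < c := by
  have h : Tendsto (fun ε : ℝ => K * ε) (𝓝[>] 0) (𝓝 (K * 0)) :=
    ((continuous_const.mul continuous_id).tendsto 0).mono_left nhdsWithin_le_nhds
  rw [mul_zero] at h
  exact h.eventually (gt_mem_nhds hc)

theorem hg_small_ex (K : ℝ) {c : ℝ} (hc : 0 < c) : ∃ ω : ℝ, 0 < ω ∧ K * ω < c := by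
  obtain ⟨ω, h1, h2⟩ := ((hg_small_ev K hc).and self_mem_nhdsWithin).exists
  exact ⟨ω, h2, h1⟩

set_option maxHeartbeats 1000000 in
theorem hg_upper1 {f : EN N → Mat d N → ℝ} {α β L : ℝ} (hf : StdIntegrand N d f α β L)
    {M : Set (EN d)} {G : EN d → EN d} {δ C : ℝ} (hR : hg_Ret M G δ C)
    {Ω : Set (EN N)} (hΩ : IsOpen Ω) (hb : Bornology.IsBounded Ω)
    {u : EN N → EN d} {Du : EN N → Mat d N} (hu : MemW11 Ω u Du) (huM : AeIn Ω u M)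
    {κ : EN N → ℕ} (hκ : Measurable κ) {n : ℕ} (hn : ∀ x, κ x < n)
    {ψ : ℕ → EN N → EN d} (hψ : ∀ k, ContDiff ℝ 1 (ψ k)) {t : ℕ → ℕ} (ht : ∀ k, 0 < t k)
    (hper : ∀ k x i, fderiv ℝ (ψ k) (x + (t k : ℝ) • EuclideanSpace.single i 1) = fderiv ℝ (ψ k) x)
    {B : ℝ} (hB : ∀ k x, ‖ψ k x‖ ≤ B) (hB' : ∀ k x, ‖fderiv ℝ (ψ k) x‖ ≤ B)
    (Ξ : ℕ → Mat d N) {a : EN N → ℝ} (ha : IntegrableOn a Ω)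
    (hae : ∀ᵐ x ∂(volume.restrict Ω), ∀ y, ‖Du x - Ξ (κ x)‖ +
      ‖(fderiv ℝ G (u x)).comp (fderiv ℝ (ψ (κ x)) y) - fderiv ℝ (ψ (κ x)) y‖ ≤ a x)
    {η : ℝ} (hη : 0 < η) :
    ∀ᶠ ε in 𝓝[>] (0:ℝ), ∃ (v : EN N → EN d) (Dv : EN N → Mat d N), MemW11 Ω v Dv ∧ AeIn Ω v M ∧
      ∫ x in Ω, ‖v x - u x‖ ≤ η ∧
      ∫ x in Ω, f (ε⁻¹ • x) (Dv x) ≤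
        (∫ x in Ω, ((t (κ x) : ℝ) ^ N)⁻¹ * ∫ z in posCube N (t (κ x)), f z (Ξ (κ x) + fderiv ℝ (ψ (κ x)) z)) +
          L * (∫ x in Ω, a x) + η := by
  have hΩm := hΩ.measurableSet
  have hΩf : volume Ω ≠ ⊤ := hb.measure_lt_top.ne
  have hfin : IsFiniteMeasure (volume.restrict Ω) := ⟨by simpa using hΩf.lt_top⟩
  have hL := hf.lip_pos
  have hC0 : 0 ≤ C := zero_le_one.trans hR.C1
  have hB0 : 0 ≤ B := (norm_nonneg _).trans (hB 0 0)
  set V := volume.real Ω with hV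
  set I := ∫ x in Ω, ‖Du x‖ with hI
  obtain ⟨ω, hω, hω'⟩ := hg_small_ex (L * (I + B * V)) (c := η/4) (by positivity)
  obtain ⟨η1, hη1, hη1'⟩ := hg_small_ex (L * (C * (n * B))) (c := η/4) (by positivity)
  have hAm : ∀ k, MeasurableSet (Ω ∩ κ ⁻¹' {k}) := fun k => hΩm.inter (hκ (measurableSet_singleton k))
  have hAf : ∀ k, volume (Ω ∩ κ ⁻¹' {k}) ≠ ⊤ := fun k => measure_ne_top_of_subset inter_subset_left hΩf
  choose χ Bc hχ hχ1 hχB hχI hχη using fun k => hg_chi_approx (hAm k) (hAf k) hη1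
  set B2 : ℝ := ∑ k ∈ Finset.range n, |Bc k| with hB2def
  have hB2 : ∀ k ∈ Finset.range n, ∀ x, ‖fderiv ℝ (χ k) x‖ ≤ B2 := by
    intro k hk x
    exact (hχB k x).trans ((le_abs_self _).trans (Finset.single_le_sum (f := fun k => |Bc k|) (fun i _ => abs_nonneg _) hk))
  have hB20 : 0 ≤ B2 := Finset.sum_nonneg fun i _ => abs_nonneg _
  obtain ⟨r, hr, hr'⟩ := Metric.uniformContinuous_iff.1 hR.uc ω hω
  -- Riemann-Lebesgue
  set c : ℕ → ℝ := fun k => ((t k : ℝ) ^ N)⁻¹ * ∫ z in posCube N (t k), f z (Ξ k + fderiv ℝ (ψ k) z) with hc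
  have hRL : Tendsto (fun ε : ℝ => ∑ k ∈ Finset.range n, ∫ x in Ω ∩ κ ⁻¹' {k}, f (ε⁻¹ • x) (Ξ k + fderiv ℝ (ψ k) (ε⁻¹ • x)))
      (𝓝[>] 0) (𝓝 (∑ k ∈ Finset.range n, volume.real (Ω ∩ κ ⁻¹' {k}) * c k)) := by
    refine tendsto_finsetSum _ fun k _ => ?_
    refine hg_RL_f hf (ht k) (D := fun y => Ξ k + fderiv ℝ (ψ k) y) (C := ‖Ξ k‖ + B) ?_ ?_ ?_ (hAm k) (hAf k)
    · exact (continuous_const.add ((hψ k).continuous_fderiv (by simp))).measurable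
    · intro y; exact (norm_add_le _ _).trans (add_le_add le_rfl (hB' k y))
    · intro y i; simp only [hper]
  have hcI : Integrable (fun x => c (κ x)) (volume.restrict Ω) := by
    refine Integrable.of_bound (C := ∑ k ∈ Finset.range n, |c k|) ?_ (Eventually.of_forall fun x => ?_)
    · exact ((measurable_of_countable c).comp hκ).aestronglyMeasurable
    · exact Finset.single_le_sum (f := fun k => |c k|) (fun i _ => abs_nonneg _) (Finset.mem_range.2 (hn x))
  have hcsum : ∑ k ∈ Finset.range n, volume.real (Ω ∩ κ ⁻¹' {k}) * c k = ∫ x in Ω, c (κ x) := by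
    rw [hg_part_int hκ hn hΩm hcI]
    refine Finset.sum_congr rfl fun k _ => ?_
    rw [setIntegral_congr_fun (g := fun _ => c k) (hAm k) (fun x hx => by
      have : κ x = k := hx.2
      simp only [this])]
    simp
  rw [hcsum] at hRL
  have hRL' := hRL.eventually (gt_mem_nhds (show (∫ x in Ω, c (κ x)) < (∫ x in Ω, c (κ x)) + η/4 by linarith))
  have htan := hR.grad_tan hΩ hb hu huM
  filter_upwards [self_mem_nhdsWithin, hRL', hg_small_ev (n * B) hR.dpos, hg_small_ev (n * B) hr,
    hg_small_ev (L * (C * (n * (B2 * B)) * V)) (c := η/4) (by positivity),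
    hg_small_ev (C * (n * B) * V) hη] with ε hε hRLε hεδ hεr hε3 hε4
  replace hε : 0 < ε := hε
  set w := hg_w n χ ψ ε with hw
  have hwC : ContDiff ℝ 1 w := hg_w_contDiff hχ hψ
  have hwn : ∀ x, ‖w x‖ ≤ ε * (n * B) := hg_w_norm hε hχ1 hB
  have hwd : ∀ x, ‖fderiv ℝ w x‖ ≤ n * B + ε * (n * (B2 * B)) := by
    intro x
    have := hg_w_fderiv hε hχ hψ hB hB' hB2 (fun _ => 0) x
    have hz : ∑ k ∈ Finset.range n, (0:ℝ) • fderiv ℝ (ψ k) (ε⁻¹ • x) = 0 :=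
      Finset.sum_eq_zero fun k _ => zero_smul ℝ (fderiv ℝ (ψ k) (ε⁻¹ • x))
    rw [hz] at this
    simp only [sub_zero] at this
    refine this.trans (add_le_add ?_ le_rfl)
    refine mul_le_mul_of_nonneg_right ?_ hB0
    calc ∑ k ∈ Finset.range n, |χ k x| ≤ ∑ k ∈ Finset.range n, (1:ℝ) := Finset.sum_le_sum fun k _ => by
          rw [abs_of_nonneg (hχ1 k x).1]; exact (hχ1 k x).2
      _ = n := by simp
  obtain ⟨hW, hWM⟩ := hg_ansatz hR hΩ hb hu huM hwC hwd (fun x => (hwn x).trans_lt (by linarith))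
  refine ⟨_, _, hW, hWM, ?_, ?_⟩
  · have h1 : ∀ᵐ x ∂(volume.restrict Ω), ‖G (u x + w x) - u x‖ ≤ C * (ε * (n * B)) := by
      filter_upwards [huM] with x hx
      have h2 := hg_lip_of_fderiv hR.smooth hR.bd (u x + w x) (u x)
      rw [hR.idM _ hx, add_sub_cancel_left] at h2
      exact h2.trans (mul_le_mul_of_nonneg_left (hwn x) hC0)
    calc _ ≤ ∫ x in Ω, C * (ε * (n * B)) := integral_mono_ae (hW.1.sub hu.1).norm (integrable_const _) h1
      _ = C * (n * B) * V * ε := by simp [hV]; ring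
      _ ≤ η := hε4.le
  · -- energy
    set Z : EN N → Mat d N := fun x => fderiv ℝ (ψ (κ x)) (ε⁻¹ • x) with hZ
    set e : EN N → ℝ := fun x => ∑ k ∈ Finset.range n, |χ k x - (Ω ∩ κ ⁻¹' {k}).indicator 1 x| with he
    have heI : Integrable e := integrable_finsetSum _ fun k _ => hχI k
    have heη : ∫ x in Ω, e x ≤ n * η1 := by
      calc ∫ x in Ω, e x ≤ ∫ x, e x := setIntegral_le_integral heI (Eventually.of_forall fun x => Finset.sum_nonneg fun i _ => abs_nonneg _)
        _ = ∑ k ∈ Finset.range n, ∫ x, |χ k x - (Ω ∩ κ ⁻¹' {k}).indicator 1 x| := integral_finsetSum _ fun k _ => hχI k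
        _ ≤ ∑ k ∈ Finset.range n, η1 := Finset.sum_le_sum fun k _ => hχη k
        _ = n * η1 := by simp
    have hZm : Measurable Z := by
      have : Measurable (Function.uncurry fun (k : ℕ) (x : EN N) => fderiv ℝ (ψ k) (ε⁻¹ • x)) := by
        refine measurable_from_prod_countable_right fun k => ?_
        exact (((hψ k).continuous_fderiv (by simp)).comp (continuous_const_smul ε⁻¹)).measurable
      exact this.comp (hκ.prodMk measurable_id)
    have hΞm : Measurable (fun x => Ξ (κ x)) := (measurable_of_countable Ξ).comp hκ
    have hD3 : IntegrableOn (fun x => Ξ (κ x) + Z x) Ω := by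
      refine Integrable.of_bound (C := (∑ k ∈ Finset.range n, ‖Ξ k‖) + B) (hΞm.add hZm).aestronglyMeasurable (Eventually.of_forall fun x => ?_)
      refine (norm_add_le _ _).trans (add_le_add ?_ (hB' _ _))
      exact Finset.single_le_sum (f := fun k => ‖Ξ k‖) (fun i _ => norm_nonneg _) (Finset.mem_range.2 (hn x))
    have hpt : ∀ᵐ x ∂(volume.restrict Ω), ‖(fderiv ℝ G (u x + w x)).comp (Du x + fderiv ℝ w x) - (Ξ (κ x) + Z x)‖ ≤
        ω * ‖Du x‖ + C * (e x * B + ε * (n * (B2 * B))) + ω * B + a x := by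
      filter_upwards [htan, hae, ae_restrict_mem hΩm] with x hx1 hx2 hxΩ
      refine hg_grad_err (Q := fderiv ℝ G (u x)) (hR.bd _) ?_ hx1 (hB' _ _) ?_ hC0 hω.le (hx2 _)
      · rw [← dist_eq_norm]
        refine (hr' ?_).le
        rw [dist_eq_norm, add_sub_cancel_left]
        exact (hwn x).trans_lt (by linarith)
      · have := hg_w_fderiv hε hχ hψ hB hB' hB2 (fun k => (Ω ∩ κ ⁻¹' {k}).indicator 1 x) x
        have hs : ∑ k ∈ Finset.range n, (Ω ∩ κ ⁻¹' {k}).indicator (1 : EN N → ℝ) x • fderiv ℝ (ψ k) (ε⁻¹ • x) = Z x := by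
          rw [Finset.sum_eq_single (κ x)]
          · rw [indicator_of_mem (show x ∈ Ω ∩ κ ⁻¹' {κ x} from ⟨hxΩ, rfl⟩)]; simp [hZ]
          · intro k _ hk
            rw [indicator_of_notMem (fun h => hk h.2.symm)]; exact zero_smul ℝ (fderiv ℝ (ψ k) (ε⁻¹ • x))
          · intro h; exact absurd (Finset.mem_range.2 (hn x)) h
        rw [hs] at this
        exact this
    have hi1 : Integrable (fun x => ω * ‖Du x‖) (volume.restrict Ω) := hu.2.1.norm.const_mul ω
    have hi2 : Integrable (fun x => C * (e x * B + ε * (n * (B2 * B)))) (volume.restrict Ω) :=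
      ((heI.integrableOn.mul_const B).add (integrable_const _)).const_mul C
    have hi3 : Integrable (fun x : EN N => ω * B) (volume.restrict Ω) := integrable_const _
    have hdiff : ∫ x in Ω, ‖(fderiv ℝ G (u x + w x)).comp (Du x + fderiv ℝ w x) - (Ξ (κ x) + Z x)‖ ≤
        ω * I + C * ((n * η1) * B + ε * (n * (B2 * B)) * V) + ω * B * V + ∫ x in Ω, a x := by
      refine (integral_mono_ae (hW.2.1.sub hD3).norm (((hi1.add hi2).add hi3).add ha) hpt).trans ?_
      have hi12 : Integrable (fun x => ω * ‖Du x‖ + C * (e x * B + ε * (n * (B2 * B)))) (volume.restrict Ω) := hi1.add hi2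
      have hi123 : Integrable (fun x => ω * ‖Du x‖ + C * (e x * B + ε * (n * (B2 * B))) + ω * B) (volume.restrict Ω) := hi12.add hi3
      have e1 : ∫ x in Ω, C * (e x * B + ε * (n * (B2 * B))) = C * ((∫ x in Ω, e x) * B + ε * (n * (B2 * B)) * V) := by
        rw [integral_const_mul, integral_add (heI.integrableOn.mul_const B) (integrable_const _), integral_mul_const]
        simp [hV]; ring_nf; simp
      have e2 : ∫ x in Ω, ω * B = ω * B * V := by simp [hV]; ring
      simp only [Pi.add_apply]
      rw [integral_add hi123 ha, integral_add hi12 hi3, integral_add hi1 hi2, integral_const_mul, e1, e2]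
      gcongr
    have hE := hg_f_diff hf (inv_ne_zero hε.ne') hΩf hW.2.1 hD3
    have hE2 : ∫ x in Ω, f (ε⁻¹ • x) (Ξ (κ x) + Z x) = ∑ k ∈ Finset.range n, ∫ x in Ω ∩ κ ⁻¹' {k}, f (ε⁻¹ • x) (Ξ k + fderiv ℝ (ψ k) (ε⁻¹ • x)) := by
      rw [hg_part_int hκ hn hΩm (hg_integrable_f hf (inv_ne_zero hε.ne') hΩf hD3)]
      refine Finset.sum_congr rfl fun k _ => setIntegral_congr_fun (hAm k) fun x hx => ?_
      have : κ x = k := hx.2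
      simp only [hZ, this]
    rw [hE2] at hE
    have hLd := mul_le_mul_of_nonneg_left hdiff hL.le
    have : L * (ω * I + C * ((n * η1) * B + ε * (n * (B2 * B)) * V) + ω * B * V + ∫ x in Ω, a x) =
      L * (I + B * V) * ω + L * (C * (n * B)) * η1 + L * (C * (n * (B2 * B)) * V) * ε + L * ∫ x in Ω, a x := by ring
    linarith

end

section
open MeasureTheory Filter Set
open scoped ENNReal RealInnerProductSpace Topology NNReal Pointwise

variable {N d : ℕ}

/-- near-optimal periodic corrector -/
structure hg_Cell (f : EN N → Mat d N → ℝ) (G : EN d → EN d) (s : EN d) (ξ : Mat d N) (T : ℝ)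
    (t : ℕ) (ψ : EN N → EN d) (B : ℝ) : Prop where
  tpos : 0 < t
  smooth : ContDiff ℝ 1 ψ
  per : ∀ x i, fderiv ℝ ψ (x + (t : ℝ) • EuclideanSpace.single i 1) = fderiv ℝ ψ x
  B0 : 0 ≤ B
  bd : ∀ x, ‖ψ x‖ ≤ B
  bd' : ∀ x, ‖fderiv ℝ ψ x‖ ≤ B
  tan : ∀ y, (fderiv ℝ G s).comp (fderiv ℝ ψ y) = fderiv ℝ ψ y
  val : ((t:ℝ) ^ N)⁻¹ * ∫ z in posCube N t, f z (ξ + fderiv ℝ ψ z) ≤ T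

theorem hg_cell_exists {f : EN N → Mat d N → ℝ} {α β L : ℝ} (hf : StdIntegrand N d f α β L)
    {M : Set (EN d)} {G : EN d → EN d} {δ C : ℝ} (hR : hg_Ret M G δ C) {s : EN d} (hsM : s ∈ M) (ξ : Mat d N)
    {η : ℝ} (hη : 0 < η) : ∃ t ψ B, hg_Cell f G s ξ (Tfhom f M s ξ + η) t ψ B := by
  obtain ⟨t, ht, φ, hφ, hc, hs, hT, hE⟩ := hg_recover hf hR hsM ξ hη
  have ht' : (0:ℝ) < t := by exact_mod_cast ht
  have hcd : Continuous (fderiv ℝ φ) := hφ.continuous_fderiv (by simp)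
  obtain ⟨C1, hC1⟩ := hcd.bounded_above_of_compact_support (hc.fderiv ℝ)
  obtain ⟨C2, hC2⟩ := hφ.continuous.bounded_above_of_compact_support hc
  have hφd := hφ.differentiable (by simp)
  have hP0 : ∀ x, (fderiv ℝ G s).comp (fderiv ℝ φ x) = fderiv ℝ φ x := fun x => by
    have h1 := ((fderiv ℝ G s).hasFDerivAt.comp x (hφd x).hasFDerivAt).fderiv
    have h2 : (fun x => fderiv ℝ G s (φ x)) = φ := funext fun x => hR.tan_fix (hT _)
    rw [← h1]
    change fderiv ℝ (fun x => fderiv ℝ G s (φ x)) x = _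
    rw [h2]
  refine ⟨t, hg_per t φ, max C1 C2, ht, hg_per_contDiff ht' hφ hc hs, hg_per_fderiv_periodic ht' hc hs, ?_, ?_, ?_, ?_, ?_⟩
  · exact ((norm_nonneg _).trans (hC1 0)).trans (le_max_left _ _)
  · intro x; exact (hC2 _).trans (le_max_right _ _)
  · intro x; rw [hg_per_fderiv ht' hc hs]; exact (hC1 _).trans (le_max_left _ _)
  · intro x; rw [hg_per_fderiv ht' hc hs]; exact hP0 _
  · rw [setIntegral_congr_fun (g := fun z => f z (ξ + fderiv ℝ φ z)) (hg_measurableSet_posCube N t)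
      (fun z hz => by simp only [hg_per_fderiv ht' hc hs, hg_fl_cube ht' hz])]
    exact hE

theorem hg_cell_zero {f : EN N → Mat d N → ℝ} {α β L : ℝ} (hf : StdIntegrand N d f α β L) (G : EN d → EN d) (s : EN d) :
    hg_Cell f G s 0 β 1 (fun _ => 0) 0 := by
  refine ⟨one_pos, contDiff_const, by simp, le_rfl, by simp, by simp, by simp, ?_⟩
  have hfin : IsFiniteMeasure (volume.restrict (posCube N ((1:ℕ):ℝ))) := ⟨by
          simpa using (hg_volume_posCube_ne_top _ _).lt_top⟩
  have h1 : ∫ z in posCube N ((1:ℕ):ℝ), f z (0 + fderiv ℝ (fun _ : EN N => (0 : EN d)) z) ≤ ∫ z in posCube N ((1:ℕ):ℝ), β := by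
    refine integral_mono_of_nonneg (Eventually.of_forall fun x => hf.nonneg _ _) (integrable_const _) ?_
    filter_upwards [ae_restrict_of_ae hf.growth] with x hx
    have := (hx 0).2
    simpa using this
  simp only [Nat.cast_one, one_pow, inv_one, one_mul] at h1 ⊢
  refine h1.trans ?_
  simp [hg_volreal_posCube N zero_le_one]

set_option maxHeartbeats 1000000 in
theorem hg_upper2 {f : EN N → Mat d N → ℝ} {α β L : ℝ} (hf : StdIntegrand N d f α β L)
    {M : Set (EN d)} {G : EN d → EN d} {δ C : ℝ} (hR : hg_Ret M G δ C)
    {Ω : Set (EN N)} (hΩ : IsOpen Ω) (hb : Bornology.IsBounded Ω)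
    {u : EN N → EN d} {Du : EN N → Mat d N} (hu : MemW11 Ω u Du) (huM : AeIn Ω u M)
    {η : ℝ} (hη : 0 < η) :
    ∀ᶠ ε in 𝓝[>] (0:ℝ), ∃ (v : EN N → EN d) (Dv : EN N → Mat d N), MemW11 Ω v Dv ∧ AeIn Ω v M ∧
      ∫ x in Ω, ‖v x - u x‖ ≤ η ∧
      ∫ x in Ω, f (ε⁻¹ • x) (Dv x) ≤ (∫ x in Ω, Tfhom f M (u x) (Du x)) + η := by
  classical
  have hΩm := hΩ.measurableSet
  have hΩf : volume Ω ≠ ⊤ := hb.measure_lt_top.ne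
  have hfin : IsFiniteMeasure (volume.restrict Ω) := ⟨by simpa using hΩf.lt_top⟩
  have hL := hf.lip_pos
  have hβ := hg_beta_pos hf
  have hTI := hg_Tfhom_integrable hf hR hΩf hu huM
  set V := volume.real Ω with hV
  obtain ⟨η0, hη0, hη0'⟩ := hg_small_ex ((2 + 2 * L) * V) (c := η/3) (by positivity)
  set S : Set (EN d × Mat d N × ℝ) := {p | p.1 ∈ M ∧ p.2.2 = Tfhom f M p.1 p.2.1} with hS
  have hdata : ∀ p : EN d × Mat d N × ℝ, ∃ t ψ B, p ∈ S → hg_Cell f G p.1 p.2.1 (p.2.2 + η0) t ψ B := by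
    intro p
    by_cases hp : p ∈ S
    · obtain ⟨t, ψ, B, h⟩ := hg_cell_exists hf hR hp.1 p.2.1 hη0
      rw [← hp.2] at h
      exact ⟨t, ψ, B, fun _ => h⟩
    · exact ⟨1, fun _ => 0, 0, fun h => absurd h hp⟩
  choose t ψ B hcell using hdata
  set O : EN d × Mat d N × ℝ → Set (EN d × Mat d N × ℝ) := fun p =>
    {q | ‖q.2.1 - p.2.1‖ < η0 ∧ ‖fderiv ℝ G q.1 - fderiv ℝ G p.1‖ * B p < η0 ∧ |q.2.2 - p.2.2| < η0} with hO
  have hGc : Continuous (fderiv ℝ G) := hR.smooth.continuous_fderiv (by simp)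
  have hOo : ∀ p, IsOpen (O p) := by
    intro p
    have c1 : Continuous (fun q : EN d × Mat d N × ℝ => ‖q.2.1 - p.2.1‖) := by fun_prop
    have c2 : Continuous (fun q : EN d × Mat d N × ℝ => ‖fderiv ℝ G q.1 - fderiv ℝ G p.1‖ * B p) := by fun_prop
    have c3 : Continuous (fun q : EN d × Mat d N × ℝ => |q.2.2 - p.2.2|) := by fun_prop
    exact (isOpen_lt c1 continuous_const).inter ((isOpen_lt c2 continuous_const).inter (isOpen_lt c3 continuous_const))
  have hOmem : ∀ p, p ∈ O p := fun p => by
    refine ⟨?_, ?_, ?_⟩ <;> simp [hη0]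
  obtain ⟨T, hTS, hTc, hTcov⟩ := TopologicalSpace.countable_cover_nhdsWithin (s := S) (f := O)
    (fun p _ => mem_nhdsWithin_of_mem_nhds ((hOo p).mem_nhds (hOmem p)))
  have hTne : T.Nonempty := by
    obtain ⟨s, hs⟩ := hR.ne
    have : ((s, 0, Tfhom f M s 0) : EN d × Mat d N × ℝ) ∈ S := ⟨hs, rfl⟩
    have := hTcov this
    simp only [mem_iUnion] at this
    obtain ⟨p, hp, -⟩ := this
    exact ⟨p, hp⟩
  obtain ⟨p, rfl⟩ := hTc.exists_eq_range hTne
  have hpS : ∀ k, p k ∈ S := fun k => hTS ⟨k, rfl⟩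
  have hq0 : AEMeasurable (fun x => ((u x, Du x, Tfhom f M (u x) (Du x)) : EN d × Mat d N × ℝ)) (volume.restrict Ω) :=
    hu.1.aestronglyMeasurable.aemeasurable.prodMk
      (hu.2.1.aestronglyMeasurable.aemeasurable.prodMk hTI.aestronglyMeasurable.aemeasurable)
  set q := hq0.mk _ with hq
  have hqm : Measurable q := hq0.measurable_mk
  have hqe := hq0.ae_eq_mk
  have hOm : ∀ k, MeasurableSet {x | q x ∈ O (p k)} := fun k => hqm (hOo (p k)).measurableSet
  have hex : ∀ x, ∃ k, q x ∈ O (p k) ∨ ∀ j, q x ∉ O (p j) := by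
    intro x
    by_cases h : ∃ k, q x ∈ O (p k)
    · obtain ⟨k, hk⟩ := h; exact ⟨k, Or.inl hk⟩
    · push Not at h; exact ⟨0, Or.inr h⟩
  set κ0 : EN N → ℕ := fun x => Nat.find (hex x) with hκ0
  have hκ0m : Measurable κ0 := by
    refine measurable_find hex fun k => ?_
    have : {x | q x ∈ O (p k) ∨ ∀ j, q x ∉ O (p j)} = {x | q x ∈ O (p k)} ∪ ⋂ j, {x | q x ∈ O (p j)}ᶜ := by
      ext x; simp
    rw [this]
    exact (hOm k).union (MeasurableSet.iInter fun j => (hOm j).compl)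
  have hκae : ∀ᵐ x ∂(volume.restrict Ω), ((u x, Du x, Tfhom f M (u x) (Du x)) : EN d × Mat d N × ℝ) ∈ O (p (κ0 x)) := by
    filter_upwards [hqe, huM] with x hx hxM
    have hxS : ((u x, Du x, Tfhom f M (u x) (Du x)) : EN d × Mat d N × ℝ) ∈ S := ⟨hxM, rfl⟩
    have := hTcov hxS
    simp only [mem_iUnion, mem_range, exists_prop, exists_exists_eq_and] at this
    obtain ⟨k, hk⟩ := this
    rw [hx] at hk ⊢
    rcases Nat.find_spec (hex x) with h | h
    · exact h
    · exact absurd hk (h k)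
  -- the remainder
  have hrest : Tendsto (fun m : ℕ => ∫ x in Ω ∩ {x | m ≤ κ0 x}, (β + L * ‖Du x‖)) atTop (𝓝 0) := by
    have h1 := tendsto_setIntegral_of_antitone (μ := volume) (f := fun x => β + L * ‖Du x‖) (s := fun m : ℕ => Ω ∩ {x | m ≤ κ0 x})
      (fun m => hΩm.inter (hκ0m measurableSet_Ici))
      (fun m n hmn => inter_subset_inter_right _ fun x hx => hmn.trans hx)
      ⟨0, IntegrableOn.mono_set (t := Ω) ((integrable_const β).add (hu.2.1.norm.const_mul L)) inter_subset_left⟩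
    have h2 : ⋂ m : ℕ, Ω ∩ {x | m ≤ κ0 x} = ∅ := by
      refine eq_empty_of_forall_notMem fun x hx => ?_
      have := (mem_iInter.1 hx (κ0 x + 1)).2
      simp at this
    rw [h2] at h1
    simpa using h1
  obtain ⟨m, hm⟩ := (hrest.eventually (gt_mem_nhds (show (0:ℝ) < η/3 by positivity))).exists
  set R : Set (EN N) := {x | m ≤ κ0 x} with hRdef
  have hRm : MeasurableSet R := hκ0m measurableSet_Ici
  -- truncated data
  set κ : EN N → ℕ := fun x => min (κ0 x) m with hκ
  have hκm : Measurable κ := (measurable_of_countable fun k : ℕ => min k m).comp hκ0m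
  have hκn : ∀ x, κ x < m + 1 := fun x => Nat.lt_succ_of_le (min_le_right _ _)
  set t' : ℕ → ℕ := fun k => if k < m then t (p k) else 1 with ht'
  set ψ' : ℕ → EN N → EN d := fun k => if k < m then ψ (p k) else fun _ => 0 with hψ'
  set Ξ : ℕ → Mat d N := fun k => if k < m then (p k).2.1 else 0 with hΞ
  set τ : ℕ → ℝ := fun k => if k < m then (p k).2.2 + η0 else β with hτ
  set B' : ℕ → ℝ := fun k => if k < m then B (p k) else 0 with hB'
  have hcell' : ∀ k, hg_Cell f G (p k).1 (Ξ k) (τ k) (t' k) (ψ' k) (B' k) := by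
    intro k
    by_cases hk : k < m
    · simp only [hΞ, hτ, ht', hψ', hB', if_pos hk]; exact hcell _ (hpS k)
    · simp only [hΞ, hτ, ht', hψ', hB', if_neg hk]; exact hg_cell_zero hf G _
  set BB : ℝ := ∑ k ∈ Finset.range m, B' k with hBB
  have hBle : ∀ k, B' k ≤ BB := by
    intro k
    by_cases hk : k < m
    · exact Finset.single_le_sum (fun i _ => (hcell' i).B0) (Finset.mem_range.2 hk)
    · simp only [hB', if_neg hk]; exact Finset.sum_nonneg fun i _ => (hcell' i).B0
  have hRind : Integrable (R.indicator fun x => ‖Du x‖) (volume.restrict Ω) := hu.2.1.norm.indicator hRm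
  have hkap : ∀ x, x ∉ R → κ x = κ0 x ∧ κ0 x < m := by
    intro x hx
    have : κ0 x < m := not_le.1 hx
    exact ⟨min_eq_left this.le, this⟩
  have hkap' : ∀ x, x ∈ R → κ x = m := fun x hx => min_eq_right hx
  have hU := hg_upper1 hf hR hΩ hb hu huM hκm hκn (ψ := ψ') (fun k => (hcell' k).smooth) (t := t') (fun k => (hcell' k).tpos)
    (fun k => (hcell' k).per) (B := BB) (fun k x => ((hcell' k).bd x).trans (hBle k)) (fun k x => ((hcell' k).bd' x).trans (hBle k))
    Ξ (a := fun x => 2 * η0 + R.indicator (fun x => ‖Du x‖) x) ((integrable_const _).add hRind) ?_ (η := η/3) (by positivity)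
  · filter_upwards [hU] with ε hε
    obtain ⟨v, Dv, h1, h2, h3, h4⟩ := hε
    refine ⟨v, Dv, h1, h2, h3.trans (by linarith), h4.trans ?_⟩
    have hRind1 : Integrable (R.indicator fun x => β) (volume.restrict Ω) := (integrable_const β).indicator hRm
    have hc : ∫ x in Ω, ((t' (κ x) : ℝ) ^ N)⁻¹ * ∫ z in posCube N (t' (κ x)), f z (Ξ (κ x) + fderiv ℝ (ψ' (κ x)) z) ≤
        ∫ x in Ω, (Tfhom f M (u x) (Du x) + (2 * η0 + R.indicator (fun x => β) x)) := by
      refine integral_mono_of_nonneg (Eventually.of_forall fun x => ?_) (hTI.add ((integrable_const _).add hRind1)) ?_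
      · exact mul_nonneg (by positivity) (integral_nonneg fun z => hf.nonneg _ _)
      · filter_upwards [hκae, huM] with x hx hxM
        refine (hcell' (κ x)).val.trans ?_
        by_cases hxR : x ∈ R
        · rw [indicator_of_mem hxR, hkap' x hxR]
          have := hg_Tfhom_nonneg hf (hR.tan_zero hxM) (Du x)
          simp only [hτ, lt_irrefl, if_false]
          linarith
        · obtain ⟨e1, e2⟩ := hkap x hxR
          rw [indicator_of_notMem hxR, e1]
          simp only [hτ, if_pos e2]
          have := (abs_lt.1 hx.2.2).1
          simp only at this
          linarith
    have e1 : ∫ x in Ω, (Tfhom f M (u x) (Du x) + (2 * η0 + R.indicator (fun x => β) x)) =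
        (∫ x in Ω, Tfhom f M (u x) (Du x)) + (2 * η0 * V + ∫ x in Ω, R.indicator (fun x => β) x) := by
      have i2 : Integrable (fun x => 2 * η0 + R.indicator (fun x => β) x) (volume.restrict Ω) := (integrable_const _).add hRind1
      rw [integral_add hTI i2, integral_add (integrable_const _) hRind1]
      simp [hV, mul_comm]
    have e2 : ∫ x in Ω, (2 * η0 + R.indicator (fun x => ‖Du x‖) x) = 2 * η0 * V + ∫ x in Ω, R.indicator (fun x => ‖Du x‖) x := by
      rw [integral_add (integrable_const _) hRind]
      simp [hV, mul_comm]
    have e3 : (∫ x in Ω, R.indicator (fun x => β) x) + L * (∫ x in Ω, R.indicator (fun x => ‖Du x‖) x) =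
        ∫ x in Ω ∩ R, (β + L * ‖Du x‖) := by
      rw [setIntegral_indicator hRm, setIntegral_indicator hRm, integral_add, integral_const_mul]
      · exact IntegrableOn.mono_set (t := Ω) (integrable_const β) inter_subset_left
      · exact IntegrableOn.mono_set (t := Ω) (hu.2.1.norm.const_mul L) inter_subset_left
    have e4 : L * (2 * η0 * V + ∫ x in Ω, R.indicator (fun x => ‖Du x‖) x) + 2 * η0 * V =
      (2 + 2 * L) * V * η0 + L * ∫ x in Ω, R.indicator (fun x => ‖Du x‖) x := by ring
    rw [e1] at hc
    rw [e2]
    linarith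
  · filter_upwards [hκae] with x hx y
    by_cases hxR : x ∈ R
    · rw [indicator_of_mem hxR, hkap' x hxR]
      simp only [hΞ, hψ', lt_irrefl, if_false]
      simp
      linarith
    · obtain ⟨e1, e2⟩ := hkap x hxR
      rw [indicator_of_notMem hxR, e1]
      have hc := hcell' (κ0 x)
      have h2 : ‖(fderiv ℝ G (u x)).comp (fderiv ℝ (ψ' (κ0 x)) y) - fderiv ℝ (ψ' (κ0 x)) y‖ ≤ η0 := by
        nth_rw 2 [← hc.tan y]
        rw [← ContinuousLinearMap.sub_comp]
        refine (ContinuousLinearMap.opNorm_comp_le _ _).trans ?_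
        refine (mul_le_mul_of_nonneg_left (hc.bd' y) (norm_nonneg _)).trans ?_
        simp only [hB', if_pos e2]
        exact hx.2.1.le
      have h1 : ‖Du x - Ξ (κ0 x)‖ ≤ η0 := by
        simp only [hΞ, if_pos e2]; exact hx.1.le
      linarith

end

section
open MeasureTheory Filter Set
open scoped ENNReal RealInnerProductSpace Topology NNReal Pointwise

variable {N d : ℕ}

theorem hg_upper {f : EN N → Mat d N → ℝ} {α β L : ℝ} (hf : StdIntegrand N d f α β L)
    {M : Set (EN d)} {G : EN d → EN d} {δ C : ℝ} (hR : hg_Ret M G δ C)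
    {Ω : Set (EN N)} (hΩ : IsOpen Ω) (hb : Bornology.IsBounded Ω)
    {u : EN N → EN d} {Du : EN N → Mat d N} (hu : MemW11 Ω u Du) (huM : AeIn Ω u M) :
    ∃ v : ℝ → EN N → EN d, TendstoL1 Ω v u ∧
      limsup (fun ε => FepsSet f M ε (v ε) Ω) (𝓝[>] 0) ≤ ENNReal.ofReal (∫ x in Ω, Tfhom f M (u x) (Du x)) := by
  classical
  set I := ∫ x in Ω, Tfhom f M (u x) (Du x) with hI
  let P : ℝ → ℝ → (EN N → EN d) → Prop := fun η ε v =>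
    ∫ x in Ω, ‖v x - u x‖ ≤ η ∧ FepsSet f M ε v Ω ≤ ENNReal.ofReal (I + η)
  let Q : ℝ → Set ℝ := fun ε => {η | 0 < η ∧ ∃ v, P η ε v}
  have hQ : ∀ η, 0 < η → ∀ᶠ ε in 𝓝[>] (0:ℝ), η ∈ Q ε := by
    intro η hη
    filter_upwards [hg_upper2 hf hR hΩ hb hu huM hη] with ε hε
    obtain ⟨v, Dv, h1, h2, h3, h4⟩ := hε
    refine ⟨hη, v, h3, ?_⟩
    exact (iInf₂_le Dv ⟨h1, h2⟩).trans (ENNReal.ofReal_le_ofReal h4)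
  have hbdd : ∀ ε, BddBelow (Q ε) := fun ε => ⟨0, fun η hη => hη.1.le⟩
  have hch : ∀ ε : ℝ, ∃ v : EN N → EN d, (Q ε).Nonempty → 0 < ε → ∃ η, 0 < η ∧ η < sInf (Q ε) + ε ∧ P η ε v := by
    intro ε
    by_cases h : (Q ε).Nonempty ∧ 0 < ε
    · obtain ⟨η, ⟨h1, v, hv⟩, h2⟩ := exists_lt_of_csInf_lt h.1 (show sInf (Q ε) < sInf (Q ε) + ε by linarith [h.2])
      exact ⟨v, fun _ _ => ⟨η, h1, h2, hv⟩⟩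
    · exact ⟨u, fun h1 h2 => absurd ⟨h1, h2⟩ h⟩
  choose v hv using hch
  have key : ∀ η0, 0 < η0 → ∀ᶠ ε in 𝓝[>] (0:ℝ), P η0 ε (v ε) := by
    intro η0 h0
    have h2 : ∀ᶠ ε : ℝ in 𝓝[>] 0, 1 * ε < η0 / 2 := hg_small_ev 1 (half_pos h0)
    filter_upwards [hQ (η0/2) (half_pos h0), h2, self_mem_nhdsWithin] with ε h3 h4 h5
    obtain ⟨η, h6, h7, h8, h9⟩ := hv ε ⟨_, h3⟩ h5
    have h10 : sInf (Q ε) ≤ η0/2 := csInf_le (hbdd ε) h3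
    have : η ≤ η0 := by linarith
    exact ⟨h8.trans this, h9.trans (ENNReal.ofReal_le_ofReal (by linarith))⟩
  refine ⟨v, ?_, ?_⟩
  · rw [TendstoL1, Metric.tendsto_nhds]
    intro η hη
    filter_upwards [key (η/2) (half_pos hη)] with ε hε
    rw [Real.dist_eq, sub_zero, abs_of_nonneg (integral_nonneg fun x => norm_nonneg _)]
    linarith [hε.1]
  · have h1 : ∀ η, 0 < η → limsup (fun ε => FepsSet f M ε (v ε) Ω) (𝓝[>] 0) ≤ ENNReal.ofReal (I + η) := by
      intro η hη
      refine limsup_le_of_le (by isBoundedDefault) ?_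
      filter_upwards [key η hη] with ε hε using hε.2
    have h2 : Tendsto (fun η : ℝ => ENNReal.ofReal (I + η)) (𝓝[>] 0) (𝓝 (ENNReal.ofReal (I + 0))) :=
      ((ENNReal.continuous_ofReal.comp (continuous_const.add continuous_id)).tendsto 0).mono_left nhdsWithin_le_nhds
    rw [add_zero] at h2
    refine ge_of_tendsto h2 ?_
    filter_upwards [self_mem_nhdsWithin] with η hη using h1 η hη

end


/-- Γ-convergence on the Sobolev space: the family `F_ε`
Γ-converges as `ε → 0`, for the strong `L¹(Ω;ℝ^d)`-topology, at every
`u ∈ W^{1,1}(Ω;M)` to `F_hom(u) = ∫_Ω Tf_hom(u,∇u) dx`. -/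
theorem statement_0
    (N d : ℕ) (hN : 0 < N) (hd : 0 < d)
    (Ω : Set (EN N)) (hΩo : IsOpen Ω) (hΩb : Bornology.IsBounded Ω)
    (M : Set (EN d)) (hM : IsNiceManifold d M)
    (f : EN N → Mat d N → ℝ) (α β L : ℝ) (hf : StdIntegrand N d f α β L)
    (u : EN N → EN d) (Du : EN N → Mat d N)
    (hu : MemW11 Ω u Du) (huM : AeIn Ω u M) :
    GammaConvergesAt (fun ε v => FepsSet f M ε v Ω) Ω u
      (ENNReal.ofReal (∫ x in Ω, Tfhom f M (u x) (Du x))) := by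
  obtain ⟨G, δ, C, hR⟩ := hg_ret_exists hM
  exact ⟨fun v hv => hg_lower hf hR hΩo hΩb hu huM v hv, hg_upper hf hR hΩo hΩb hu huM⟩
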